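/- arXiv:2212.02653 — 14 statements merged into one kernel-verified Lean document; each statement's English description precedes it below -/
import Mathlib

section
/- Let L be a finite first-order language with only function symbols, and let K be a uniformly locally finite class of L-structures. Then the pseudovariety generated by K — the class of all finite L-structures B for which there exist finitely many structures A₁, …, A_n ∈ K, a substructure S of the direct product A₁ × ⋯ × A_n, and a surjective homomorphism from S onto B — is also uniformly locally finite. -/
open FirstOrder Language

universe u v w

namespace Stmt0

/-- The pointwise structure on a direct product of `L`-structures. -/
instance piStructure {L : FirstOrder.Language.{v, w}} {ι : Type*} {M : ι → Type*}
    [∀ i, L.Structure (M i)] : L.Structure (∀ i, M i) where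
  funMap f x i := Structure.funMap f fun j => x j i
  RelMap r x := ∀ i, Structure.RelMap r fun j => x j i

/-- A class of `L`-structures is uniformly locally finite if for every `n` there is an `m`
such that in every member, subsets of size at most `n` generate substructures
of size at most `m`. -/
def UniformlyLocallyFinite (L : FirstOrder.Language.{v, w})
    (K : ∀ (M : Type u) [L.Structure M], Prop) : Prop :=
  ∀ n : ℕ, ∃ m : ℕ, ∀ (M : Type u) [L.Structure M], K M →
    ∀ s : Set M, s.Finite → s.ncard ≤ n →
      (Substructure.closure L s : Set M).Finite ∧
        (Substructure.closure L s : Set M).ncard ≤ m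

/-- `B` is a surjective homomorphic image of a substructure of the direct product of the
family `A`. -/
def IsHomImageOfSubProd (L : FirstOrder.Language.{v, w}) {n : ℕ} (A : Fin n → Type u)
    [∀ i, L.Structure (A i)] (B : Type u) [L.Structure B] : Prop :=
  ∃ (S : L.Substructure (∀ i, A i)) (f : S →[L] B), Function.Surjective f

/-- Membership in the pseudovariety generated by the class `K`: finite structures that are
surjective homomorphic images of substructures of finite direct products of members of `K`. -/
def InPseudovariety (L : FirstOrder.Language.{v, w}) (K : ∀ (M : Type u) [L.Structure M], Prop)
    (B : Type u) [iB : L.Structure B] : Prop :=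
  Finite B ∧ ∃ (n : ℕ) (A : Fin n → Type u) (iA : ∀ i, L.Structure (A i)),
    (∀ i, @K (A i) (iA i)) ∧ @IsHomImageOfSubProd L n A iA B iB

lemma finite_structure (L : FirstOrder.Language.{v, w}) [L.IsAlgebraic] [Finite L.Symbols]
    (k : ℕ) : Finite (L.Structure (Fin k)) := by
  have : Finite (Σ n, L.Functions n) :=
    Finite.of_injective (fun x => (Sum.inl x : L.Symbols)) Sum.inl_injective
  refine Finite.of_injective
    (fun (S : L.Structure (Fin k)) (p : Σ n, L.Functions n) (x : Fin p.1 → Fin k) =>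
      S.funMap p.2 x) ?_
  intro S T h
  refine FirstOrder.Language.Structure.ext ?_ ?_
  · funext n f x
    exact congrFun (congrFun h ⟨n, f⟩) x
  · funext n r
    exact isEmptyElim r

/-- Structures on an initial segment of the naturals with `k` marked points. -/
abbrev Pointed (L : FirstOrder.Language.{v, w}) (m k : ℕ) :=
  Σ j : Fin (m + 1), L.Structure (Fin j) × (Fin k → Fin j)

/-- Evaluation of terms in all small pointed structures. -/
def evalAll (L : FirstOrder.Language.{v, w}) (m k : ℕ) (t : L.Term (Fin k))
    (p : Pointed L m k) : Fin p.1 :=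
  @Term.realize L _ p.2.1 _ p.2.2 t

lemma realize_pi {L : FirstOrder.Language.{v, w}} {ι α : Type*} {M : ι → Type*}
    [∀ i, L.Structure (M i)] (t : L.Term α) (x : α → ∀ i, M i) (i : ι) :
    t.realize x i = t.realize (fun a => x a i) := by
  induction t with
  | var a => rfl
  | func f ts ih =>
    simp only [Term.realize_func]
    change Structure.funMap f (fun j => (ts j).realize x i) = _
    simp only [ih]

lemma realize_eq_of_evalAll {L : FirstOrder.Language.{v, w}} {m k : ℕ} {M : Type u}
    [L.Structure M] (x : Fin k → M)
    (hf : (Substructure.closure L (Set.range x) : Set M).Finite)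
    (hc : (Substructure.closure L (Set.range x) : Set M).ncard ≤ m)
    {t t' : L.Term (Fin k)} (h : evalAll L m k t = evalAll L m k t') :
    t.realize x = t'.realize x := by
  let C := Substructure.closure L (Set.range x)
  have : Finite C := hf
  have hj : Nat.card C < m + 1 := Nat.lt_succ_of_le hc
  let e : C ≃ Fin (Nat.card C) := Finite.equivFin C
  letI S : L.Structure (Fin (Nat.card C)) := e.inducedStructure
  let E : C ≃[L] Fin (Nat.card C) := e.inducedStructureEquiv
  let y : Fin k → C := fun a => ⟨x a, Substructure.subset_closure ⟨a, rfl⟩⟩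
  have h1 : t.realize (E ∘ y) = t'.realize (E ∘ y) :=
    congrFun h ⟨⟨Nat.card C, hj⟩, S, E ∘ y⟩
  rw [HomClass.realize_term, HomClass.realize_term] at h1
  have h2 := congrArg C.subtype (E.injective h1)
  rw [← HomClass.realize_term, ← HomClass.realize_term] at h2
  exact h2

lemma tuple_bound (L : FirstOrder.Language.{v, w}) [L.IsAlgebraic] [Finite L.Symbols]
    (K : ∀ (M : Type u) [L.Structure M], Prop)
    (hK : UniformlyLocallyFinite.{u} L K) (k : ℕ) :
    ∃ N : ℕ, ∀ (B : Type u) [L.Structure B], InPseudovariety L K B → ∀ x : Fin k → B,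
      (Substructure.closure L (Set.range x) : Set B).ncard ≤ N := by
  obtain ⟨m, hm⟩ := hK k
  have := finite_structure L
  refine ⟨Nat.card (∀ p : Pointed L m k, Fin p.1), ?_⟩
  rintro B _ ⟨_, n, A, iA, hA, S, f, hfs⟩ x
  have key : ∀ t t' : L.Term (Fin k), evalAll L m k t = evalAll L m k t' →
      t.realize x = t'.realize x := by
    intro t t' h
    choose g hg using hfs
    have hx : x = f ∘ (fun a => g (x a)) := by
      funext a; exact (hg _).symm
    rw [hx, HomClass.realize_term, HomClass.realize_term]
    congr 1
    apply Subtype.ext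
    change S.subtype _ = S.subtype _
    rw [← HomClass.realize_term, ← HomClass.realize_term]
    funext i
    rw [realize_pi, realize_pi]
    have := hm (A i) (hA i)
      (Set.range fun a => (S.subtype ∘ fun a => g (x a)) a i) (Set.finite_range _)
      (by
        rw [← Set.image_univ]
        refine (Set.ncard_image_le Set.finite_univ).trans ?_
        simp [Set.ncard_univ])
    exact realize_eq_of_evalAll _ this.1 this.2 h
  have ex : ∀ b : (Substructure.closure L (Set.range x) : Set B),
      ∃ t : L.Term (Fin k), t.realize x = b := by
    rintro ⟨b, hb⟩
    obtain ⟨t, ht⟩ := Substructure.mem_closure_iff_exists_term.1 hb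
    choose g hg using fun a : Set.range x => a.2
    refine ⟨t.relabel g, ?_⟩
    rw [Term.realize_relabel]
    refine Eq.trans ?_ ht
    congr 1
    funext a
    exact hg a
  choose T hT using ex
  refine Nat.card_le_card_of_injective (fun b => evalAll L m k (T b)) ?_
  intro b c h
  apply Subtype.ext
  rw [← hT b, ← hT c]
  exact key _ _ h

theorem stmt0 (L : FirstOrder.Language.{v, w}) [L.IsAlgebraic] [Finite L.Symbols]
    (K : ∀ (M : Type u) [L.Structure M], Prop)
    (hK : UniformlyLocallyFinite.{u} L K) :
    UniformlyLocallyFinite.{u} L (InPseudovariety L K) := by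
  intro n
  choose N hN using tuple_bound L K hK
  refine ⟨∑ k ∈ Finset.range (n + 1), N k, ?_⟩
  intro B _ hB s hs hn
  have : Finite B := hB.1
  refine ⟨Set.toFinite _, ?_⟩
  have : Finite s := hs
  let e : s ≃ Fin s.ncard := Finite.equivFin s
  have hr : Set.range (fun a => (e.symm a : B)) = s := by
    ext b
    constructor
    · rintro ⟨a, rfl⟩
      exact (e.symm a).2
    · intro hb
      exact ⟨e ⟨b, hb⟩, by simp⟩
  have h := hN s.ncard B hB (fun a => (e.symm a : B))
  rw [hr] at h
  exact h.trans (Finset.single_le_sum (f := N) (fun _ _ => Nat.zero_le _)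
    (Finset.mem_range.2 (Nat.lt_succ_of_le hn)))

end Stmt0
end

section
/- Let L be a finite first-order language with only function symbols, let K be a uniformly locally finite class of L-structures, and let k ≥ 1. Suppose some member of K has at least two elements. Then there is a finite set T of L-terms in the variables x₀, …, x_{k−1} such that: (1) T is closed under taking subterms; (2) for every n-ary function symbol f of L and all u₁, …, u_n ∈ T there is exactly one u′ ∈ T such that K satisfies the equation f(u₁, …, u_n) ≈ u′; and (3) every L-term in the variables x₀, …, x_{k−1} is K-equivalent to exactly one member of T. -/
open FirstOrder Language

universe u v w

namespace Stmt1

/-- A class of `L`-structures is uniformly locally finite if for every `n` there is an `m`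
such that in every member, subsets of size at most `n` generate substructures
of size at most `m`. -/
def UniformlyLocallyFinite (L : FirstOrder.Language.{v, w})
    (K : ∀ (M : Type u) [L.Structure M], Prop) : Prop :=
  ∀ n : ℕ, ∃ m : ℕ, ∀ (M : Type u) [L.Structure M], K M →
    ∀ s : Set M, s.Finite → s.ncard ≤ n →
      (Substructure.closure L s : Set M).Finite ∧
        (Substructure.closure L s : Set M).ncard ≤ m

/-- The class `K` satisfies the equation `s ≈ t` (universally quantified). -/
def SatisfiesEq (L : FirstOrder.Language.{v, w}) (K : ∀ (M : Type u) [L.Structure M], Prop)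
    {α : Type*} (s t : L.Term α) : Prop :=
  ∀ (M : Type u) [L.Structure M], K M → ∀ va : α → M, s.realize va = t.realize va

theorem finite_structure (L : FirstOrder.Language.{v, w}) [L.IsAlgebraic] [Finite L.Symbols]
    (j : ℕ) : Finite (L.Structure (Fin j)) := by
  have : Finite (Σ l, L.Functions l) :=
    Finite.of_injective (Sum.inl : _ → L.Symbols) Sum.inl_injective
  refine Finite.of_injective
    (β := ∀ s : (Σ l, L.Functions l), (Fin s.1 → Fin j) → Fin j)
    (fun S s => S.funMap s.2) ?_
  intro A B hAB
  refine Structure.ext ?_ ?_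
  · funext n f x
    exact congrFun (congrFun hAB ⟨n, f⟩) x
  · funext n r
    exact isEmptyElim r

theorem satisfiesEq_finite (L : FirstOrder.Language.{v, w}) [L.IsAlgebraic] [Finite L.Symbols]
    (K : ∀ (M : Type u) [L.Structure M], Prop)
    (hK : UniformlyLocallyFinite.{u} L K) (k : ℕ) :
    ∃ (β : Type v) (_ : Finite β) (g : L.Term (Fin k) → β),
      ∀ s t, g s = g t → SatisfiesEq L K s t := by
  obtain ⟨m, hm⟩ := hK k
  have := finite_structure L
  let D := Σ j : Fin (m + 1), L.Structure (Fin j) × (Fin k → Fin j)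
  let g : L.Term (Fin k) → (∀ d : D, Fin d.1) :=
    fun t d => @Term.realize L (Fin d.1) d.2.1 _ d.2.2 t
  have hfin : Finite (∀ d : D, Fin d.1) := inferInstance
  obtain ⟨N, ⟨e⟩⟩ := Finite.exists_equiv_fin (∀ d : D, Fin d.1)
  refine ⟨ULift (Fin N), inferInstance, fun t => ⟨e (g t)⟩, ?_⟩
  intro s t hst M _ hM va
  have hst' : g s = g t := e.injective (ULift.up_injective hst)
  obtain ⟨hf, hc⟩ := hm M hM (Set.range va) (Set.finite_range va) (by
    have h := Set.ncard_image_le (f := va) (Set.finite_univ)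
    simpa [Set.ncard_univ] using h)
  let S := Substructure.closure L (Set.range va)
  have : Finite S := hf
  have hcard : Nat.card S < m + 1 := Nat.lt_succ_of_le hc
  let e' : S ≃ Fin (Nat.card S) := Finite.equivFin S
  letI str : L.Structure (Fin (Nat.card S)) := e'.inducedStructure
  let vS : Fin k → S := fun i => ⟨va i, Substructure.subset_closure ⟨i, rfl⟩⟩
  have key := congrFun hst' ⟨⟨Nat.card S, hcard⟩, str, fun i => e' (vS i)⟩
  have key' : s.realize (fun i => e' (vS i)) = t.realize (fun i => e' (vS i)) := key
  have h1 : ∀ r : L.Term (Fin k), r.realize (fun i => e' (vS i)) = e' (r.realize vS) :=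
    fun r => HomClass.realize_term (e'.inducedStructureEquiv (L := L)) (t := r) (v := vS)
  have h2 : ∀ r : L.Term (Fin k), r.realize va = S.subtype (r.realize vS) :=
    fun r => HomClass.realize_term S.subtype (t := r) (v := vS)
  rw [h1, h1] at key'
  rw [h2, h2, e'.injective key']

def Good (L : FirstOrder.Language.{v, w}) (K : ∀ (M : Type u) [L.Structure M], Prop)
    {k : ℕ} (T : Finset (L.Term (Fin k))) : Prop :=
  (∀ (n : ℕ) (f : L.Functions n) (ts : Fin n → L.Term (Fin k)),
        Term.func f ts ∈ T → ∀ i, ts i ∈ T) ∧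
  ∀ s ∈ T, ∀ t ∈ T, SatisfiesEq L K s t → s = t

theorem SatisfiesEq.symm' {L : FirstOrder.Language.{v, w}}
    {K : ∀ (M : Type u) [L.Structure M], Prop} {k : ℕ} {s t : L.Term (Fin k)}
    (h : SatisfiesEq L K s t) : SatisfiesEq L K t s := fun M _ hM va => (h M hM va).symm

theorem SatisfiesEq.trans' {L : FirstOrder.Language.{v, w}}
    {K : ∀ (M : Type u) [L.Structure M], Prop} {k : ℕ} {s t r : L.Term (Fin k)}
    (h : SatisfiesEq L K s t) (h' : SatisfiesEq L K t r) : SatisfiesEq L K s r :=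
  fun M _ hM va => (h M hM va).trans (h' M hM va)

theorem exists_max (L : FirstOrder.Language.{v, w}) [L.IsAlgebraic] [Finite L.Symbols]
    (K : ∀ (M : Type u) [L.Structure M], Prop)
    (hK : UniformlyLocallyFinite.{u} L K) (k : ℕ) :
    ∃ T : Finset (L.Term (Fin k)), Good L K T ∧
      ∀ T' : Finset (L.Term (Fin k)), Good L K T' → T'.card ≤ T.card := by
  obtain ⟨β, hβ, g, hg⟩ := satisfiesEq_finite L K hK k
  have := Fintype.ofFinite β
  let A : Set ℕ := {n | ∃ T : Finset (L.Term (Fin k)), Good L K T ∧ T.card = n}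
  have hne : A.Nonempty := ⟨0, ∅, ⟨by simp, by simp⟩, rfl⟩
  have hbd : BddAbove A := by
    refine ⟨Fintype.card β, ?_⟩
    rintro n ⟨T, hT, rfl⟩
    exact Finset.card_le_card_of_injOn g (fun _ _ => Finset.mem_univ _)
      (fun s hs t ht h => hT.2 s hs t ht (hg s t h))
  obtain ⟨T, hT, hTc⟩ := Nat.sSup_mem hne hbd
  exact ⟨T, hT, fun T' hT' => hTc ▸ le_csSup hbd ⟨T', hT', rfl⟩⟩

theorem exists_rep_of_max {L : FirstOrder.Language.{v, w}}
    {K : ∀ (M : Type u) [L.Structure M], Prop} {k : ℕ} {T : Finset (L.Term (Fin k))}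
    (hT : Good L K T)
    (hmax : ∀ T' : Finset (L.Term (Fin k)), Good L K T' → T'.card ≤ T.card)
    (t : L.Term (Fin k))
    (hsub : ∀ (n : ℕ) (f : L.Functions n) (ts : Fin n → L.Term (Fin k)),
        Term.func f ts = t → ∀ i, ts i ∈ T) :
    ∃ u ∈ T, SatisfiesEq L K t u := by
  classical
  by_contra! hno
  have hnot : t ∉ T := fun h => hno t h (fun _ _ _ _ => rfl)
  have := hmax (insert t T) ⟨?_, ?_⟩
  · rw [Finset.card_insert_of_notMem hnot] at this
    omega
  · intro n f ts h i
    rcases Finset.mem_insert.1 h with h | h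
    · exact Finset.mem_insert_of_mem (hsub n f ts h i)
    · exact Finset.mem_insert_of_mem (hT.1 n f ts h i)
  · intro a ha b hb hab
    rcases Finset.mem_insert.1 ha with ha' | ha' <;>
      rcases Finset.mem_insert.1 hb with hb' | hb'
    · exact ha'.trans hb'.symm
    · exact absurd (ha' ▸ hab) (hno b hb')
    · exact absurd (hb' ▸ hab.symm') (hno a ha')
    · exact hT.2 a ha' b hb' hab

theorem stmt1 (L : FirstOrder.Language.{v, w}) [L.IsAlgebraic] [Finite L.Symbols]
    (K : ∀ (M : Type u) [L.Structure M], Prop)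
    (hK : UniformlyLocallyFinite.{u} L K) (k : ℕ) (hk : 1 ≤ k)
    (hbig : ∃ (M : Type u) (iM : L.Structure M), @K M iM ∧ ∃ a b : M, a ≠ b) :
    ∃ T : Finset (L.Term (Fin k)),
      -- (1) closed under taking subterms
      (∀ (n : ℕ) (f : L.Functions n) (ts : Fin n → L.Term (Fin k)),
        Term.func f ts ∈ T → ∀ i, ts i ∈ T) ∧
      -- (2) for every function symbol applied to members of T, exactly one
      --     `K`-equivalent member of T
      (∀ (n : ℕ) (f : L.Functions n) (u : Fin n → L.Term (Fin k)), (∀ i, u i ∈ T) →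
        ∃! u' : L.Term (Fin k), u' ∈ T ∧ SatisfiesEq L K (Term.func f u) u') ∧
      -- (3) every term is `K`-equivalent to exactly one member of T
      (∀ t : L.Term (Fin k), ∃! u : L.Term (Fin k), u ∈ T ∧ SatisfiesEq L K t u) := by
  obtain ⟨T, hT, hmax⟩ := exists_max L K hK k
  have hrep : ∀ t : L.Term (Fin k), ∃ u ∈ T, SatisfiesEq L K t u := by
    intro t
    induction t with
    | var x => exact exists_rep_of_max hT hmax _ (fun n f ts h => by cases h)
    | func f ts ih =>
      choose u hu hus using ih
      obtain ⟨r, hr, hrs⟩ := exists_rep_of_max hT hmax (Term.func f u) (by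
        intro n f' ts' h i
        cases h
        exact hu i)
      refine ⟨r, hr, SatisfiesEq.trans' ?_ hrs⟩
      intro M _ hM va
      simp only [Term.realize]
      congr 1
      funext i
      exact hus i M hM va
  have h3 : ∀ t : L.Term (Fin k), ∃! u : L.Term (Fin k), u ∈ T ∧ SatisfiesEq L K t u := by
    intro t
    obtain ⟨u, hu, hus⟩ := hrep t
    exact ⟨u, ⟨hu, hus⟩, fun y hy => hT.2 y hy.1 u hu (hy.2.symm'.trans' hus)⟩
  exact ⟨T, hT.1, fun n f u _ => h3 _, h3⟩

end Stmt1
end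

section
/- Let G = (V, E) be a finite directed graph and let u, v ∈ V. Let G′ be the directed graph on the vertex set V together with two new vertices a and b, with edge set E ∪ {(a, u), (v, a), (v, b)}, and let M be the graph algebra of G′. Then {a, b} is an equivalence class of some congruence on the magma M if and only if there is no directed path (possibly of length zero) from u to v in G. -/
namespace Stmt2

/-- The vertex set of the extended graph: `V` together with two new vertices `a` and `b`. -/
def Vtx (V : Type*) := V ⊕ Bool

/-- The new vertex `a`. -/
def avert (V : Type*) : Vtx V := Sum.inr true

/-- The new vertex `b`. -/
def bvert (V : Type*) : Vtx V := Sum.inr false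

/-- The edge relation of the extended graph `G′`: the edges of `G` together with
`(a, u)`, `(v, a)` and `(v, b)`. -/
def E' {V : Type*} (E : V → V → Prop) (u v : V) : Vtx V → Vtx V → Prop := fun x y =>
  (∃ x' y', x = Sum.inl x' ∧ y = Sum.inl y' ∧ E x' y') ∨
    (x = avert V ∧ y = Sum.inl u) ∨ (x = Sum.inl v ∧ y = avert V) ∨
    (x = Sum.inl v ∧ y = bvert V)

/-- The underlying set of the graph algebra of `G′`: the vertices together with a zero. -/
def GraphAlg (V : Type*) (E : V → V → Prop) (u v : V) := Option (Vtx V)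

/-- Multiplication in the graph algebra: `x·y = y` if `(x,y)` is an edge,
and `x·y = 0` otherwise (with `0 = none` absorbing). -/
noncomputable instance {V : Type*} (E : V → V → Prop) (u v : V) :
    Mul (GraphAlg V E u v) :=
  ⟨fun x y =>
    match x, y with
    | some x, some y =>
        letI := Classical.propDecidable (E' E u v x y)
        if E' E u v x y then some y else none
    | _, _ => none⟩

open Classical in
/-- The map whose kernel is the wanted congruence. -/
noncomputable def collapse {V : Type*} (E : V → V → Prop) (u v : V) :
    GraphAlg V E u v → Option (V ⊕ Unit)
  | none => none
  | some (Sum.inl x) => if Relation.ReflTransGen E u x then none else some (Sum.inl x)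
  | some (Sum.inr _) => some (Sum.inr ())

theorem edge_ll {V : Type*} {E : V → V → Prop} {u v x y : V} :
    E' E u v (Sum.inl x) (Sum.inl y) ↔ E x y := by
  constructor
  · rintro (⟨x', y', h1, h2, h⟩ | ⟨h, _⟩ | ⟨_, h⟩ | ⟨_, h⟩)
    · cases h1; cases h2; exact h
    all_goals cases h
  · intro h; exact Or.inl ⟨x, y, rfl, rfl, h⟩

theorem edge_lr {V : Type*} {E : V → V → Prop} {u v x : V} {t : Bool} :
    E' E u v (Sum.inl x) (Sum.inr t) ↔ x = v := by
  constructor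
  · rintro (⟨x', y', h1, h2, h⟩ | ⟨h, _⟩ | ⟨h, _⟩ | ⟨h, _⟩)
    · cases h2
    all_goals cases h
    all_goals rfl
  · rintro rfl
    cases t
    · exact Or.inr (Or.inr (Or.inr ⟨rfl, rfl⟩))
    · exact Or.inr (Or.inr (Or.inl ⟨rfl, rfl⟩))

theorem edge_rl {V : Type*} {E : V → V → Prop} {u v y : V} {t : Bool} :
    E' E u v (Sum.inr t) (Sum.inl y) → y = u := by
  rintro (⟨x', y', h1, h2, h⟩ | ⟨_, h⟩ | ⟨h, _⟩ | ⟨h, _⟩)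
  · cases h1
  all_goals cases h
  all_goals rfl

theorem edge_rr {V : Type*} {E : V → V → Prop} {u v : V} {s t : Bool} :
    ¬ E' E u v (Sum.inr s) (Sum.inr t) := by
  rintro (⟨x', y', h1, h2, h⟩ | ⟨_, h⟩ | ⟨h, _⟩ | ⟨h, _⟩)
  · cases h1
  all_goals cases h

section
variable {V : Type*} {E : V → V → Prop} {u v : V}

/-- The zero. -/
def zz (E : V → V → Prop) (u v : V) : GraphAlg V E u v := (none : Option (Vtx V))

/-- An old vertex. -/
def pt (E : V → V → Prop) (u v : V) (p : V) : GraphAlg V E u v :=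
  (some (Sum.inl p : V ⊕ Bool) : Option (V ⊕ Bool))

/-- A new vertex. -/
def ab (E : V → V → Prop) (u v : V) (s : Bool) : GraphAlg V E u v :=
  (some (Sum.inr s : V ⊕ Bool) : Option (V ⊕ Bool))

theorem cases3 (x : GraphAlg V E u v) :
    x = zz E u v ∨ (∃ p, x = pt E u v p) ∨ ∃ s, x = ab E u v s := by
  rcases x with _ | x | s
  · exact Or.inl rfl
  · exact Or.inr (Or.inl ⟨x, rfl⟩)
  · exact Or.inr (Or.inr ⟨s, rfl⟩)

theorem zz_mul (x : GraphAlg V E u v) : zz E u v * x = zz E u v := rfl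

theorem mul_zz (x : GraphAlg V E u v) : x * zz E u v = zz E u v := by
  cases x <;> rfl

theorem pt_pt_pos {p q : V} (h : E p q) : pt E u v p * pt E u v q = pt E u v q :=
  if_pos (edge_ll.2 h)

theorem pt_pt_neg {p q : V} (h : ¬ E p q) : pt E u v p * pt E u v q = zz E u v :=
  if_neg (fun k => h (edge_ll.1 k))

theorem pt_ab_pos (s : Bool) : pt E u v v * ab E u v s = ab E u v s :=
  if_pos (edge_lr.2 rfl)

theorem pt_ab_neg {p : V} (h : p ≠ v) (s : Bool) : pt E u v p * ab E u v s = zz E u v :=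
  if_neg (fun k => h (edge_lr.1 k))

theorem ab_pt_neg {p : V} (h : p ≠ u) (s : Bool) : ab E u v s * pt E u v p = zz E u v :=
  if_neg (fun k => h (edge_rl k))

theorem a_pt : ab E u v true * pt E u v u = pt E u v u :=
  if_pos (Or.inr (Or.inl ⟨rfl, rfl⟩))

theorem b_pt (p : V) : ab E u v false * pt E u v p = zz E u v := by
  refine if_neg ?_
  rintro (⟨x', y', h1, h2, h⟩ | ⟨h, _⟩ | ⟨h, _⟩ | ⟨h, _⟩)
  · cases h1
  all_goals cases h

theorem ab_ab (s t : Bool) : ab E u v s * ab E u v t = zz E u v :=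
  if_neg edge_rr

theorem c_zz : collapse E u v (zz E u v) = none := rfl

theorem c_pt_pos {p : V} (h : Relation.ReflTransGen E u p) :
    collapse E u v (pt E u v p) = none := if_pos h

theorem c_pt_neg {p : V} (h : ¬ Relation.ReflTransGen E u p) :
    collapse E u v (pt E u v p) = some (Sum.inl p) := if_neg h

theorem c_ab (s : Bool) : collapse E u v (ab E u v s) = some (Sum.inr ()) := rfl

/-- Elements in the zero class or `{a, b}` annihilate from the left. -/
theorem collapse_mul_left
    (hv : ¬ Relation.ReflTransGen E u v) (x y : GraphAlg V E u v)
    (hx : ∀ p, collapse E u v x ≠ some (Sum.inl p)) :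
    collapse E u v (x * y) = none := by
  rcases cases3 x with rfl | ⟨p, rfl⟩ | ⟨s, rfl⟩
  · rw [zz_mul, c_zz]
  · have hr : Relation.ReflTransGen E u p := by
      by_contra hr
      exact hx p (c_pt_neg hr)
    rcases cases3 y with rfl | ⟨q, rfl⟩ | ⟨t, rfl⟩
    · rw [mul_zz, c_zz]
    · by_cases h : E p q
      · rw [pt_pt_pos h, c_pt_pos (hr.tail h)]
      · rw [pt_pt_neg h, c_zz]
    · have : p ≠ v := by rintro rfl; exact hv hr
      rw [pt_ab_neg this, c_zz]
  · rcases cases3 y with rfl | ⟨q, rfl⟩ | ⟨t, rfl⟩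
    · rw [mul_zz, c_zz]
    · by_cases h : q = u
      · subst h
        cases s
        · rw [b_pt, c_zz]
        · rw [a_pt, c_pt_pos .refl]
      · rw [ab_pt_neg h, c_zz]
    · rw [ab_ab, c_zz]

theorem collapse_inl {x : GraphAlg V E u v} {p : V}
    (h : collapse E u v x = some (Sum.inl p)) : x = pt E u v p := by
  rcases cases3 x with rfl | ⟨q, rfl⟩ | ⟨s, rfl⟩
  · cases h
  · by_cases hr : Relation.ReflTransGen E u q
    · cases (c_pt_pos hr).symm.trans h
    · cases (c_pt_neg hr).symm.trans h
      rfl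
  · cases h

theorem collapse_inr {x : GraphAlg V E u v}
    (h : collapse E u v x = some (Sum.inr ())) : ∃ s, x = ab E u v s := by
  rcases cases3 x with rfl | ⟨q, rfl⟩ | ⟨s, rfl⟩
  · cases h
  · by_cases hr : Relation.ReflTransGen E u q
    · cases (c_pt_pos hr).symm.trans h
    · cases (c_pt_neg hr).symm.trans h
  · exact ⟨s, rfl⟩

theorem collapse_mul_none (p : V) (y : GraphAlg V E u v)
    (hy : collapse E u v y = none) : collapse E u v (pt E u v p * y) = none := by
  rcases cases3 y with rfl | ⟨q, rfl⟩ | ⟨s, rfl⟩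
  · rw [mul_zz, c_zz]
  · by_cases h : E p q
    · rw [pt_pt_pos h, hy]
    · rw [pt_pt_neg h, c_zz]
  · cases hy

theorem collapse_mul_inr {p : V} (s t : Bool) :
    collapse E u v (pt E u v p * ab E u v s) = collapse E u v (pt E u v p * ab E u v t) := by
  by_cases h : p = v
  · subst h
    rw [pt_ab_pos, pt_ab_pos, c_ab, c_ab]
  · rw [pt_ab_neg h, pt_ab_neg h]

theorem collapse_mul
    (hv : ¬ Relation.ReflTransGen E u v) {x x' y y' : GraphAlg V E u v}
    (hx : collapse E u v x = collapse E u v x') (hy : collapse E u v y = collapse E u v y') :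
    collapse E u v (x * y) = collapse E u v (x' * y') := by
  by_cases h : ∃ p, collapse E u v x = some (Sum.inl p)
  · obtain ⟨p, hp⟩ := h
    have h1 := collapse_inl hp
    have h2 := collapse_inl (hx.symm.trans hp)
    subst h1 h2
    rcases hc : collapse E u v y with _ | q | ⟨⟩
    · rw [collapse_mul_none _ _ hc, collapse_mul_none _ _ (hy.symm.trans hc)]
    · rw [collapse_inl hc, collapse_inl (hy.symm.trans hc)]
    · obtain ⟨s, rfl⟩ := collapse_inr hc
      obtain ⟨t, rfl⟩ := collapse_inr (hy.symm.trans hc)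
      exact collapse_mul_inr s t
  · push Not at h
    rw [collapse_mul_left hv _ _ h, collapse_mul_left hv _ _ (fun p => hx ▸ h p)]

end

theorem stmt2 {V : Type*} [Fintype V] (E : V → V → Prop) (u v : V) :
    (∃ c : Con (GraphAlg V E u v),
      ∃ w : GraphAlg V E u v,
        {z : GraphAlg V E u v | c z w} =
          ({some (avert V), some (bvert V)} : Set (GraphAlg V E u v))) ↔
      ¬ Relation.ReflTransGen E u v := by
  constructor
  · rintro ⟨c, w, hw⟩ hr
    have ha : c (ab E u v true) w := by
      have : ab E u v true ∈ {z : GraphAlg V E u v | c z w} := by rw [hw]; exact Or.inl rfl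
      exact this
    have hb : c (ab E u v false) w := by
      have : ab E u v false ∈ {z : GraphAlg V E u v | c z w} := by rw [hw]; exact Or.inr rfl
      exact this
    have key : ∀ x, Relation.ReflTransGen E u x → c (pt E u v x) (zz E u v) := by
      intro x hx
      induction hx with
      | refl =>
        have h := c.mul (c.trans ha (c.symm hb)) (c.refl (pt E u v u))
        rw [a_pt, b_pt] at h
        exact h
      | @tail y z _ hyz ih =>
        have h := c.mul ih (c.refl (pt E u v z))
        rw [pt_pt_pos hyz, zz_mul] at h
        exact h
    have h := c.mul (key v hr) (c.refl (ab E u v true))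
    rw [pt_ab_pos, zz_mul] at h
    have h0 : zz E u v ∈ {z : GraphAlg V E u v | c z w} := c.trans (c.symm h) ha
    rw [hw] at h0
    rcases h0 with h0 | h0 <;> cases h0
  · intro hv
    refine ⟨⟨⟨fun x y => collapse E u v x = collapse E u v y,
      fun _ => rfl, fun h => h.symm, fun h k => h.trans k⟩, fun h k => collapse_mul hv h k⟩,
      ab E u v true, ?_⟩
    ext z
    change collapse E u v z = some (Sum.inr ()) ↔ _
    constructor
    · intro h
      obtain ⟨s, rfl⟩ := collapse_inr h
      cases s
      · exact Or.inr rfl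
      · exact Or.inl rfl
    · rintro (rfl | rfl) <;> rfl

end Stmt2
end

section
/- Let L be a finite first-order language with only function symbols and let K be a class of L-structures. Suppose there is a finite set F of L-terms, each in the variables {x, z₁, z₂, …} and each containing the variable x, with the term x itself belonging to F, such that: (i) F determines principal congruences in K, meaning that for every A ∈ K and all a, b, c, d ∈ A, the pair (a, b) lies in the smallest congruence of A containing (c, d) if and only if there is a finite chain a = e₀, e₁, …, e_k = b such that for each j, either e_j = e_{j+1} or there exist t ∈ F and parameters ē in A with {t^A(c, ē), t^A(d, ē)} = {e_j, e_{j+1}}; (ii) for all A ∈ K and a, b ∈ A, if t^A(a, ē) = b for some L-term t containing the variable x and some parameters ē in A, then s^A(a, ē′) = b for some s ∈ F and parameters ē′; and (iii) K is division ordered, i.e. for every A ∈ K the divisibility preorder (a ⇝ b iff t^A(a, ē) = b for some L-term t containing x and parameters ē) is antisymmetric. Then K has definable completely meet irreducible congruences: there is a first-order L-formula π(x, y, u, v) such that for every A ∈ K and all a ≠ b in A, the relation {(c, d) ∈ A² : A ⊨ π(a, b, c, d)} is a congruence on A that does not contain (a, b) and is maximal among congruences of A not containing (a, b). -/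
open FirstOrder Language

universe u v w

namespace Stmt3

variable (L : FirstOrder.Language.{v, w})

/-- A congruence on an `L`-structure (for an algebraic language): an equivalence relation
compatible with all the operations. -/
def IsCongruence (A : Type u) [L.Structure A] (θ : A → A → Prop) : Prop :=
  Equivalence θ ∧ ∀ (n : ℕ) (f : L.Functions n) (a b : Fin n → A),
    (∀ i, θ (a i) (b i)) → θ (Structure.funMap f a) (Structure.funMap f b)

/-- `(a, b)` lies in the smallest congruence containing `(c, d)`. -/
def MemPrincipalCong {A : Type u} [L.Structure A] (c d a b : A) : Prop :=
  ∀ θ : A → A → Prop, IsCongruence L A θ → θ c d → θ a b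

/-- One step of the Maltsev chain determined by the set of terms `F`:
variable `0` plays the role of `x`, and the remaining variables are parameters. -/
def OneStep {A : Type u} [L.Structure A] (F : Finset (L.Term ℕ)) (c d : A)
    (x y : A) : Prop :=
  x = y ∨ ∃ t ∈ F, ∃ e : ℕ → A,
    ({Term.realize (Function.update e 0 c) t, Term.realize (Function.update e 0 d) t} :
        Set A) = {x, y}

/-- `a` divides `b`: `t(a, ē) = b` for some term `t` containing the variable `x`
(encoded as variable `0`) and some parameters `ē`. -/
def Divides {A : Type u} [L.Structure A] (a b : A) : Prop :=
  ∃ t : L.Term ℕ, 0 ∈ t.varFinset ∧ ∃ e : ℕ → A,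
    Term.realize (Function.update e 0 a) t = b

section Helpers

variable {L}
variable {A : Type u} [L.Structure A]

theorem mem_varFinset_subst {σ : ℕ → L.Term ℕ} {k m : ℕ} (hm : m ∈ (σ k).varFinset)
    (t : L.Term ℕ) (hk : k ∈ t.varFinset) : m ∈ (t.subst σ).varFinset := by
  induction t with
  | var j =>
    simp only [Term.varFinset, Finset.mem_singleton] at hk
    subst hk
    exact hm
  | func f ts ih =>
    simp only [Term.varFinset, Finset.mem_biUnion, Finset.mem_univ, true_and, Term.subst] at hk ⊢
    obtain ⟨i, hi⟩ := hk
    exact ⟨i, ih i hi⟩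

theorem mem_varFinset_relabel {g : ℕ → ℕ} {k : ℕ}
    (t : L.Term ℕ) (hk : k ∈ t.varFinset) : g k ∈ (t.relabel g).varFinset := by
  induction t with
  | var j =>
    simp only [Term.varFinset, Finset.mem_singleton] at hk
    subst hk
    simp
  | func f ts ih =>
    simp only [Term.varFinset, Finset.mem_biUnion, Finset.mem_univ, true_and,
      Term.relabel] at hk ⊢
    obtain ⟨i, hi⟩ := hk
    exact ⟨i, ih i hi⟩

theorem Divides.refl' (a : A) : Divides L a a :=
  ⟨Term.var 0, by simp, fun _ => a, by simp⟩

theorem Divides.trans' {a b c : A} (h₁ : Divides L a b) (h₂ : Divides L b c) :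
    Divides L a c := by
  obtain ⟨s, hs, e, rfl⟩ := h₁
  obtain ⟨t, ht, e', rfl⟩ := h₂
  refine ⟨t.subst (fun k => if k = 0 then s.relabel (fun m => 2 * m) else Term.var (2 * k + 1)),
    mem_varFinset_subst (k := 0) ?_ t ht,
    fun m => if m % 2 = 0 then e (m / 2) else e' (m / 2), ?_⟩
  · simpa using mem_varFinset_relabel (g := fun m => 2 * m) s hs
  · rw [Term.realize_subst]
    congr 1
    funext k
    by_cases hk : k = 0
    · subst hk
      simp only [if_true, Term.realize_relabel, Function.update_self]
      congr 1
      funext m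
      by_cases hm : m = 0
      · subst hm; simp
      · simp [Function.update_of_ne, hm]
    · have h2 : (2 * k + 1) / 2 = k := by omega
      have h3 : (2 * k + 1) % 2 = 1 := by omega
      simp [hk, Function.update_of_ne, h2, h3]

/-- Unary polynomials built from basic translations. -/
inductive Pol (L : FirstOrder.Language.{v, w}) {A : Type u} [L.Structure A] :
    (A → A) → Prop
  | id : Pol L (fun x => x)
  | comp (q : A → A) (n : ℕ) (f : L.Functions n) (g : Fin n → A) (i : Fin n) :
      Pol L q → Pol L (fun x => q (Structure.funMap f (Function.update g i x)))

/-- The syntactic congruence of the set of divisors of `p`. -/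
def Synt (L : FirstOrder.Language.{v, w}) {A : Type u} [L.Structure A] (p c d : A) : Prop :=
  ∀ q : A → A, Pol L q → (Divides L (q c) p ↔ Divides L (q d) p)

theorem synt_isCongruence (p : A) : IsCongruence L A (Synt L p) := by
  have heq : Equivalence (Synt L p) :=
    ⟨fun _ _ _ => Iff.rfl, fun h q hq => (h q hq).symm,
      fun h h' q hq => (h q hq).trans (h' q hq)⟩
  refine ⟨heq, ?_⟩
  intro n f a b hab
  have key : ∀ S : Finset (Fin n),
      Synt L p (Structure.funMap f a) (Structure.funMap f (S.piecewise b a)) := by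
    intro S
    induction S using Finset.induction_on with
    | empty => simpa using heq.refl _
    | insert i S hi ih =>
      refine heq.trans ih ?_
      intro q hq
      have := hab i _ (Pol.comp q n f (S.piecewise b a) i hq)
      rw [Finset.piecewise_insert]
      have h2 : Function.update (S.piecewise b a) i (a i) = S.piecewise b a := by
        rw [Function.update_eq_self_iff]
        simp [hi]
      rwa [h2] at this
  simpa using key Finset.univ

theorem cong_pol {θ : A → A → Prop} (hθ : IsCongruence L A θ) {q : A → A} (hq : Pol L q) :
    ∀ {c d : A}, θ c d → θ (q c) (q d) := by
  induction hq with
  | id => exact fun h => h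
  | comp q n f g i _ ih =>
    intro c d h
    apply ih
    apply hθ.2
    intro j
    by_cases hj : j = i
    · subst hj; simpa using h
    · simpa [Function.update_of_ne hj] using hθ.1.refl _

theorem cong_term {θ : A → A → Prop} (hθ : IsCongruence L A θ) (t : L.Term ℕ) (e : ℕ → A)
    {c d : A} (h : θ c d) :
    θ (t.realize (Function.update e 0 c)) (t.realize (Function.update e 0 d)) := by
  induction t with
  | var j =>
    by_cases hj : j = 0
    · subst hj; simpa using h
    · simpa [Function.update_of_ne hj] using hθ.1.refl _
  | func f ts ih => exact hθ.2 _ f _ _ ih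

/-- The definable version of the syntactic congruence. -/
def FSynt (F : Finset (L.Term ℕ)) (p c d : A) : Prop :=
  ∀ t ∈ F, ∀ e : ℕ → A, (Divides L (t.realize (Function.update e 0 c)) p ↔
    Divides L (t.realize (Function.update e 0 d)) p)

theorem fsynt_iff_synt (F : Finset (L.Term ℕ))
    (hT : ∀ a b c d : A,
      MemPrincipalCong L c d a b → Relation.ReflTransGen (OneStep L F c d) a b)
    (p c d : A) : FSynt F p c d ↔ Synt L p c d := by
  constructor
  · intro h q hq
    have h1 : MemPrincipalCong L c d (q c) (q d) := fun θ hθ hcd => cong_pol hθ hq hcd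
    have h2 := hT _ _ _ _ h1
    have h3 : ∀ x y, OneStep L F c d x y → (Divides L x p ↔ Divides L y p) := by
      rintro x y (rfl | ⟨t, ht, e, he⟩)
      · rfl
      · have := h t ht e
        rcases Set.pair_eq_pair_iff.1 he with ⟨h1, h2⟩ | ⟨h1, h2⟩
        · rwa [h1, h2] at this
        · rw [h1, h2] at this; exact this.symm
    generalize q d = z at h2
    clear h1
    induction h2 with
    | refl => rfl
    | tail _ hs ih => exact ih.trans (h3 _ _ hs)
  · intro h t _ e
    exact cong_term (synt_isCongruence p) t e h _ Pol.id

theorem fsynt_main (F : Finset (L.Term ℕ)) (hFvar : ∀ t ∈ F, 0 ∈ (Term.varFinset t))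
    (hFx : (Term.var 0 : L.Term ℕ) ∈ F)
    (hT : ∀ a b c d : A,
      MemPrincipalCong L c d a b → Relation.ReflTransGen (OneStep L F c d) a b)
    (p q : A) (hpq : ¬ Divides L q p) :
    IsCongruence L A (FSynt F p) ∧ ¬ FSynt F p p q ∧
      ∀ θ : A → A → Prop, IsCongruence L A θ → (∀ c d, FSynt F p c d → θ c d) → ¬ θ p q →
        ∀ c d, θ c d → FSynt F p c d := by
  refine ⟨?_, ?_, ?_⟩
  · have : FSynt F p = Synt L p := by
      funext c d
      exact propext (fsynt_iff_synt F hT p c d)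
    rw [this]
    exact synt_isCongruence p
  · intro h
    have := h _ hFx (fun _ => p)
    simp only [Term.realize_var, Function.update_self] at this
    exact hpq (this.1 (Divides.refl' p))
  · intro θ hθ hle hn c d hcd
    have key : ∀ x y, θ x y → Divides L x p → Divides L y p := by
      rintro x y hxy ⟨s, hs, e, he⟩
      by_contra hy
      apply hn
      have h1 := cong_term hθ s e hxy
      rw [he] at h1
      refine hθ.1.trans h1 (hle _ _ ?_)
      intro t ht e'
      have n1 : ∀ z, ¬ Divides L z p →
          ¬ Divides L (t.realize (Function.update e' 0 z)) p := fun z hz hd =>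
        hz (Divides.trans' ⟨t, hFvar t ht, e', rfl⟩ hd)
      refine iff_of_false (n1 _ ?_) (n1 _ hpq)
      exact fun hd => hy (Divides.trans' ⟨s, hs, e, rfl⟩ hd)
    intro t _ e
    have h1 := cong_term hθ t e hcd
    exact ⟨key _ _ h1, key _ _ (hθ.1.symm h1)⟩

/-- The term `t` with `x` replaced by the free variable `x` and the other variables
made into variables to be quantified. -/
def paramTerm {α : Type} (t : L.Term ℕ) (x : α) : L.Term (α ⊕ t.varFinset) :=
  t.restrictVar (fun k => if (k : ℕ) = 0 then Sum.inl x else Sum.inr k)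

theorem realize_paramTerm {α : Type} (t : L.Term ℕ) (x : α) (v : α → A)
    (i : t.varFinset → A) (e : ℕ → A) (he : ∀ k : t.varFinset, (k : ℕ) ≠ 0 → i k = e k) :
    (paramTerm t x).realize (Sum.elim v i) = t.realize (Function.update e 0 (v x)) := by
  apply Term.realize_restrictVar
  intro k
  by_cases hk : (k : ℕ) = 0
  · simp [hk]
  · simp [hk, Function.update_of_ne, he k hk]

theorem exists_extend (t : L.Term ℕ) (a : A) (i : t.varFinset → A) :
    ∃ e : ℕ → A, ∀ k : t.varFinset, (k : ℕ) ≠ 0 → i k = e k :=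
  ⟨fun k => if h : k ∈ t.varFinset then i ⟨k, h⟩ else a, fun k _ => by simp⟩

/-- The formula stating that variable 0 divides variable 1. -/
noncomputable def divF (F : Finset (L.Term ℕ)) : L.Formula (Fin 2) :=
  Formula.iSup (fun t : F => Formula.iExs (t : L.Term ℕ).varFinset
    (Term.equal (paramTerm (t : L.Term ℕ) (0 : Fin 2)) (Term.var (Sum.inl 1))))

theorem realize_divF (F : Finset (L.Term ℕ)) (hFvar : ∀ t ∈ F, 0 ∈ (Term.varFinset t))
    (hD : ∀ a b : A,
      Divides L a b → ∃ s ∈ F, ∃ e : ℕ → A, Term.realize (Function.update e 0 a) s = b)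
    (v : Fin 2 → A) : (divF F).Realize v ↔ Divides L (v 0) (v 1) := by
  rw [divF, Formula.realize_iSup]
  simp only [Formula.realize_iExs, Formula.realize_equal, Term.realize_var, Sum.elim_inl]
  constructor
  · rintro ⟨t, i, h⟩
    obtain ⟨e, he⟩ := exists_extend (t : L.Term ℕ) (v 0) i
    rw [realize_paramTerm _ _ _ _ e he] at h
    exact ⟨t, hFvar t t.2, e, h⟩
  · intro h
    obtain ⟨s, hs, e, he⟩ := hD _ _ h
    refine ⟨⟨s, hs⟩, fun k => e k, ?_⟩
    rw [realize_paramTerm _ _ _ _ e (fun _ _ => rfl)]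
    exact he

/-- The formula defining `FSynt p c d`. -/
noncomputable def syntF (F : Finset (L.Term ℕ)) (p c d : Fin 4) : L.Formula (Fin 4) :=
  Formula.iInf (fun t : F => Formula.iAlls (t : L.Term ℕ).varFinset
    (Formula.iff
      (BoundedFormula.subst (divF F) ![paramTerm (t : L.Term ℕ) c, Term.var (Sum.inl p)])
      (BoundedFormula.subst (divF F) ![paramTerm (t : L.Term ℕ) d, Term.var (Sum.inl p)])))

theorem realize_syntF (F : Finset (L.Term ℕ)) (hFvar : ∀ t ∈ F, 0 ∈ (Term.varFinset t))
    (hD : ∀ a b : A,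
      Divides L a b → ∃ s ∈ F, ∃ e : ℕ → A, Term.realize (Function.update e 0 a) s = b)
    (p c d : Fin 4) (v : Fin 4 → A) :
    (syntF F p c d).Realize v ↔ FSynt F (v p) (v c) (v d) := by
  have hs : ∀ {β : Type} (tf : Fin 2 → L.Term β) (w : β → A),
      Formula.Realize (BoundedFormula.subst (divF F) tf) w ↔
        Divides L ((tf 0).realize w) ((tf 1).realize w) := by
    intro β tf w
    rw [Formula.Realize, BoundedFormula.realize_subst]
    exact realize_divF F hFvar hD _
  rw [syntF, Formula.realize_iInf]
  simp only [Formula.realize_iAlls, Formula.realize_iff, hs, Matrix.cons_val_zero,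
    Matrix.cons_val_one, Term.realize_var, Sum.elim_inl]
  constructor
  · intro h t ht e
    have := h ⟨t, ht⟩ (fun k => e k)
    rwa [realize_paramTerm _ _ _ _ e (fun _ _ => rfl),
      realize_paramTerm _ _ _ _ e (fun _ _ => rfl)] at this
  · intro h t i
    obtain ⟨e, he⟩ := exists_extend (t : L.Term ℕ) (v 0) i
    rw [realize_paramTerm _ _ _ _ e he, realize_paramTerm _ _ _ _ e he]
    exact h t t.2 e

/-- The final formula. -/
noncomputable def piF (F : Finset (L.Term ℕ)) : L.Formula (Fin 4) :=
  ((divF F).relabel ![1, 0] ⊓ syntF F 1 2 3) ⊔ (∼((divF F).relabel ![1, 0]) ⊓ syntF F 0 2 3)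

theorem realize_piF (F : Finset (L.Term ℕ)) (hFvar : ∀ t ∈ F, 0 ∈ (Term.varFinset t))
    (hD : ∀ a b : A,
      Divides L a b → ∃ s ∈ F, ∃ e : ℕ → A, Term.realize (Function.update e 0 a) s = b)
    (a b c d : A) : (piF F).Realize ![a, b, c, d] ↔
      (Divides L b a ∧ FSynt F b c d) ∨ (¬ Divides L b a ∧ FSynt F a c d) := by
  rw [piF, Formula.realize_sup, Formula.realize_inf, Formula.realize_inf, Formula.realize_not,
    Formula.realize_relabel, realize_divF F hFvar hD, realize_syntF F hFvar hD,
    realize_syntF F hFvar hD]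
  rfl

end Helpers

theorem stmt3 [L.IsAlgebraic] [Finite L.Symbols]
    (K : ∀ (M : Type u) [L.Structure M], Prop)
    (F : Finset (L.Term ℕ))
    -- each member of F contains the variable x, and x itself belongs to F
    (hFvar : ∀ t ∈ F, 0 ∈ (Term.varFinset t))
    (hFx : (Term.var 0 : L.Term ℕ) ∈ F)
    -- (i) F determines principal congruences in K
    (hTFPC : ∀ (A : Type u) [L.Structure A], K A → ∀ a b c d : A,
      MemPrincipalCong L c d a b ↔ Relation.ReflTransGen (OneStep L F c d) a b)
    -- (ii) divisibility is witnessed by terms in F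
    (hFDD : ∀ (A : Type u) [L.Structure A], K A → ∀ a b : A,
      Divides L a b → ∃ s ∈ F, ∃ e : ℕ → A, Term.realize (Function.update e 0 a) s = b)
    -- (iii) K is division ordered
    (hDO : ∀ (A : Type u) [L.Structure A], K A → ∀ a b : A,
      Divides L a b → Divides L b a → a = b) :
    -- conclusion: definable completely meet irreducible congruences
    ∃ π : L.Formula (Fin 4),
      ∀ (A : Type u) [L.Structure A], K A → ∀ a b : A, a ≠ b →
        IsCongruence L A (fun c d => π.Realize ![a, b, c, d]) ∧
        ¬ π.Realize ![a, b, a, b] ∧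
        ∀ θ : A → A → Prop, IsCongruence L A θ →
          (∀ c d : A, π.Realize ![a, b, c, d] → θ c d) → ¬ θ a b →
          ∀ c d : A, θ c d → π.Realize ![a, b, c, d] := by
  refine ⟨piF F, ?_⟩
  intro A _ hA a b hab
  have hpi := realize_piF F hFvar (hFDD A hA)
  have hT : ∀ a b c d : A,
      MemPrincipalCong L c d a b → Relation.ReflTransGen (OneStep L F c d) a b :=
    fun a b c d => (hTFPC A hA a b c d).1
  simp only [hpi]
  by_cases h : Divides L b a
  · have h' : ¬ Divides L a b := fun h' => hab (hDO A hA a b h' h)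
    obtain ⟨h1, h2, h3⟩ := fsynt_main F hFvar hFx hT b a h'
    simp only [h, true_and, not_true_eq_false, false_and, or_false]
    exact ⟨h1, fun hh => h2 (h1.1.symm hh),
      fun θ hθ hle hn => h3 θ hθ hle (fun hh => hn (hθ.1.symm hh))⟩
  · obtain ⟨h1, h2, h3⟩ := fsynt_main F hFvar hFx hT a b h
    simp only [h, true_and, not_false_eq_true, false_and, false_or]
    exact ⟨h1, h2, h3⟩

end Stmt3
end

section
/- Let L be a finite first-order language and let K be a class of finite L-structures. Then K is uniformly locally finite if and only if the class of all ultraproducts of families of members of K (over arbitrary nonempty index sets and ultrafilters on them) is uniformly locally finite. -/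
open FirstOrder Language

universe u v w

namespace Stmt5

/-- A class of `L`-structures is uniformly locally finite if for every `n` there is an `m`
such that in every member, subsets of size at most `n` generate substructures
of size at most `m`. -/
def UniformlyLocallyFinite (L : FirstOrder.Language.{v, w})
    (K : ∀ (M : Type u) [L.Structure M], Prop) : Prop :=
  ∀ n : ℕ, ∃ m : ℕ, ∀ (M : Type u) [L.Structure M], K M →
    ∀ s : Set M, s.Finite → s.ncard ≤ n →
      (Substructure.closure L s : Set M).Finite ∧
        (Substructure.closure L s : Set M).ncard ≤ m

/-- The class of all ultraproducts of families of members of `K`, over arbitrary nonempty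
index sets and ultrafilters on them (up to isomorphism of `L`-structures). -/
def UltraproductClass (L : FirstOrder.Language.{v, w})
    (K : ∀ (M : Type u) [L.Structure M], Prop) :
    ∀ (N : Type u) [L.Structure N], Prop :=
  fun N _ =>
    ∃ (ι : Type u) (_ : Nonempty ι) (U : Ultrafilter ι) (M : ι → Type u)
      (iM : ∀ i, L.Structure (M i)),
        (∀ i, @K (M i) (iM i)) ∧
          Nonempty (N ≃[L] (U : Filter ι).Product M)

theorem stmt5 (L : FirstOrder.Language.{v, w}) [Finite L.Symbols]
    (K : ∀ (M : Type u) [L.Structure M], Prop)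
    (hfin : ∀ (M : Type u) [L.Structure M], K M → Finite M) :
    UniformlyLocallyFinite.{u} L K ↔
      UniformlyLocallyFinite.{u} L (UltraproductClass L K) := by
  constructor
  · intro h n
    obtain ⟨m, hm⟩ := h n
    refine ⟨m, ?_⟩
    rintro N _ ⟨ι, _, U, M, iM, hK, ⟨e⟩⟩ s hs hsn
    rw [← Set.encard_le_coe_iff_finite_ncard_le]
    by_contra hcon
    rw [not_le] at hcon
    have hcon' : ((m + 1 : ℕ) : ℕ∞) ≤ (Substructure.closure L s : Set N).encard := by
      push_cast
      exact Order.add_one_le_of_lt hcon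
    obtain ⟨T, hT, hTc⟩ := Set.exists_subset_encard_eq hcon'
    have hTfin : T.Finite := Set.finite_of_encard_eq_coe hTc
    have : Finite T := hTfin
    have hterm : ∀ y : T, ∃ t : L.Term s, t.realize ((↑) : s → N) = y := fun y =>
      Substructure.mem_closure_iff_exists_term.1 (hT y.2)
    choose t ht using hterm
    have hrep : ∀ z : s, ∃ x : ∀ a, M a, (x : (U : Filter ι).Product M) = e z := fun z =>
      Quotient.exists_rep (e z)
    choose x hx using hrep
    have hey : ∀ y : T, e y =
        ((fun a => (t y).realize fun i => x i a : ∀ a, M a) : (U : Filter ι).Product M) := by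
      intro y
      rw [← ht y, ← HomClass.realize_term, ← Ultraproduct.term_realize_cast]
      congr 1
      funext i
      exact (hx i).symm
    have hev : ∀ᶠ a in (U : Filter ι), ∀ y z : T, y ≠ z →
        (t y).realize (fun i => x i a) ≠ (t z).realize (fun i => x i a) := by
      rw [Filter.eventually_all]
      intro y
      rw [Filter.eventually_all]
      intro z
      by_cases hyz : y = z
      · exact Filter.Eventually.of_forall fun a h => absurd hyz h
      · have h1 : ¬ ∀ᶠ a in (U : Filter ι),
            (t y).realize (fun i => x i a) = (t z).realize (fun i => x i a) := by
          intro hh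
          apply hyz
          apply Subtype.ext
          apply e.injective
          rw [hey, hey]
          exact Quotient.sound hh
        rw [← Ultrafilter.eventually_not] at h1
        exact h1.mono fun a ha _ => ha
    obtain ⟨a, ha⟩ := hev.exists
    have : Finite s := hs
    have hR : (Set.range fun i : s => x i a).ncard ≤ n := by
      rw [← Set.image_univ]
      refine (Set.ncard_image_le Set.finite_univ).trans ?_
      rwa [Set.ncard_univ, Nat.card_coe_set_eq]
    have hcl := hm (M a) (hK a) _ (Set.finite_range fun i : s => x i a) hR
    rw [← Set.encard_le_coe_iff_finite_ncard_le] at hcl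
    have hinj : Function.Injective fun y : T => (t y).realize fun i => x i a := by
      intro y z hyz
      by_contra hne
      exact ha y z hne hyz
    have hsub : (Set.range fun y : T => (t y).realize fun i => x i a) ⊆
        (Substructure.closure L (Set.range fun i : s => x i a) : Set (M a)) := by
      rintro _ ⟨y, rfl⟩
      exact Term.realize_mem _ _ fun i => Substructure.subset_closure ⟨i, rfl⟩
    have h2 := (Set.encard_le_encard hsub).trans hcl
    rw [← Set.image_univ, hinj.encard_image, Set.encard_univ, ENat.card_coe_set_eq, hTc] at h2
    have h3 : m + 1 ≤ m := by exact_mod_cast h2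
    omega
  · intro h n
    obtain ⟨m, hm⟩ := h n
    refine ⟨m, fun M _ hM s hs hsn => hm M ?_ s hs hsn⟩
    let q : M → ((pure PUnit.unit : Ultrafilter PUnit.{u+1}) : Filter PUnit.{u+1}).Product
        (fun _ => M) := fun x => Quotient.mk _ (fun _ => x)
    have hq : Function.Bijective q := by
      constructor
      · intro x y hxy
        have h1 : ∀ᶠ _ in ((pure PUnit.unit : Ultrafilter PUnit.{u+1}) : Filter PUnit.{u+1}),
          x = y := Quotient.exact hxy
        exact h1.exists.choose_spec
      · intro z
        obtain ⟨f, rfl⟩ := Quotient.exists_rep z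
        exact ⟨f PUnit.unit, rfl⟩
    refine ⟨PUnit, inferInstance, pure PUnit.unit, fun _ => M, fun _ => inferInstance,
      fun _ => hM, ⟨⟨Equiv.ofBijective q hq, ?_, ?_⟩⟩⟩
    · intro k f v
      exact (Ultraproduct.funMap_cast (u := pure PUnit.unit) f (fun i _ => v i)).symm
    · intro k r v
      have h1 := relMap_quotient_mk' (s := Filter.productSetoid
        ((pure PUnit.unit : Ultrafilter PUnit.{u+1}) : Filter PUnit.{u+1}) (fun _ => M))
        (ps := Ultraproduct.setoidPrestructure (fun _ => M) (pure PUnit.unit)) r (fun i _ => v i)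
      refine Iff.trans h1 ?_
      exact Filter.eventually_const

end Stmt5
end

section
/- Let L be a finite first-order language with only function symbols and let K be a class of finite L-structures that is uniformly locally finite and is closed under substructures, finite direct products, and surjective homomorphic images. Then for every finite L-structure B, B lies in HSP(K) if and only if B ∈ K; that is, K is exactly the class of finite members of the variety generated by K. -/
open FirstOrder Language

universe u v w

namespace Stmt6

/-- The pointwise structure on a direct product of `L`-structures. -/
instance piStructure {L : FirstOrder.Language.{v, w}} {ι : Type*} {M : ι → Type*}
    [∀ i, L.Structure (M i)] : L.Structure (∀ i, M i) where
  funMap f x i := Structure.funMap f fun j => x j i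
  RelMap r x := ∀ i, Structure.RelMap r fun j => x j i

/-- A class of `L`-structures is uniformly locally finite if for every `n` there is an `m`
such that in every member, subsets of size at most `n` generate substructures
of size at most `m`. -/
def UniformlyLocallyFinite (L : FirstOrder.Language.{v, w})
    (K : ∀ (M : Type u) [L.Structure M], Prop) : Prop :=
  ∀ n : ℕ, ∃ m : ℕ, ∀ (M : Type u) [L.Structure M], K M →
    ∀ s : Set M, s.Finite → s.ncard ≤ n →
      (Substructure.closure L s : Set M).Finite ∧
        (Substructure.closure L s : Set M).ncard ≤ m

/-- `B` lies in `HSP(K)`: it is a surjective homomorphic image of a substructure of a direct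
product (over an arbitrary index set) of members of `K`. -/
def InHSP (L : FirstOrder.Language.{v, w}) (K : ∀ (M : Type u) [L.Structure M], Prop)
    (B : Type u) [L.Structure B] : Prop :=
  ∃ (ι : Type u) (A : ι → Type u) (iA : ∀ i, L.Structure (A i)),
    (∀ i, @K (A i) (iA i)) ∧
      ∃ (S : L.Substructure (∀ i, A i)) (f : S →[L] B), Function.Surjective f


/-- Reindexing a product along a map of index sets is a homomorphism. -/
def reindex (L : FirstOrder.Language.{v, w}) {ι κ : Type*} (A : ι → Type*)
    [∀ i, L.Structure (A i)] (j : κ → ι) : (∀ i, A i) →[L] (∀ k, A (j k)) where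
  toFun x k := x (j k)
  map_fun' _ _ := rfl
  map_rel' _ _ h k := h (j k)

/-- Finitely many elements of a product are separated by finitely many coordinates. -/
theorem exists_separating {ι : Type*} (A : ι → Type*) (F : Set (∀ i, A i)) (hF : F.Finite) :
    ∃ (n : ℕ) (j : Fin n → ι), ∀ x ∈ F, ∀ y ∈ F, (∀ k, x (j k) = y (j k)) → x = y := by
  classical
  have : Finite F := hF
  let P := {p : F × F // p.1.1 ≠ p.2.1}
  have hp : ∀ p : P, ∃ i, p.1.1.1 i ≠ p.1.2.1 i := fun p => Function.ne_iff.mp p.2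
  choose c hc using hp
  obtain ⟨n, ⟨e⟩⟩ := Finite.exists_equiv_fin P
  refine ⟨n, fun k => c (e.symm k), fun x hx y hy h => ?_⟩
  by_contra hne
  let p : P := ⟨(⟨x, hx⟩, ⟨y, hy⟩), hne⟩
  apply hc p
  have h' : x (c (e.symm (e p))) = y (c (e.symm (e p))) := h (e p)
  have he : e.symm (e p) = p := e.symm_apply_apply p
  rw [he] at h'
  exact h'

theorem stmt6 (L : FirstOrder.Language.{v, w}) [L.IsAlgebraic] [Finite L.Symbols]
    (K : ∀ (M : Type u) [L.Structure M], Prop)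
    -- K is a class of finite structures
    (hfin : ∀ (M : Type u) [L.Structure M], K M → Finite M)
    -- K is uniformly locally finite
    (hulf : UniformlyLocallyFinite.{u} L K)
    -- K is closed under substructures
    (hS : ∀ (M : Type u) [L.Structure M], K M → ∀ S : L.Substructure M, K S)
    -- K is closed under finite direct products
    (hP : ∀ (n : ℕ) (A : Fin n → Type u) (iA : ∀ i, L.Structure (A i)),
      (∀ i, @K (A i) (iA i)) → K (∀ i, A i))
    -- K is closed under surjective homomorphic images
    (hH : ∀ (M N : Type u) [L.Structure M] [L.Structure N], K M →
      (∃ f : M →[L] N, Function.Surjective f) → K N) :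
    ∀ (B : Type u) [L.Structure B], Finite B → (InHSP L K B ↔ K B) := by
  intro B _ hB
  constructor
  · rintro ⟨ι, A, iA, hA, S, f, hf⟩
    choose g hg using hf
    let s : Set (∀ i, A i) := Set.range fun b => (g b : ∀ i, A i)
    have hs : s.Finite := Set.finite_range _
    let T : L.Substructure (∀ i, A i) := Substructure.closure L s
    have hTS : T ≤ S := by
      refine Substructure.closure_le.mpr ?_
      rintro _ ⟨b, rfl⟩
      exact (g b).2
    obtain ⟨m, hm⟩ := hulf s.ncard
    have hT : (T : Set (∀ i, A i)).Finite := by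
      by_contra hinf
      obtain ⟨t, ht, htc⟩ := Set.Infinite.exists_subset_card_eq hinf (m + 1)
      obtain ⟨n, j, hj⟩ := exists_separating A (t : Set (∀ i, A i)) t.finite_toSet
      have hk := hP n (fun k => A (j k)) (fun k => iA (j k)) (fun k => hA (j k))
      obtain ⟨h1, h2⟩ := hm _ hk (reindex L A j '' s) (hs.image _) (Set.ncard_image_le hs)
      rw [← Substructure.map_closure] at h1 h2
      have hsub : reindex L A j '' (t : Set (∀ i, A i)) ⊆
          ((Substructure.closure L s).map (reindex L A j) : Set _) := by
        rintro _ ⟨x, hx, rfl⟩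
        exact ⟨x, ht hx, rfl⟩
      have h3 := Set.ncard_le_ncard hsub h1
      have hi : Set.InjOn (reindex L A j) (t : Set (∀ i, A i)) :=
        fun x hx y hy h => hj x hx y hy fun k => congrFun h k
      rw [hi.ncard_image, Set.ncard_coe_finset] at h3
      omega
    obtain ⟨n, j, hj⟩ := exists_separating A (T : Set (∀ i, A i)) hT
    have hk := hP n (fun k => A (j k)) (fun k => iA (j k)) (fun k => hA (j k))
    have hk' := hS _ hk (T.map (reindex L A j))
    have hinv : ∀ y : T.map (reindex L A j), ∃ x : T, reindex L A j x = y := by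
      rintro ⟨_, x, hx, rfl⟩
      exact ⟨⟨x, hx⟩, rfl⟩
    choose r hr using hinv
    have hinj : ∀ x y : T, reindex L A j x = reindex L A j y → x = y := fun x y h =>
      Subtype.ext (hj x x.2 y y.2 fun k => congrFun h k)
    refine hH _ B hk' ⟨⟨fun y => f (Substructure.inclusion hTS (r y)), ?_, ?_⟩, ?_⟩
    · intro a F x
      have : r (Structure.funMap F x) = Structure.funMap F (r ∘ x) := by
        apply hinj
        rw [hr]
        have h1 : ((Structure.funMap F (r ∘ x) : T) : ∀ i, A i)
            = Structure.funMap F (fun i => ((r (x i) : T) : ∀ i, A i)) := rfl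
        rw [h1, FirstOrder.Language.Hom.map_fun]
        have h2 : (reindex L A j ∘ fun i => ((r (x i) : T) : ∀ i, A i)) = fun i => (x i).1 :=
          funext fun i => hr (x i)
        rw [h2]
        rfl
      rw [this, FirstOrder.Language.Embedding.map_fun, FirstOrder.Language.Hom.map_fun]
      rfl
    · intro a R
      exact isEmptyElim R
    · intro b
      have hb : (g b : ∀ i, A i) ∈ T := Substructure.subset_closure ⟨b, rfl⟩
      refine ⟨⟨reindex L A j (g b), g b, hb, rfl⟩, ?_⟩
      have : r ⟨reindex L A j (g b), g b, hb, rfl⟩ = ⟨g b, hb⟩ := hinj _ _ (hr _)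
      change f (Substructure.inclusion hTS (r _)) = b
      rw [this]
      exact hg b
  · intro hK
    refine ⟨PUnit, fun _ => B, fun _ => inferInstance, fun _ => hK, ⊤,
      ⟨fun x => x.1 PUnit.unit, fun _ _ => rfl, fun R => isEmptyElim R⟩, fun b => ?_⟩
    exact ⟨⟨fun _ => b, trivial⟩, rfl⟩


end Stmt6
end

section
/- Let L be a finite first-order language and let Φ be a universal L-sentence such that the class of all (finite or infinite) models of Φ is uniformly locally finite and the class of finite models of Φ is closed under substructures and finite direct products. Then Φ has exactly the same models, over all L-structures, as some universal Horn L-sentence. -/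
open FirstOrder Language

universe u v w

namespace Stmt7

variable {L : FirstOrder.Language.{v, w}} {α : Type*} {n : ℕ}

/-- The pointwise structure on a direct product of `L`-structures. -/
instance piStructure {ι : Type*} {M : ι → Type*}
    [∀ i, L.Structure (M i)] : L.Structure (∀ i, M i) where
  funMap f x i := Structure.funMap f fun j => x j i
  RelMap r x := ∀ i, Structure.RelMap r fun j => x j i

/-- A class of `L`-structures is uniformly locally finite if for every `n` there is an `m`
such that in every member, subsets of size at most `n` generate substructures
of size at most `m`. -/
def UniformlyLocallyFinite (L : FirstOrder.Language.{v, w})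
    (K : ∀ (M : Type u) [L.Structure M], Prop) : Prop :=
  ∀ n : ℕ, ∃ m : ℕ, ∀ (M : Type u) [L.Structure M], K M →
    ∀ s : Set M, s.Finite → s.ncard ≤ n →
      (Substructure.closure L s : Set M).Finite ∧
        (Substructure.closure L s : Set M).ncard ≤ m

/-- A sentence is universal if it is a universally quantified quantifier-free formula. -/
def IsUniversalSentence (Φ : L.Sentence) : Prop :=
  ∃ (m : ℕ) (ψ : L.BoundedFormula Empty m), ψ.IsQF ∧ Φ = ψ.alls

/-- Disjunctions of negated atomic formulas (including the empty disjunction `⊥`). -/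
inductive IsNegClause : L.BoundedFormula α n → Prop
  | falsum : IsNegClause ⊥
  | negAtom {φ : L.BoundedFormula α n} : φ.IsAtomic → IsNegClause φ.not
  | sup {φ ψ : L.BoundedFormula α n} : IsNegClause φ → IsNegClause ψ →
      IsNegClause (φ ⊔ ψ)

/-- A Horn clause: a disjunction of atomic and negated atomic formulas with at most one
unnegated disjunct. -/
inductive IsHornClause : L.BoundedFormula α n → Prop
  | ofNeg {φ : L.BoundedFormula α n} : IsNegClause φ → IsHornClause φ
  | atom {φ : L.BoundedFormula α n} : φ.IsAtomic → IsHornClause φ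
  | withPos {φ ψ : L.BoundedFormula α n} : IsNegClause φ → ψ.IsAtomic →
      IsHornClause (φ ⊔ ψ)

/-- A finite conjunction of Horn clauses. -/
inductive IsHornConj : L.BoundedFormula α n → Prop
  | clause {φ : L.BoundedFormula α n} : IsHornClause φ → IsHornConj φ
  | inf {φ ψ : L.BoundedFormula α n} : IsHornConj φ → IsHornConj ψ → IsHornConj (φ ⊓ ψ)

/-- A universal Horn sentence: a universally quantified finite conjunction of Horn clauses. -/
def IsUniversalHornSentence (Φ : L.Sentence) : Prop :=
  ∃ (m : ℕ) (ψ : L.BoundedFormula Empty m), IsHornConj ψ ∧ Φ = ψ.alls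

/-- A model of `Φ` together with an `m`-tuple. -/
structure PModel (Φ : L.Sentence) (m : ℕ) where
  M : Type u
  str : L.Structure M
  mod : M ⊨ Φ
  v : Fin m → M

attribute [instance] PModel.str

/-- Satisfaction of a formula at the distinguished tuple. -/
def PModel.Sat {Φ : L.Sentence} {m : ℕ} (X : PModel.{u} Φ m) (φ : L.BoundedFormula Empty m) :
    Prop :=
  φ.Realize (default : Empty → X.M) X.v

theorem realize_alls_iff {m : ℕ} (ψ : L.BoundedFormula Empty m) (M : Type u) [L.Structure M] :
    (M ⊨ ψ.alls) ↔ ∀ c : Fin m → M, ψ.Realize (default : Empty → M) c := by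
  unfold Sentence.Realize
  exact BoundedFormula.realize_alls

theorem term_realize_pi {ι : Type*} {β : Type*} {A : ι → Type*} [∀ i, L.Structure (A i)]
    (t : L.Term β) (x : β → ∀ i, A i) (i : ι) :
    t.realize x i = t.realize (fun b => x b i) := by
  induction t with
  | var b => rfl
  | func f ts ih =>
    simp only [Term.realize_func]
    change Structure.funMap f (fun j => (ts j).realize x i) = _
    congr 1
    funext j
    exact ih j

theorem elim_pi {ι : Type*} {A : ι → Type*} {m : ℕ} (w : ∀ i, Fin m → A i) (i : ι) :
    (fun b => Sum.elim (default : Empty → ∀ i, A i) (fun k i => w i k) b i)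
      = Sum.elim (default : Empty → A i) (w i) := by
  funext b
  rcases b with b | b
  · exact b.elim
  · rfl

theorem atomic_pi {ι : Type*} {A : ι → Type*} [∀ i, L.Structure (A i)] {m : ℕ}
    (w : ∀ i, Fin m → A i) {φ : L.BoundedFormula Empty m} (h : φ.IsAtomic) :
    φ.Realize (default : Empty → ∀ i, A i) (fun k i => w i k) ↔
      ∀ i, φ.Realize (default : Empty → A i) (w i) := by
  cases h with
  | equal t₁ t₂ =>
    simp only [BoundedFormula.realize_bdEqual, funext_iff, term_realize_pi, elim_pi]
  | rel R ts =>
    simp only [BoundedFormula.realize_rel]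
    change (∀ i, Structure.RelMap R fun j =>
      (ts j).realize (Sum.elim (default : Empty → ∀ i, A i) (fun k i => w i k)) i) ↔ _
    simp only [term_realize_pi, elim_pi]

theorem qf_congr {m : ℕ} {M N : Type*} [L.Structure M] [L.Structure N]
    (a : Fin m → M) (b : Fin m → N)
    (hab : ∀ φ : L.BoundedFormula Empty m, φ.IsAtomic →
      (φ.Realize (default : Empty → M) a ↔ φ.Realize (default : Empty → N) b))
    {ψ : L.BoundedFormula Empty m} (h : ψ.IsQF) :
    ψ.Realize (default : Empty → M) a ↔ ψ.Realize (default : Empty → N) b := by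
  induction h with
  | falsum => exact Iff.rfl
  | of_isAtomic h => exact hab _ h
  | imp _ _ h₁ h₂ => simp only [BoundedFormula.realize_imp, h₁, h₂]

theorem exists_neg {m : ℕ} (P : Set (L.BoundedFormula Empty m)) (hP : P.Finite)
    (hA : ∀ p ∈ P, p.IsAtomic) :
    ∃ χ : L.BoundedFormula Empty m, IsNegClause χ ∧
      ∀ (M : Type u) [L.Structure M] (c : Fin m → M),
        χ.Realize (default : Empty → M) c ↔ ∃ p ∈ P, ¬ p.Realize (default : Empty → M) c := by
  induction P, hP using Set.Finite.induction_on with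
  | empty => exact ⟨⊥, .falsum, by simp⟩
  | @insert a s _ _ ih =>
    obtain ⟨χ, h1, h2⟩ := ih fun p hp => hA p (Set.mem_insert_of_mem _ hp)
    refine ⟨a.not ⊔ χ, .sup (.negAtom (hA a (Set.mem_insert _ _))) h1, fun M _ c => ?_⟩
    simp [h2]

theorem exists_conj {m : ℕ} (K : Set (L.BoundedFormula Empty m)) (hK : K.Finite)
    (hne : K.Nonempty) (hA : ∀ p ∈ K, IsHornClause p) :
    ∃ χ : L.BoundedFormula Empty m, IsHornConj χ ∧
      ∀ (M : Type u) [L.Structure M] (c : Fin m → M),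
        χ.Realize (default : Empty → M) c ↔ ∀ p ∈ K, p.Realize (default : Empty → M) c := by
  induction K, hK using Set.Finite.induction_on with
  | empty => simp at hne
  | @insert a s _ _ ih =>
    have ha := hA a (Set.mem_insert _ _)
    rcases s.eq_empty_or_nonempty with rfl | hs
    · exact ⟨a, .clause ha, by simp⟩
    obtain ⟨χ, h1, h2⟩ := ih hs fun p hp => hA p (Set.mem_insert_of_mem _ hp)
    refine ⟨a ⊓ χ, .inf (.clause ha) h1, fun M _ c => ?_⟩
    simp [h2]

theorem exists_fin {m : ℕ} {Φ : L.Sentence} (hU : IsUniversalSentence Φ)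
    (hulf : UniformlyLocallyFinite.{u} L (fun (M : Type u) [L.Structure M] => M ⊨ Φ))
    (X : PModel.{u} Φ m) :
    ∃ Y : PModel.{u} Φ m, Finite Y.M ∧ ∀ φ : L.BoundedFormula Empty m, φ.IsAtomic →
      (Y.Sat φ ↔ X.Sat φ) := by
  obtain ⟨k, ψ, hψ, rfl⟩ := hU
  obtain ⟨N, hN⟩ := hulf m
  have hr : (Set.range X.v).ncard ≤ m := by
    have := Set.ncard_image_le (f := X.v) (s := Set.univ) Set.finite_univ
    simpa [Set.image_univ, Set.ncard_univ] using this
  obtain ⟨h1, -⟩ := hN X.M X.mod _ (Set.finite_range X.v) hr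
  let S := Substructure.closure L (Set.range X.v)
  have hmod : (↥S) ⊨ ψ.alls := by
    have hX := (realize_alls_iff ψ X.M).1 X.mod
    rw [realize_alls_iff]
    intro c
    rw [← hψ.realize_embedding S.subtype, Subsingleton.elim (S.subtype ∘ default) default]
    exact hX _
  refine ⟨⟨S, inferInstance, hmod, fun i => ⟨X.v i, Substructure.subset_closure ⟨i, rfl⟩⟩⟩,
    h1, fun φ hφ => ?_⟩
  unfold PModel.Sat
  rw [← hφ.isQF.realize_embedding S.subtype]
  rw [Subsingleton.elim (S.subtype ∘ default) default]
  rfl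

theorem exists_prod {m : ℕ} {Φ : L.Sentence} (hU : IsUniversalSentence Φ)
    (hulf : UniformlyLocallyFinite.{u} L (fun (M : Type u) [L.Structure M] => M ⊨ Φ))
    (hP : ∀ (n : ℕ) (A : Fin n → Type u) (iA : ∀ i, L.Structure (A i)),
      (∀ i, Finite (A i)) → (∀ i, (A i) ⊨ Φ) → (∀ i, A i) ⊨ Φ)
    {J : Type*} [Finite J] (X : J → PModel.{u} Φ m) :
    ∃ Y : PModel.{u} Φ m, ∀ φ : L.BoundedFormula Empty m, φ.IsAtomic →
      (Y.Sat φ ↔ ∀ j, (X j).Sat φ) := by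
  choose Z hfin hZ using fun j => exists_fin hU hulf (X j)
  obtain ⟨n, ⟨e⟩⟩ := Finite.exists_equiv_fin J
  refine ⟨⟨∀ i : Fin n, (Z (e.symm i)).M, inferInstance,
    hP n _ (fun i => (Z (e.symm i)).str) (fun i => hfin _) (fun i => (Z _).mod),
    fun k i => (Z (e.symm i)).v k⟩, fun φ hφ => ?_⟩
  refine (atomic_pi (fun i => (Z (e.symm i)).v) hφ).trans ?_
  refine Iff.trans ?_ (e.symm.forall_congr_right (q := fun j => (X j).Sat φ))
  exact forall_congr' fun i => hZ _ φ hφ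

/-- Equality of terms in all models of `Φ`. -/
def termSetoid (Φ : L.Sentence) (m : ℕ) : Setoid (L.Term (Empty ⊕ Fin m)) where
  r t t' := ∀ X : PModel.{u} Φ m, X.Sat (t.bdEqual t')
  iseqv := ⟨fun _ _ => rfl, fun h X => (h X).symm, fun h h' X => (h X).trans (h' X)⟩

theorem finite_quot {m : ℕ} {Φ : L.Sentence} (hU : IsUniversalSentence Φ)
    (hulf : UniformlyLocallyFinite.{u} L (fun (M : Type u) [L.Structure M] => M ⊨ Φ))
    (hP : ∀ (n : ℕ) (A : Fin n → Type u) (iA : ∀ i, L.Structure (A i)),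
      (∀ i, Finite (A i)) → (∀ i, (A i) ⊨ Φ) → (∀ i, A i) ⊨ Φ) :
    Finite (Quotient (termSetoid.{u} Φ m)) := by
  by_contra hinf
  rw [not_finite_iff_infinite] at hinf
  obtain ⟨N, hN⟩ := hulf m
  let g := Infinite.natEmbedding (Quotient (termSetoid.{u} Φ m))
  let t : Fin (N + 1) → L.Term (Empty ⊕ Fin m) := fun i => (g i).out
  have ht : ∀ p : {p : Fin (N + 1) × Fin (N + 1) // p.1 ≠ p.2},
      ∃ X : PModel.{u} Φ m, ¬ X.Sat ((t p.1.1).bdEqual (t p.1.2)) := by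
    rintro ⟨⟨i, j⟩, hij⟩
    by_contra! hc
    apply hij
    have : (termSetoid.{u} Φ m).r (t i) (t j) := hc
    have h2 := Quotient.out_equiv_out.1 this
    exact Fin.ext (g.injective h2)
  choose X hX using ht
  obtain ⟨Y, hY⟩ := exists_prod hU hulf hP X
  have hr : (Set.range Y.v).ncard ≤ m := by
    have := Set.ncard_image_le (f := Y.v) (s := Set.univ) Set.finite_univ
    simpa [Set.image_univ, Set.ncard_univ] using this
  obtain ⟨h1, h2⟩ := hN Y.M Y.mod _ (Set.finite_range Y.v) hr
  let f : Fin (N + 1) → Y.M := fun i => (t i).realize (Sum.elim default Y.v)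
  have hf : Function.Injective f := by
    intro i j hij
    by_contra hne
    exact hX ⟨⟨i, j⟩, hne⟩ ((hY ((t i).bdEqual (t j)) (.equal _ _)).1 hij ⟨⟨i, j⟩, hne⟩)
  have hsub : Set.range f ⊆ (Substructure.closure L (Set.range Y.v) : Set Y.M) := by
    rintro _ ⟨i, rfl⟩
    refine (t i).realize_mem _ ?_
    rintro (b | b)
    · exact b.elim
    · exact Substructure.subset_closure ⟨b, rfl⟩
  have h3 := Set.ncard_le_ncard hsub h1
  have h4 : (Set.range f).ncard = N + 1 := by
    rw [← Set.image_univ, Set.ncard_image_of_injective _ hf]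
    simp [Set.ncard_univ]
  omega

theorem exists_same {m : ℕ} {Φ : L.Sentence} (hU : IsUniversalSentence Φ)
    (hulf : UniformlyLocallyFinite.{u} L (fun (M : Type u) [L.Structure M] => M ⊨ Φ))
    (hP : ∀ (n : ℕ) (A : Fin n → Type u) (iA : ∀ i, L.Structure (A i)),
      (∀ i, Finite (A i)) → (∀ i, (A i) ⊨ Φ) → (∀ i, A i) ⊨ Φ)
    (A : Set (L.BoundedFormula Empty m)) (hfin : A.Finite) (hA : ∀ p ∈ A, p.IsAtomic)
    {M : Type u} [L.Structure M] (c : Fin m → M)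
    (hM : ∀ P ⊆ A, ∀ q ∈ A,
      (∀ X : PModel.{u} Φ m, (∀ p ∈ P, X.Sat p) → X.Sat q) →
      (∀ p ∈ P, p.Realize (default : Empty → M) c) → q.Realize (default : Empty → M) c) :
    ∃ Y : PModel.{u} Φ m, ∀ φ ∈ A, (φ.Realize (default : Empty → M) c ↔ Y.Sat φ) := by
  let P : Set (L.BoundedFormula Empty m) := {p ∈ A | p.Realize (default : Empty → M) c}
  let Q : Set (L.BoundedFormula Empty m) := {p ∈ A | ¬ p.Realize (default : Empty → M) c}
  have hQfin : Finite Q := (hfin.subset (Set.sep_subset _ _)).to_subtype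
  have h : ∀ q : Q, ∃ X : PModel.{u} Φ m, (∀ p ∈ P, X.Sat p) ∧ ¬ X.Sat q := by
    rintro ⟨q, hqA, hq⟩
    by_contra! hc
    exact hq (hM P (Set.sep_subset _ _) q hqA hc fun p hp => hp.2)
  choose X hX1 hX2 using h
  obtain ⟨Y, hY⟩ := exists_prod hU hulf hP X
  refine ⟨Y, fun φ hφ => ?_⟩
  rw [hY φ (hA φ hφ)]
  constructor
  · intro h j
    exact hX1 j φ ⟨hφ, h⟩
  · intro h
    by_contra hc
    exact hX2 ⟨φ, hφ, hc⟩ (h ⟨φ, hφ, hc⟩)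

theorem stmt7 (L : FirstOrder.Language.{v, w}) [Finite L.Symbols]
    (Φ : L.Sentence) (hU : IsUniversalSentence Φ)
    -- the class of all models of Φ is uniformly locally finite
    (hulf : UniformlyLocallyFinite.{u} L (fun (M : Type u) [L.Structure M] => M ⊨ Φ))
    -- the finite models of Φ are closed under substructures
    (hS : ∀ (M : Type u) [L.Structure M], Finite M → M ⊨ Φ →
      ∀ S : L.Substructure M, (↥S) ⊨ Φ)
    -- the finite models of Φ are closed under finite direct products
    (hP : ∀ (n : ℕ) (A : Fin n → Type u) (iA : ∀ i, L.Structure (A i)),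
      (∀ i, Finite (A i)) → (∀ i, (A i) ⊨ Φ) → (∀ i, A i) ⊨ Φ) :
    ∃ Ψ : L.Sentence, IsUniversalHornSentence Ψ ∧
      ∀ (M : Type u) [L.Structure M], (M ⊨ Φ ↔ M ⊨ Ψ) := by
  obtain ⟨m, ψ, hψ, rfl⟩ := id hU
  have hQ : Finite (Quotient (termSetoid.{u} ψ.alls m)) := finite_quot hU hulf hP
  let τ : L.Term (Empty ⊕ Fin m) → L.Term (Empty ⊕ Fin m) :=
    fun t => (Quotient.mk (termSetoid.{u} ψ.alls m) t).out
  have hτ : ∀ (t) (X : PModel.{u} ψ.alls m),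
      (τ t).realize (Sum.elim default X.v) = t.realize (Sum.elim default X.v) :=
    fun t X => Quotient.mk_out (s := termSetoid.{u} ψ.alls m) t X
  have hfF : Finite (Σ l, L.Functions l) :=
    Finite.of_injective (fun x => (Sum.inl x : L.Symbols)) Sum.inl_injective
  have hfR : Finite (Σ l, L.Relations l) :=
    Finite.of_injective (fun x => (Sum.inr x : L.Symbols)) Sum.inr_injective
  let A1 : Set (L.BoundedFormula Empty m) := Set.range
    fun p : Quotient (termSetoid.{u} ψ.alls m) × Quotient (termSetoid.{u} ψ.alls m) =>
      p.1.out.bdEqual p.2.out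
  let A2 : Set (L.BoundedFormula Empty m) := Set.range
    fun p : Σ R : (Σ l, L.Relations l), (Fin R.1 → Quotient (termSetoid.{u} ψ.alls m)) =>
      p.1.2.boundedFormula fun i => (p.2 i).out
  let A3 : Set (L.BoundedFormula Empty m) := Set.range
    fun b : Empty ⊕ Fin m => (Term.var b).bdEqual (τ (Term.var b))
  let A4 : Set (L.BoundedFormula Empty m) := Set.range
    fun p : Σ R : (Σ l, L.Functions l), (Fin R.1 → Quotient (termSetoid.{u} ψ.alls m)) =>
      (Term.func p.1.2 fun i => (p.2 i).out).bdEqual (τ (Term.func p.1.2 fun i => (p.2 i).out))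
  let A := (A1 ∪ A2) ∪ (A3 ∪ A4)
  have hAfin : A.Finite :=
    ((Set.finite_range _).union (Set.finite_range _)).union
      ((Set.finite_range _).union (Set.finite_range _))
  have hA : ∀ p ∈ A, p.IsAtomic := by
    rintro p ((⟨x, rfl⟩ | ⟨x, rfl⟩) | (⟨x, rfl⟩ | ⟨x, rfl⟩))
    · exact .equal _ _
    · exact .rel _ _
    · exact .equal _ _
    · exact .equal _ _
  -- the semantic form of the Horn axioms
  have key : ∀ (M : Type u) [L.Structure M], (∀ c : Fin m → M, ∀ P ⊆ A, ∀ q ∈ A,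
      (∀ X : PModel.{u} ψ.alls m, (∀ p ∈ P, X.Sat p) → X.Sat q) →
      (∀ p ∈ P, p.Realize (default : Empty → M) c) → q.Realize (default : Empty → M) c) →
      M ⊨ ψ.alls := by
    intro M _ hM
    rw [realize_alls_iff]
    intro c
    obtain ⟨Y, hY⟩ := exists_same hU hulf hP A hAfin hA c (hM c)
    have hMτ : ∀ t : L.Term (Empty ⊕ Fin m),
        t.realize (Sum.elim (default : Empty → M) c) = (τ t).realize (Sum.elim default c) := by
      intro t
      induction t with
      | var b =>
        have hb : (Term.var b).bdEqual (τ (Term.var b)) ∈ A := Or.inr (Or.inl ⟨b, rfl⟩)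
        exact (hY _ hb).2 (hτ _ Y).symm
      | @func l f ts ih =>
        have hb : (Term.func f fun i => τ (ts i)).bdEqual (τ (Term.func f fun i => τ (ts i))) ∈ A :=
          Or.inr (Or.inr ⟨⟨⟨l, f⟩, fun i => Quotient.mk _ (ts i)⟩, rfl⟩)
        have h1 := (hY _ hb).2 (hτ _ Y).symm
        have h2 : τ (Term.func f fun i => τ (ts i)) = τ (Term.func f ts) := by
          refine congrArg Quotient.out (Quotient.sound ?_)
          intro X
          simp only [PModel.Sat, BoundedFormula.realize_bdEqual, Term.realize_func, hτ]
        rw [h2] at h1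
        refine Eq.trans ?_ h1
        simp only [Term.realize_func, ih]
    refine (qf_congr c Y.v ?_ hψ).2 ((realize_alls_iff ψ Y.M).1 Y.mod Y.v)
    intro φ hφ
    cases hφ with
    | equal t₁ t₂ =>
      have hb : (τ t₁).bdEqual (τ t₂) ∈ A := Or.inl (Or.inl ⟨⟨Quotient.mk _ t₁, Quotient.mk _ t₂⟩, rfl⟩)
      have := hY _ hb
      simpa only [PModel.Sat, BoundedFormula.realize_bdEqual, hτ, ← hMτ] using this
    | @rel l R ts =>
      have hb : R.boundedFormula (fun i => τ (ts i)) ∈ A :=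
        Or.inl (Or.inr ⟨⟨⟨l, R⟩, fun i => Quotient.mk _ (ts i)⟩, rfl⟩)
      have := hY _ hb
      simpa only [PModel.Sat, BoundedFormula.realize_rel, hτ, ← hMτ] using this
  -- syntactic clauses
  have hclause : ∀ p : A.powerset × A, ∃ χ : L.BoundedFormula Empty m, IsHornClause χ ∧
      ∀ (M : Type u) [L.Structure M] (c : Fin m → M),
        χ.Realize (default : Empty → M) c ↔
          ((∀ r ∈ p.1.1, r.Realize (default : Empty → M) c) →
            p.2.1.Realize (default : Empty → M) c) := by
    rintro ⟨⟨P, hPA⟩, ⟨q, hq⟩⟩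
    obtain ⟨χ, h1, h2⟩ := exists_neg.{u} P (hAfin.subset hPA) fun p hp => hA p (hPA hp)
    refine ⟨χ ⊔ q, .withPos h1 (hA q hq), fun M _ c => ?_⟩
    rw [BoundedFormula.realize_sup, h2]
    constructor
    · rintro (⟨p, hp, hn⟩ | h) h'
      · exact absurd (h' p hp) hn
      · exact h
    · intro h
      by_cases h' : ∀ r ∈ P, r.Realize (default : Empty → M) c
      · exact Or.inr (h h')
      · push Not at h'
        exact Or.inl h'
  choose cl hcl1 hcl2 using hclause
  have hPfin : Finite A.powerset := hAfin.finite_subsets.to_subtype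
  have hAfinite : Finite A := hAfin.to_subtype
  let V : Set (A.powerset × A) :=
    {p | ∀ X : PModel.{u} ψ.alls m, (∀ r ∈ p.1.1, X.Sat r) → X.Sat p.2.1}
  rcases V.eq_empty_or_nonempty with hV | hV
  · refine ⟨(((Term.var (Sum.inr 0)).bdEqual (Term.var (Sum.inr 0)) :
      L.BoundedFormula Empty 1)).alls, ⟨1, _, .clause (.atom (.equal _ _)), rfl⟩, ?_⟩
    intro M _
    refine iff_of_true (key M ?_) ?_
    · intro c P hPA q hq h
      have : (⟨⟨P, hPA⟩, ⟨q, hq⟩⟩ : A.powerset × A) ∈ V := h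
      simp [hV] at this
    · rw [realize_alls_iff]
      intro c
      rfl
  · obtain ⟨χ, h1, h2⟩ := exists_conj.{u} (Set.image cl V) (V.toFinite.image cl) (hV.image cl) (by
      rintro _ ⟨p, -, rfl⟩
      exact hcl1 p)
    refine ⟨χ.alls, ⟨m, χ, h1, rfl⟩, fun M _ => ⟨fun h => ?_, fun h => key M ?_⟩⟩
    · rw [realize_alls_iff]
      intro c
      rw [h2]
      rintro _ ⟨p, hp, rfl⟩
      rw [hcl2]
      exact hp ⟨M, inferInstance, h, c⟩
    · rw [realize_alls_iff] at h
      intro c P hPA q hq hv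
      have := (h2 M c).1 (h c) _ ⟨⟨⟨P, hPA⟩, ⟨q, hq⟩⟩, hv, rfl⟩
      rwa [hcl2] at this

end Stmt7
end

section
/- Let L be a finite first-order language with only function symbols and let Φ be a universal L-sentence such that the class of all (finite or infinite) models of Φ is uniformly locally finite and the class of finite models of Φ is closed under substructures, finite direct products, and surjective homomorphic images. Then there are finitely many equations — L-sentences of the form ∀x₁ … ∀x_m (s ≈ t) with s, t L-terms — whose conjunction has exactly the same models as Φ over all L-structures. -/
open FirstOrder Language

universe u v w

namespace Stmt8

variable {L : FirstOrder.Language.{v, w}}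

/-- The pointwise structure on a direct product of `L`-structures. -/
instance piStructure {ι : Type*} {M : ι → Type*}
    [∀ i, L.Structure (M i)] : L.Structure (∀ i, M i) where
  funMap f x i := Structure.funMap f fun j => x j i
  RelMap r x := ∀ i, Structure.RelMap r fun j => x j i

/-- A class of `L`-structures is uniformly locally finite if for every `n` there is an `m`
such that in every member, subsets of size at most `n` generate substructures
of size at most `m`. -/
def UniformlyLocallyFinite (L : FirstOrder.Language.{v, w})
    (K : ∀ (M : Type u) [L.Structure M], Prop) : Prop :=
  ∀ n : ℕ, ∃ m : ℕ, ∀ (M : Type u) [L.Structure M], K M →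
    ∀ s : Set M, s.Finite → s.ncard ≤ n →
      (Substructure.closure L s : Set M).Finite ∧
        (Substructure.closure L s : Set M).ncard ≤ m

/-- A sentence is universal if it is a universally quantified quantifier-free formula. -/
def IsUniversalSentence (Φ : L.Sentence) : Prop :=
  ∃ (m : ℕ) (ψ : L.BoundedFormula Empty m), ψ.IsQF ∧ Φ = ψ.alls

/-- An equation: a universally quantified equality between two terms. -/
def IsEquation (σ : L.Sentence) : Prop :=
  ∃ (m : ℕ) (s t : L.Term (Empty ⊕ Fin m)), σ = (s.bdEqual t).alls

theorem mem_closure_range_iff {k : ℕ} {M : Type u} [L.Structure M] (g : Fin k → M) (x : M) :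
    x ∈ Substructure.closure L (Set.range g) ↔
      ∃ t : L.Term (Empty ⊕ Fin k), t.realize (Sum.elim default g) = x := by
  constructor
  · intro h
    refine Substructure.closure_induction (p := fun x => ∃ t : L.Term (Empty ⊕ Fin k),
      t.realize (Sum.elim default g) = x) h ?Hs ?Hfun
    · rintro _ ⟨i, rfl⟩
      exact ⟨Term.var (Sum.inr i), rfl⟩
    · intro n f y hy
      have hy' : ∀ i, ∃ t : L.Term (Empty ⊕ Fin k), t.realize (Sum.elim default g) = y i := hy
      choose t ht using hy'
      refine ⟨Term.func f t, ?_⟩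
      simp only [Term.realize_func, ht]
  · rintro ⟨t, rfl⟩
    refine t.realize_mem _ ?_
    rintro (e | i)
    · exact e.elim
    · exact Substructure.subset_closure ⟨i, rfl⟩

theorem hom_realize {k : ℕ} {M N : Type*} [L.Structure M] [L.Structure N] (f : M →[L] N)
    (g : Fin k → M) (t : L.Term (Empty ⊕ Fin k)) :
    t.realize (Sum.elim default (f ∘ g)) = f (t.realize (Sum.elim default g)) := by
  rw [← HomClass.realize_term, Sum.comp_elim]
  congr 2
  exact Subsingleton.elim _ _

theorem realize_sentence_alls {k : ℕ} (M : Type*) [L.Structure M]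
    (ψ : L.BoundedFormula Empty k) :
    M ⊨ (ψ.alls : L.Sentence) ↔ ∀ xs : Fin k → M, ψ.Realize default xs :=
  BoundedFormula.realize_alls

theorem qf_embedding {k : ℕ} {M N : Type*} [L.Structure M] [L.Structure N]
    {ψ : L.BoundedFormula Empty k} (hψ : ψ.IsQF) (f : M ↪[L] N) (xs : Fin k → M) :
    ψ.Realize default (f ∘ xs) ↔ ψ.Realize default xs := by
  rw [← hψ.realize_embedding f, Subsingleton.elim (f ∘ default) default]

/-- A coordinate projection. -/
def projHom [L.IsAlgebraic] {ι : Type*} {M : ι → Type*} [∀ i, L.Structure (M i)] (i : ι) :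
    (∀ i, M i) →[L] M i where
  toFun x := x i
  map_fun' _ _ := rfl
  map_rel' _ _ h := h i

/-- Existence of a finite relatively free model on `k` generators. -/
theorem exists_free [L.IsAlgebraic]
    (Φ : L.Sentence) (hU : IsUniversalSentence Φ)
    (hulf : UniformlyLocallyFinite.{u} L (fun (M : Type u) [L.Structure M] => M ⊨ Φ))
    (hP : ∀ (n : ℕ) (A : Fin n → Type u) (iA : ∀ i, L.Structure (A i)),
      (∀ i, Finite (A i)) → (∀ i, (A i) ⊨ Φ) → (∀ i, A i) ⊨ Φ) (k : ℕ) :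
    ∃ (A : Type u) (_ : L.Structure A) (g : Fin k → A), Finite A ∧ A ⊨ Φ ∧
      ∀ (M : Type u) [L.Structure M], M ⊨ Φ → ∀ (b : Fin k → M)
        (s t : L.Term (Empty ⊕ Fin k)),
        s.realize (Sum.elim default g) = t.realize (Sum.elim default g) →
        s.realize (Sum.elim default b) = t.realize (Sum.elim default b) := by
  obtain ⟨m, hm⟩ := hulf k
  have hrange : ∀ {M : Type u} (b : Fin k → M), (Set.range b).ncard ≤ k := by
    intro M b
    rw [← Set.image_univ]
    refine (Set.ncard_image_le (Set.toFinite _)).trans ?_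
    simp [Set.ncard_univ]
  let P : Set ℕ := {c | ∃ (A : Type u) (_ : L.Structure A) (g : Fin k → A), Finite A ∧ A ⊨ Φ ∧
    (Substructure.closure L (Set.range g) : Set A).ncard = c}
  have hbdd : BddAbove P := by
    refine ⟨m, ?_⟩
    rintro c ⟨A, _, g, _, hA, rfl⟩
    exact (hm A hA _ (Set.toFinite _) (hrange g)).2
  have hne : P.Nonempty := by
    let A : Fin 0 → Type u := fun _ => PUnit
    let iA : ∀ i, L.Structure (A i) := fun i => i.elim0
    have := hP 0 A iA (fun i => i.elim0) (fun i => i.elim0)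
    exact ⟨_, ∀ i, A i, @piStructure L _ A iA, fun _ i => i.elim0, inferInstance, this, rfl⟩
  obtain ⟨A, iA, g, hfin, hA, hc⟩ := Nat.sSup_mem hne hbdd
  refine ⟨A, iA, g, hfin, hA, ?_⟩
  intro M iM hM b s t hst
  obtain ⟨l, ψ, hψ, rfl⟩ := hU
  let B := Substructure.closure L (Set.range b)
  have hBfin : Finite B := (hm M hM _ (Set.finite_range b) (hrange b)).1
  have hB : B ⊨ ψ.alls := by
    rw [realize_sentence_alls] at hM ⊢
    intro xs
    rw [← qf_embedding hψ B.subtype]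
    exact hM _
  let b' : Fin k → B := fun i => ⟨b i, Substructure.subset_closure ⟨i, rfl⟩⟩
  let C : Fin 2 → Type u := Fin.cons A (Fin.cons B Fin.elim0)
  let iC : ∀ i, L.Structure (C i) :=
    Fin.cons (α := fun i => L.Structure (C i)) iA
      (Fin.cons (α := fun i : Fin 1 => L.Structure (C i.succ))
        (Substructure.inducedStructure : L.Structure B) (fun i => i.elim0))
  have hCfin : ∀ i, Finite (C i) := by
    intro i
    fin_cases i
    · exact hfin
    · exact hBfin
  have hC : ∀ i, (C i) ⊨ ψ.alls := by
    intro i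
    fin_cases i
    · exact hA
    · exact hB
  have hprod := hP 2 C iC hCfin hC
  let h : Fin k → ∀ i, C i := fun j =>
    Fin.cons (α := C) (g j) (Fin.cons (α := fun i : Fin 1 => C i.succ) (b' j) (fun i => i.elim0))
  let p0 : (∀ i, C i) →[L] A := projHom (L := L) (M := C) 0
  let p1 : (∀ i, C i) →[L] B := projHom (L := L) (M := C) 1
  have e0 : p0 ∘ h = g := rfl
  have e1 : p1 ∘ h = b' := rfl
  have himg : p0 '' (Substructure.closure L (Set.range h) : Set (∀ i, C i)) =
      (Substructure.closure L (Set.range g) : Set A) := by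
    rw [← e0, Set.range_comp, ← Substructure.map_closure]
    rfl
  have hfinprod : Finite (∀ i, C i) := inferInstance
  have hle : (Substructure.closure L (Set.range h) : Set (∀ i, C i)).ncard ≤
      (Substructure.closure L (Set.range g) : Set A).ncard := by
    rw [hc]
    exact le_csSup hbdd ⟨_, inferInstance, h, hfinprod, hprod, rfl⟩
  have hinj : Set.InjOn p0 (Substructure.closure L (Set.range h) : Set (∀ i, C i)) := by
    refine Set.injOn_of_ncard_image_eq ?_ (Set.toFinite _)
    exact le_antisymm (Set.ncard_image_le (Set.toFinite _)) (by rw [himg]; exact hle)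
  have hst' : s.realize (Sum.elim default h) = t.realize (Sum.elim default h) := by
    refine hinj ((mem_closure_range_iff h _).2 ⟨s, rfl⟩)
      ((mem_closure_range_iff h _).2 ⟨t, rfl⟩) ?_
    rw [← hom_realize, ← hom_realize, e0]
    exact hst
  have h1 : s.realize (Sum.elim default b') = t.realize (Sum.elim default b') := by
    rw [← e1, hom_realize, hom_realize, hst']
  have e2 : B.subtype.toHom ∘ b' = b := rfl
  rw [← e2, hom_realize, hom_realize, h1]

theorem stmt8 (L : FirstOrder.Language.{v, w}) [L.IsAlgebraic] [Finite L.Symbols]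
    (Φ : L.Sentence) (hU : IsUniversalSentence Φ)
    -- the class of all models of Φ is uniformly locally finite
    (hulf : UniformlyLocallyFinite.{u} L (fun (M : Type u) [L.Structure M] => M ⊨ Φ))
    -- the finite models of Φ are closed under substructures
    (hS : ∀ (M : Type u) [L.Structure M], Finite M → M ⊨ Φ →
      ∀ S : L.Substructure M, (↥S) ⊨ Φ)
    -- the finite models of Φ are closed under finite direct products
    (hP : ∀ (n : ℕ) (A : Fin n → Type u) (iA : ∀ i, L.Structure (A i)),
      (∀ i, Finite (A i)) → (∀ i, (A i) ⊨ Φ) → (∀ i, A i) ⊨ Φ)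
    -- the finite models of Φ are closed under surjective homomorphic images
    (hH : ∀ (M N : Type u) [L.Structure M] [L.Structure N], Finite M → Finite N →
      M ⊨ Φ → (∃ f : M →[L] N, Function.Surjective f) → N ⊨ Φ) :
    ∃ E : List L.Sentence, (∀ σ ∈ E, IsEquation σ) ∧
      ∀ (M : Type u) [L.Structure M], (M ⊨ Φ ↔ ∀ σ ∈ E, M ⊨ σ) := by
  obtain ⟨k, ψ, hψ, hΦ⟩ := id hU
  obtain ⟨A, iA, g, hfin, hA, hfree⟩ := exists_free Φ hU hulf hP k
  let F := Substructure.closure L (Set.range g)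
  have hF : F ⊨ Φ := hS A hfin hA F
  have hrep : ∀ x : F, ∃ t : L.Term (Empty ⊕ Fin k), t.realize (Sum.elim default g) = x :=
    fun x => (mem_closure_range_iff g _).1 x.2
  choose rep hrep using hrep
  let g' : Fin k → F := fun i => ⟨g i, Substructure.subset_closure ⟨i, rfl⟩⟩
  have hfinL : Finite (Σ n, L.Functions n) :=
    Finite.of_injective (Sum.inl : _ → L.Symbols) Sum.inl_injective
  let e1 : Fin k → L.Sentence := fun i =>
    ((Term.var (Sum.inr i) : L.Term (Empty ⊕ Fin k)).bdEqual (rep (g' i))).alls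
  let e2 : (Σ f : (Σ n, L.Functions n), (Fin f.1 → F)) → L.Sentence := fun q =>
    ((Term.func q.1.2 (fun i => rep (q.2 i)) : L.Term (Empty ⊕ Fin k)).bdEqual
      (rep (Structure.funMap q.1.2 q.2))).alls
  have hEfin : (Set.range e1 ∪ Set.range e2).Finite :=
    (Set.finite_range e1).union (Set.finite_range e2)
  refine ⟨hEfin.toFinset.toList, ?_, ?_⟩
  · intro σ hσ
    simp only [Finset.mem_toList, Set.Finite.mem_toFinset] at hσ
    rcases hσ with ⟨i, rfl⟩ | ⟨q, rfl⟩
    · exact ⟨k, _, _, rfl⟩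
    · exact ⟨k, _, _, rfl⟩
  intro M iM
  simp only [Finset.mem_toList, Set.Finite.mem_toFinset]
  constructor
  · intro hM σ hσ
    rcases hσ with ⟨i, rfl⟩ | ⟨q, rfl⟩
    · rw [realize_sentence_alls]
      intro b
      rw [BoundedFormula.realize_bdEqual]
      refine hfree M hM b _ _ ?_
      rw [hrep]
      rfl
    · rw [realize_sentence_alls]
      intro b
      rw [BoundedFormula.realize_bdEqual]
      refine hfree M hM b _ _ ?_
      rw [hrep]
      simp only [Term.realize_func, hrep]
      rfl
  · intro hM
    rw [hΦ, realize_sentence_alls]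
    intro a
    have h1 : ∀ i, a i = (rep (g' i)).realize (Sum.elim default a) := by
      intro i
      have := (realize_sentence_alls M _).1 (hM (e1 i) (Or.inl ⟨i, rfl⟩)) a
      rwa [BoundedFormula.realize_bdEqual] at this
    have h2 : ∀ (n : ℕ) (f : L.Functions n) (x : Fin n → F),
        Structure.funMap f (fun i => (rep (x i)).realize (Sum.elim default a)) =
          (rep (Structure.funMap f x)).realize (Sum.elim default a) := by
      intro n f x
      have := (realize_sentence_alls M _).1 (hM (e2 ⟨⟨n, f⟩, x⟩) (Or.inr ⟨_, rfl⟩)) a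
      rwa [BoundedFormula.realize_bdEqual] at this
    let φ : F →[L] M :=
      { toFun := fun x => (rep x).realize (Sum.elim default a)
        map_fun' := fun f x => (h2 _ f x).symm
        map_rel' := fun r => isEmptyElim r }
    have hsurj : Function.Surjective (φ.codRestrict φ.range (fun c => ⟨c, rfl⟩)) := by
      rintro ⟨_, c, rfl⟩
      exact ⟨c, rfl⟩
    have hN : φ.range ⊨ Φ :=
      hH F φ.range inferInstance (Finite.of_surjective _ hsurj) hF ⟨_, hsurj⟩
    rw [hΦ, realize_sentence_alls] at hN
    let a' : Fin k → φ.range := fun i => ⟨a i, g' i, (h1 i).symm⟩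
    exact (qf_embedding hψ φ.range.subtype a').2 (hN a')

end Stmt8
end

section
/- Let L be a finite first-order language and let Φ be a ∀*∃* L-sentence such that the class K of finite models of Φ is uniformly locally finite and closed under substructures. Then there is a universal L-sentence Ψ such that for every finite L-structure A, A ⊨ Φ if and only if A ⊨ Ψ. -/
open FirstOrder Language

universe u v w

namespace Stmt9

variable {L : FirstOrder.Language.{v, w}} {α : Type*}

/-- Existentially quantifies the last `k` bound variables of a bounded formula. -/
def exsN : ∀ {n k : ℕ}, L.BoundedFormula α (n + k) → L.BoundedFormula α n
  | _, 0, φ => φ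
  | _, _ + 1, φ => exsN φ.ex

/-- A `∀*∃*` sentence: universally quantified existentially quantified
quantifier-free formula. -/
def IsAESentence (Φ : L.Sentence) : Prop :=
  ∃ (m k : ℕ) (ψ : L.BoundedFormula Empty (m + k)),
    ψ.IsQF ∧ Φ = (exsN ψ : L.BoundedFormula Empty m).alls

/-- A sentence is universal if it is a universally quantified quantifier-free formula. -/
def IsUniversalSentence (Φ : L.Sentence) : Prop :=
  ∃ (m : ℕ) (ψ : L.BoundedFormula Empty m), ψ.IsQF ∧ Φ = ψ.alls

/-- A class of `L`-structures is uniformly locally finite if for every `n` there is an `m`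
such that in every member, subsets of size at most `n` generate substructures
of size at most `m`. -/
def UniformlyLocallyFinite (L : FirstOrder.Language.{v, w})
    (K : ∀ (M : Type u) [L.Structure M], Prop) : Prop :=
  ∀ n : ℕ, ∃ m : ℕ, ∀ (M : Type u) [L.Structure M], K M →
    ∀ s : Set M, s.Finite → s.ncard ≤ n →
      (Substructure.closure L s : Set M).Finite ∧
        (Substructure.closure L s : Set M).ncard ≤ m

/-- Terms of depth at most `j`. -/
def termsUpTo (L : FirstOrder.Language.{v, w}) (β : Type) : ℕ → Set (L.Term β)
  | 0 => Set.range Term.var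
  | j + 1 => Set.range Term.var ∪
      ⋃ f : (Σ l, L.Functions l),
        Set.range (fun ts : Fin f.1 → termsUpTo L β j => Term.func f.2 (fun i => (ts i).1))

theorem termsUpTo_finite (L : FirstOrder.Language.{v, w}) [Finite L.Symbols] (β : Type)
    [Finite β] (j : ℕ) : (termsUpTo L β j).Finite := by
  have : Finite (Σ l, L.Functions l) :=
    Finite.of_injective (Sum.inl : _ → L.Symbols) Sum.inl_injective
  induction j with
  | zero => exact Set.finite_range _
  | succ j ih =>
    have : Finite (termsUpTo L β j) := ih
    exact (Set.finite_range _).union (Set.finite_iUnion fun f => Set.finite_range _)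

theorem var_mem_termsUpTo (β : Type) (j : ℕ) (b : β) :
    (Term.var b : L.Term β) ∈ termsUpTo L β j := by
  cases j with
  | zero => exact ⟨b, rfl⟩
  | succ j => exact Or.inl ⟨b, rfl⟩

theorem func_mem_termsUpTo (β : Type) (j : ℕ) {l : ℕ} (f : L.Functions l)
    (ts : Fin l → L.Term β) (h : ∀ i, ts i ∈ termsUpTo L β j) :
    Term.func f ts ∈ termsUpTo L β (j + 1) :=
  Or.inr (Set.mem_iUnion.2 ⟨⟨l, f⟩, fun i => ⟨ts i, h i⟩, rfl⟩)

theorem termsUpTo_subset_succ (β : Type) (j : ℕ) :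
    termsUpTo L β j ⊆ termsUpTo L β (j + 1) := by
  induction j with
  | zero => exact Set.subset_union_left
  | succ j ih =>
    rintro t (ht | ht)
    · exact Or.inl ht
    · obtain ⟨⟨l, f⟩, ts, rfl⟩ := Set.mem_iUnion.1 ht
      exact func_mem_termsUpTo β _ f _ fun i => ih (ts i).2

theorem termsUpTo_mono (β : Type) : Monotone (termsUpTo L β) :=
  monotone_nat_of_le_succ (termsUpTo_subset_succ β)

theorem term_realize_mem_closure {M : Type u} [L.Structure M] {β : Type} (x : β → M)
    (t : L.Term β) : t.realize x ∈ Substructure.closure L (Set.range x) := by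
  induction t with
  | var b => exact Substructure.subset_closure ⟨b, rfl⟩
  | func f ts ih => exact (Substructure.closure L (Set.range x)).fun_mem f _ ih

/-- If the closure of `range x` has at most `N` elements, each of its elements is the value of a
term of depth at most `N + 1`. -/
theorem exists_term_of_mem_closure {M : Type u} [L.Structure M] {β : Type} (x : β → M) (N : ℕ)
    (hf : (Substructure.closure L (Set.range x) : Set M).Finite)
    (hN : (Substructure.closure L (Set.range x) : Set M).ncard ≤ N)
    {a : M} (ha : a ∈ Substructure.closure L (Set.range x)) :
    ∃ t ∈ termsUpTo L β (N + 1), t.realize x = a := by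
  let E : ℕ → Set M := fun j => (fun t : L.Term β => t.realize x) '' termsUpTo L β j
  have hmono : Monotone E := fun i j h => Set.image_mono (termsUpTo_mono β h)
  have hsub : ∀ j, E j ⊆ (Substructure.closure L (Set.range x) : Set M) := by
    rintro j _ ⟨t, -, rfl⟩
    exact term_realize_mem_closure x t
  have key : ∀ j, (∃ i ≤ j, E (i + 1) ⊆ E i) ∨ j ≤ (E j).ncard := by
    intro j
    induction j with
    | zero => exact Or.inr (Nat.zero_le _)
    | succ j ih =>
      rcases ih with ⟨i, hi, h⟩ | h
      · exact Or.inl ⟨i, by omega, h⟩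
      · by_cases hs : E (j + 1) ⊆ E j
        · exact Or.inl ⟨j, by omega, hs⟩
        · right
          have : (E j).ncard < (E (j + 1)).ncard :=
            Set.ncard_lt_ncard ⟨hmono (Nat.le_succ j), hs⟩ (hf.subset (hsub _))
          omega
  rcases key (N + 1) with ⟨i, hi, h⟩ | h
  · let S : L.Substructure M :=
      { carrier := E i
        fun_mem := by
          intro n f y hy
          choose ts hts hv using hy
          refine h ⟨Term.func f ts, func_mem_termsUpTo β i f ts hts, ?_⟩
          simp only [Term.realize_func]
          congr 1
          funext k
          exact hv k }
    have hS : Substructure.closure L (Set.range x) ≤ S := by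
      rw [Substructure.closure_le]
      rintro _ ⟨b, rfl⟩
      exact ⟨Term.var b, var_mem_termsUpTo β i b, rfl⟩
    exact hmono hi (hS ha)
  · have := Set.ncard_le_ncard (hsub (N + 1)) hf
    omega

theorem realize_exsN {M : Type u} [L.Structure M] {k : ℕ} : ∀ {n : ℕ}
    (φ : L.BoundedFormula α (n + k)) (x : α → M) (xs : Fin n → M),
    (exsN φ).Realize x xs ↔ ∃ ys : Fin k → M, φ.Realize x (Fin.append xs ys) := by
  induction k with
  | zero =>
    intro n φ x xs
    constructor
    · intro h
      refine ⟨Fin.elim0, ?_⟩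
      simpa [exsN] using h
    · rintro ⟨ys, h⟩
      have : ys = Fin.elim0 := Subsingleton.elim _ _
      subst this
      simpa [exsN] using h
  | succ k ih =>
    intro n φ x xs
    have h1 : (exsN φ : L.BoundedFormula α n) = exsN (k := k) (BoundedFormula.ex φ) := rfl
    rw [h1, ih]
    simp only [BoundedFormula.realize_ex]
    constructor
    · rintro ⟨ys, a, h⟩
      refine ⟨Fin.snoc ys a, ?_⟩
      rw [Fin.append_snoc]
      exact h
    · rintro ⟨ys, h⟩
      refine ⟨Fin.init ys, ys (Fin.last k), ?_⟩
      rw [← Fin.append_snoc, Fin.snoc_init_self]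
      exact h

/-- Substituting terms for the bound variables of a quantifier-free formula. -/
theorem exists_subst {n m : ℕ} {ψ : L.BoundedFormula Empty n} (h : ψ.IsQF)
    (σ : Fin n → L.Term (Empty ⊕ Fin m)) :
    ∃ θ : L.BoundedFormula Empty m, θ.IsQF ∧
      ∀ (M : Type u) [L.Structure M] (x : Empty → M) (xs : Fin m → M),
        θ.Realize x xs ↔ ψ.Realize x (fun i => (σ i).realize (Sum.elim x xs)) := by
  have aux : ∀ (t : L.Term (Empty ⊕ Fin n)) (M : Type u) [L.Structure M] (x : Empty → M)
      (xs : Fin m → M),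
      (t.subst (Sum.elim (fun e => Term.var (Sum.inl e)) σ)).realize (Sum.elim x xs) =
        t.realize (Sum.elim x (fun i => (σ i).realize (Sum.elim x xs))) := by
    intro t M _ x xs
    rw [Term.realize_subst]
    congr 1
    funext a
    rcases a with a | a <;> rfl
  induction h with
  | falsum => exact ⟨⊥, BoundedFormula.isQF_bot, fun M _ x xs => Iff.rfl⟩
  | of_isAtomic h =>
    cases h with
    | equal t₁ t₂ =>
      refine ⟨_, (BoundedFormula.IsAtomic.equal
        (t₁.subst (Sum.elim (fun e => Term.var (Sum.inl e)) σ))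
        (t₂.subst (Sum.elim (fun e => Term.var (Sum.inl e)) σ))).isQF, fun M _ x xs => ?_⟩
      simp only [BoundedFormula.realize_bdEqual, aux]
    | rel R ts =>
      refine ⟨_, (BoundedFormula.IsAtomic.rel R (fun i =>
        (ts i).subst (Sum.elim (fun e => Term.var (Sum.inl e)) σ))).isQF, fun M _ x xs => ?_⟩
      simp only [BoundedFormula.realize_rel, aux]
  | imp _ _ ih₁ ih₂ =>
    obtain ⟨θ₁, hq₁, h₁⟩ := ih₁
    obtain ⟨θ₂, hq₂, h₂⟩ := ih₂
    refine ⟨θ₁.imp θ₂, hq₁.imp hq₂, fun M _ x xs => ?_⟩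
    simp only [BoundedFormula.realize_imp, h₁, h₂]

/-- Finite disjunctions of quantifier-free formulas. -/
theorem exists_disj {ι : Type*} {m : ℕ} (θ : ι → L.BoundedFormula Empty m)
    (hθ : ∀ i, (θ i).IsQF) {s : Set ι} (hs : s.Finite) :
    ∃ χ : L.BoundedFormula Empty m, χ.IsQF ∧
      ∀ (M : Type u) [L.Structure M] (x : Empty → M) (xs : Fin m → M),
        χ.Realize x xs ↔ ∃ i ∈ s, (θ i).Realize x xs := by
  induction s, hs using Set.Finite.induction_on with
  | empty => exact ⟨⊥, BoundedFormula.isQF_bot, fun M _ x xs => by simp⟩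
  | insert _ _ ih =>
    rename_i a s _ _
    obtain ⟨χ, hq, h⟩ := ih
    refine ⟨θ a ⊔ χ, (hθ a).sup hq, fun M _ x xs => ?_⟩
    simp [BoundedFormula.realize_sup, h]

theorem stmt9 (L : FirstOrder.Language.{v, w}) [Finite L.Symbols]
    (Φ : L.Sentence) (hAE : IsAESentence Φ)
    -- the class of finite models of Φ is uniformly locally finite
    (hulf : UniformlyLocallyFinite.{u} L
      (fun (M : Type u) [L.Structure M] => Finite M ∧ M ⊨ Φ))
    -- the class of finite models of Φ is closed under substructures
    (hS : ∀ (M : Type u) [L.Structure M], Finite M → M ⊨ Φ →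
      ∀ S : L.Substructure M, (↥S) ⊨ Φ) :
    ∃ Ψ : L.Sentence, IsUniversalSentence Ψ ∧
      ∀ (M : Type u) [L.Structure M], Finite M → (M ⊨ Φ ↔ M ⊨ Ψ) := by
  obtain ⟨m, k, ψ, hψ, rfl⟩ := hAE
  obtain ⟨N, hN⟩ := hulf m
  let T := termsUpTo L (Empty ⊕ Fin m) (N + 1)
  have hT : T.Finite := termsUpTo_finite L _ _
  have hTk : (Set.pi Set.univ (fun _ : Fin k => T)).Finite := Set.Finite.pi fun _ => hT
  choose θ hθq hθ using fun τ : Fin k → L.Term (Empty ⊕ Fin m) =>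
    exists_subst.{u} hψ (Fin.append (fun i : Fin m => Term.var (Sum.inr i)) τ)
  obtain ⟨χ, hχq, hχ⟩ := exists_disj.{u} θ hθq hTk
  refine ⟨χ.alls, ⟨m, χ, hχq, rfl⟩, fun M _ hfin => ?_⟩
  have happ : ∀ (τ : Fin k → L.Term (Empty ⊕ Fin m)) (x : Empty → M) (xs : Fin m → M),
      (fun i => (Fin.append (fun i : Fin m => (Term.var (Sum.inr i) : L.Term (Empty ⊕ Fin m))) τ
        i).realize (Sum.elim x xs)) =
      Fin.append xs (fun i => (τ i).realize (Sum.elim x xs)) := by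
    intro τ x xs
    funext i
    refine Fin.addCases (fun i => ?_) (fun i => ?_) i <;> simp
  constructor
  · intro hM
    have hM' := hM
    unfold Sentence.Realize
    rw [BoundedFormula.realize_alls]
    intro xs
    rw [hχ]
    let x0 : Empty → M := default
    have hrange : Set.range (Sum.elim x0 xs) = Set.range xs := by
      rw [Set.Sum.elim_range, Set.range_eq_empty, Set.empty_union]
    have hcard : (Set.range xs).ncard ≤ m := by
      rw [← Set.image_univ]
      refine (Set.ncard_image_le Set.finite_univ).trans ?_
      simp [Set.ncard_univ]
    obtain ⟨hf, hc⟩ := hN M ⟨hfin, hM⟩ (Set.range xs) (Set.finite_range xs) hcard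
    have hSm := hS M hfin hM (Substructure.closure L (Set.range xs))
    unfold Sentence.Realize at hSm
    rw [BoundedFormula.realize_alls] at hSm
    have := hSm (fun i => ⟨xs i, Substructure.subset_closure ⟨i, rfl⟩⟩)
    rw [realize_exsN] at this
    obtain ⟨ys, hys⟩ := this
    have hex : ∀ i, ∃ t ∈ T, t.realize (Sum.elim x0 xs) = (ys i : M) := fun i =>
      exists_term_of_mem_closure (Sum.elim x0 xs) N (by rw [hrange]; exact hf)
        (by rw [hrange]; exact hc) (by rw [hrange]; exact (ys i).2)
    choose τ hτ hτv using hex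
    refine ⟨τ, fun i _ => hτ i, ?_⟩
    rw [hθ, happ]
    rw [← hψ.realize_embedding (Substructure.closure L (Set.range xs)).subtype] at hys
    convert hys using 1
    · funext i
      refine Fin.addCases (fun i => ?_) (fun i => ?_) i
      · simp
      · simp only [Fin.append_right, Function.comp_apply]
        rw [Subsingleton.elim (default : Empty → M) x0, hτv]
        rfl
  · intro hM
    unfold Sentence.Realize at hM ⊢
    rw [BoundedFormula.realize_alls] at hM ⊢
    intro xs
    rw [realize_exsN]
    obtain ⟨τ, -, h⟩ := (hχ M _ xs).1 (hM xs)
    rw [hθ, happ] at h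
    exact ⟨_, h⟩

end Stmt9
end

section
/- Let n be a natural number and let u, v ∈ FreeMonoid (Fin n). If for every finite J-trivial monoid M and every function φ : Fin n → M the induced monoid homomorphisms from FreeMonoid (Fin n) to M send u and v to the same element, then u = v. -/
namespace Stmt11

/-- A monoid is `J`-trivial if mutually divisible elements are equal. -/
def JTrivial (M : Type*) [Monoid M] : Prop :=
  ∀ a b : M, (∃ x y, x * a * y = b) → (∃ x y, x * b * y = a) → a = b

/-- Congruence identifying all words of length greater than `k`. -/
def longCon (n k : ℕ) : Con (FreeMonoid (Fin n)) where
  r a b := a = b ∨ (k < a.length ∧ k < b.length)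
  iseqv := by
    refine ⟨fun _ => Or.inl rfl, ?_, ?_⟩
    · rintro a b (h | h)
      · exact Or.inl h.symm
      · exact Or.inr h.symm
    · rintro a b c (rfl | h) (rfl | h')
      · exact Or.inl rfl
      · exact Or.inr h'
      · exact Or.inr h
      · exact Or.inr ⟨h.1, h'.2⟩
  mul' := by
    rintro a b c d (rfl | h) (rfl | h')
    · exact Or.inl rfl
    all_goals
      right
      simp only [FreeMonoid.length_mul]
      omega

theorem longCon_iff {n k : ℕ} {a b : FreeMonoid (Fin n)} :
    ((a : (longCon n k).Quotient) = b) ↔ a = b ∨ (k < a.length ∧ k < b.length) :=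
  (longCon n k).eq

theorem longCon_finite (n k : ℕ) : Finite (longCon n k).Quotient := by
  have hf : Finite {l : List (Fin n) // l.length ≤ k + 1} :=
    (List.finite_length_le (Fin n) (k + 1)).to_subtype
  refine Finite.of_surjective
    (fun l : {l : List (Fin n) // l.length ≤ k + 1} =>
      ((FreeMonoid.ofList l.1 : FreeMonoid (Fin n)) : (longCon n k).Quotient)) ?_
  intro q
  induction q using Con.induction_on with
  | H w =>
    refine ⟨⟨w.toList.take (k + 1), by simp⟩, ?_⟩
    apply longCon_iff.2
    by_cases hw : w.toList.length ≤ k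
    · left
      show FreeMonoid.ofList (w.toList.take (k + 1)) = w
      rw [List.take_of_length_le (by omega)]
      rfl
    · right
      have h1 : k < (w.toList.take (k + 1)).length := by
        rw [List.length_take]; omega
      exact ⟨h1, not_le.1 hw⟩

theorem longCon_jTrivial (n k : ℕ) : JTrivial (longCon n k).Quotient := by
  intro a b
  induction a using Con.induction_on with
  | H a =>
  induction b using Con.induction_on with
  | H b =>
  rintro ⟨x, y, h1⟩ ⟨z, t, h2⟩
  induction x using Con.induction_on with
  | H x =>
  induction y using Con.induction_on with
  | H y =>
  induction z using Con.induction_on with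
  | H z =>
  induction t using Con.induction_on with
  | H t =>
  simp only [← Con.coe_mul] at h1 h2
  rw [longCon_iff] at h1 h2 ⊢
  have e1 : (x * a * y).length = x.length + a.length + y.length := by
    simp only [FreeMonoid.length_mul]
  have e2 : (z * b * t).length = z.length + b.length + t.length := by
    simp only [FreeMonoid.length_mul]
  rcases h1 with h1 | h1 <;> rcases h2 with h2 | h2
  · left
    rw [h1] at e1
    rw [h2] at e2
    have hx : x = 1 := FreeMonoid.length_eq_zero.1 (by omega)
    have hy : y = 1 := FreeMonoid.length_eq_zero.1 (by omega)
    simpa [hx, hy] using h1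
  · right
    rw [h1] at e1
    omega
  · right
    rw [h2] at e2
    omega
  · exact Or.inr ⟨h2.2, h1.2⟩

theorem stmt11 (n : ℕ) (u v : FreeMonoid (Fin n))
    (h : ∀ (M : Type) [Monoid M], Finite M → JTrivial M →
      ∀ φ : Fin n → M, FreeMonoid.lift φ u = FreeMonoid.lift φ v) :
    u = v := by
  have key := h (longCon n (u.length + v.length)).Quotient (longCon_finite _ _)
    (longCon_jTrivial _ _) (fun i => ((FreeMonoid.of i : FreeMonoid (Fin n)) : _))
  have e : FreeMonoid.lift (fun i => ((FreeMonoid.of i : FreeMonoid (Fin n)) :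
      (longCon n (u.length + v.length)).Quotient)) = (longCon n (u.length + v.length)).mk' := by
    apply FreeMonoid.hom_eq
    intro i
    simp
  rw [e] at key
  rcases longCon_iff.1 key with h | h
  · exact h
  · omega

end Stmt11
end

section
/- There is no set E of pairs of elements of FreeMonoid ℕ such that for every finite monoid M: M is J-trivial if and only if for every pair (u, v) ∈ E and every monoid homomorphism φ : FreeMonoid ℕ → M one has φ(u) = φ(v). That is, the class of finite J-trivial monoids is not the class of finite models of any set of monoid equations. -/
namespace Stmt12

/-- A monoid is `J`-trivial if mutually divisible elements are equal. -/
def JTrivial (M : Type*) [Monoid M] : Prop :=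
  ∀ a b : M, (∃ x y, x * a * y = b) → (∃ x y, x * b * y = a) → a = b

/-- `w` is a factor of `u`. -/
def Fac (u w : FreeMonoid ℕ) : Prop := ∃ a b, a * w * b = u

theorem Fac.left {u w z : FreeMonoid ℕ} (h : Fac u (w * z)) : Fac u w := by
  obtain ⟨a, b, h⟩ := h
  exact ⟨a, z * b, by rw [← h]; simp only [mul_assoc]⟩

theorem Fac.right {u w z : FreeMonoid ℕ} (h : Fac u (w * z)) : Fac u z := by
  obtain ⟨a, b, h⟩ := h
  exact ⟨a * w, b, by rw [← h]; simp only [mul_assoc]⟩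

/-- The Rees congruence collapsing all words that are not factors of `u`. -/
def facCon (u : FreeMonoid ℕ) : Con (FreeMonoid ℕ) where
  r w w' := w = w' ∨ (¬ Fac u w ∧ ¬ Fac u w')
  iseqv := by
    refine ⟨fun _ => Or.inl rfl, ?_, ?_⟩
    · rintro x y (h | h)
      · exact Or.inl h.symm
      · exact Or.inr h.symm
    · rintro x y z (rfl | h) (rfl | h')
      · exact Or.inl rfl
      · exact Or.inr h'
      · exact Or.inr h
      · exact Or.inr ⟨h.1, h'.2⟩
  mul' := by
    rintro w x y z (rfl | h) (rfl | h')
    · exact Or.inl rfl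
    · exact Or.inr ⟨fun k => h'.1 k.right, fun k => h'.2 k.right⟩
    · exact Or.inr ⟨fun k => h.1 k.left, fun k => h.2 k.left⟩
    · exact Or.inr ⟨fun k => h.1 k.left, fun k => h.2 k.left⟩

theorem facCon_iff {u w w' : FreeMonoid ℕ} :
    ((w : (facCon u).Quotient) = w') ↔ (w = w' ∨ (¬ Fac u w ∧ ¬ Fac u w')) :=
  (facCon u).eq

theorem fac_finite (u : FreeMonoid ℕ) : {w | Fac u w}.Finite := by
  refine (List.finite_toSet (List.sublists (FreeMonoid.toList u))).subset ?_
  rintro w ⟨a, b, h⟩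
  refine List.mem_sublists.2 ?_
  have : List.IsInfix (FreeMonoid.toList w) (FreeMonoid.toList u) :=
    ⟨FreeMonoid.toList a, FreeMonoid.toList b, by
      rw [← h]; rfl⟩
  exact this.sublist

theorem quot_finite (u : FreeMonoid ℕ) : Finite (facCon u).Quotient := by
  have h1 : ((fun w : FreeMonoid ℕ => (w : (facCon u).Quotient)) '' {w | Fac u w}).Finite :=
    (fac_finite u).image _
  have h2 : ((fun w : FreeMonoid ℕ => (w : (facCon u).Quotient)) '' {w | ¬ Fac u w}).Finite := by
    refine Set.Subsingleton.finite ?_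
    rintro _ ⟨w, hw, rfl⟩ _ ⟨w', hw', rfl⟩
    exact facCon_iff.2 (Or.inr ⟨hw, hw'⟩)
  refine Set.finite_univ_iff.1 ((h1.union h2).subset ?_)
  intro q _
  induction q using Con.induction_on with
  | _ w =>
    by_cases h : Fac u w
    · exact Or.inl ⟨w, h, rfl⟩
    · exact Or.inr ⟨w, h, rfl⟩

theorem quot_jtrivial (u : FreeMonoid ℕ) : JTrivial (facCon u).Quotient := by
  rintro a b ⟨x, y, h⟩ ⟨x', y', h'⟩
  induction a using Con.induction_on with | _ a
  induction b using Con.induction_on with | _ b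
  induction x using Con.induction_on with | _ x
  induction y using Con.induction_on with | _ y
  induction x' using Con.induction_on with | _ x'
  induction y' using Con.induction_on with | _ y'
  simp only [← Con.coe_mul] at h h'
  rw [facCon_iff] at h h' ⊢
  rcases h with h | h
  · rcases h' with h' | h'
    · left
      have e1 := congrArg FreeMonoid.length h
      have e2 := congrArg FreeMonoid.length h'
      simp only [FreeMonoid.length_mul] at e1 e2
      have hx : x = 1 := FreeMonoid.length_eq_zero.1 (by omega)
      have hy : y = 1 := FreeMonoid.length_eq_zero.1 (by omega)
      simpa [hx, hy] using h
    · right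
      exact ⟨h'.2, fun k => h'.2 (by rw [← h] at k; exact k.left.right)⟩
  · rcases h' with h' | h'
    · right
      exact ⟨fun k => h.2 (by rw [← h'] at k; exact k.left.right), h.2⟩
    · exact Or.inr ⟨h'.2, h.2⟩

theorem stmt12 :
    ¬ ∃ E : Set (FreeMonoid ℕ × FreeMonoid ℕ),
      ∀ (M : Type) [Monoid M], Finite M →
        (JTrivial M ↔ ∀ p ∈ E, ∀ φ : FreeMonoid ℕ →* M, φ p.1 = φ p.2) := by
  rintro ⟨E, hE⟩
  have triv : ∀ p ∈ E, p.1 = p.2 := by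
    intro p hp
    have h := (hE (facCon p.1).Quotient (quot_finite p.1)).1 (quot_jtrivial p.1) p hp
      (facCon p.1).mk'
    rcases facCon_iff.1 h with h | h
    · exact h
    · exact absurd ⟨1, 1, by simp⟩ h.1
  have hJ : JTrivial (Multiplicative (ZMod 2)) :=
    (hE (Multiplicative (ZMod 2)) inferInstance).2 (fun p hp φ => by rw [triv p hp])
  have := hJ (Multiplicative.ofAdd 0) (Multiplicative.ofAdd 1)
    ⟨Multiplicative.ofAdd 1, 1, by decide⟩ ⟨Multiplicative.ofAdd 1, 1, by decide⟩
  exact absurd this (by decide)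

end Stmt12
end

section
/- Let L_f be the first-order language consisting of a single unary function symbol f and no other symbols. There is no L_f-sentence φ such that for every finite L_f-structure A: A ⊨ φ if and only if there exists n ∈ ℕ with f^A iterated n+1 times equal to f^A iterated n times on every element of A (i.e., ∃ n, ∀ x ∈ A, (f^A)^[n+1](x) = (f^A)^[n](x)). -/
open FirstOrder Language

namespace Stmt13

/-- The functions of the language with a single unary function symbol. -/
abbrev unaryFunctions : ℕ → Type := fun n => match n with
  | 1 => Unit
  | _ => Empty

/-- The language consisting of a single unary function symbol `f` and nothing else. -/
abbrev Lf : FirstOrder.Language := ⟨unaryFunctions, fun _ => Empty⟩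

/-- The unary function symbol `f`. -/
abbrev fsym : Lf.Functions 1 := ()

/-- The interpretation of `f` in an `Lf`-structure. -/
def fInterp (A : Type*) [Lf.Structure A] : A → A :=
  fun x => Structure.funMap fsym ![x]

/-- A set with a partial action of ℤ (exact signed distances `E d p q`), without short cycles and with
enough elements; `f` is the shift by `-1`, except that it fixes the root. -/
structure Good (R : ℕ) (M : Type) [Lf.Structure M] where
  E : ℤ → M → M → Prop
  root : M
  top : M
  fin : Fintype M
  zero : ∀ p q, E 0 p q ↔ p = q
  symm : ∀ d p q, E d p q → E (-d) q p
  trans : ∀ d e p q s, E d p q → E e q s → E (d + e) p s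
  acyc : ∀ (d : ℤ) p, |d| ≤ R → E d p p → d = 0
  large : R < Fintype.card M
  ex : ∀ (d : ℤ) p, (∃ x, E d p x) ∨ (∃ j, d < j ∧ j ≤ 0 ∧ E j p root) ∨ (∃ j, 0 ≤ j ∧ j < d ∧ E j p top)
  rootmin : ∀ d x, E d root x → 0 ≤ d
  topmax : ∀ d x, E d top x → d ≤ 0
  froot : fInterp M root = root
  fE : ∀ p, p ≠ root → E (-1) p (fInterp M p)

section
variable {R : ℕ} {M N : Type} [Lf.Structure M] [Lf.Structure N]

theorem Good.uniq (g : Good R M) {d : ℤ} {p x y : M} (h : g.E d p x) (h' : g.E d p y) : x = y := by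
  have := g.trans _ _ _ _ _ (g.symm _ _ _ h) h'
  rw [neg_add_cancel] at this
  exact (g.zero _ _).1 this

theorem Good.shift (g : Good R M) {d : ℤ} {p x : M} (h : g.E d p x) (e : ℤ) (z : M) :
    g.E e x z ↔ g.E (d + e) p z := by
  constructor
  · exact g.trans _ _ _ _ _ h
  · intro h'
    have := g.trans _ _ _ _ _ (g.symm _ _ _ h) h'
    simpa using this

theorem Good.symm_iff (g : Good R M) (d : ℤ) (p q : M) : g.E d p q ↔ g.E (-d) q p :=
  ⟨g.symm _ _ _, fun h => by simpa using g.symm _ _ _ h⟩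

def Sim (g : Good R M) (h : Good R N) (r : ℕ) (P : Finset (M × N)) : Prop :=
  ∀ a ∈ P, ∀ b ∈ P, ∀ d : ℤ, |d| ≤ r → (g.E d a.1 b.1 ↔ h.E d a.2 b.2)

variable {g : Good R M} {h : Good R N}

theorem Sim.mono {r r' : ℕ} {P : Finset (M × N)} (H : Sim g h r P) (hr : r' ≤ r) : Sim g h r' P :=
  fun a ha b hb d hd => H a ha b hb d (hd.trans (by exact_mod_cast hr))

open Classical in
theorem Sim.insert {r : ℕ} {P : Finset (M × N)} (H : Sim g h r P) (hr : r ≤ R) (x : M) (y : N)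
    (hxy : ∀ a ∈ P, ∀ d : ℤ, |d| ≤ r → (g.E d x a.1 ↔ h.E d y a.2)) :
    Sim g h r (Insert.insert (x, y) P) := by
  have hR : (r : ℤ) ≤ R := by exact_mod_cast hr
  intro a ha b hb d hd
  rcases Finset.mem_insert.1 ha with rfl | ha <;> rcases Finset.mem_insert.1 hb with rfl | hb
  · constructor
    · intro k
      obtain rfl := g.acyc _ _ (hd.trans hR) k
      exact (h.zero _ _).2 rfl
    · intro k
      obtain rfl := h.acyc _ _ (hd.trans hR) k
      exact (g.zero _ _).2 rfl
  · exact hxy b hb d hd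
  · rw [g.symm_iff, h.symm_iff]
    exact hxy a ha (-d) (by rwa [abs_neg])
  · exact H a ha b hb d hd

open Classical in
theorem Sim.near {r k : ℕ} {P : Finset (M × N)} (H : Sim g h (r + k) P) (hr : r ≤ R) {x : M} {y : N}
    {d : ℤ} {a : M × N} (ha : a ∈ P) (hd : |d| ≤ k) (h1 : g.E d a.1 x) (h2 : h.E d a.2 y) :
    Sim g h r (Insert.insert (x, y) P) := by
  refine (H.mono (Nat.le_add_right _ _)).insert hr x y fun b hb e he => ?_
  rw [g.shift h1, h.shift h2]
  apply H a ha b hb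
  have := abs_add_le d e
  push_cast
  linarith

open Classical in
theorem ext_far (h : Good R N) (r : ℕ) (P : Finset (M × N)) (hc : P.card * (2 * r + 1) ≤ R) :
    ∃ y, ∀ a ∈ P, ∀ d : ℤ, |d| ≤ r → ¬ h.E d a.2 y := by
  by_contra! hcon
  choose a ha d hd hE using hcon
  letI := h.fin
  have := Finset.card_le_card_of_injOn (s := (Finset.univ : Finset N))
    (t := P ×ˢ Finset.Icc (-(r : ℤ)) r) (fun y => (a y, d y))
    (fun y _ => by
      have := abs_le.1 (hd y)
      simp [ha y, this.1, this.2])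
    (fun y _ z _ hyz => by
      simp only [Prod.mk.injEq] at hyz
      have h1 := hE y
      rw [hyz.1, hyz.2] at h1
      exact h.uniq h1 (hE z))
  rw [Finset.card_product, Int.card_Icc] at this
  have h2 : ((r : ℤ) + 1 - -(r : ℤ)).toNat = 2 * r + 1 := by omega
  rw [h2] at this
  have h3 := h.large
  rw [Finset.card_univ] at this
  omega

open Classical in
theorem Sim.ext {r : ℕ} {P : Finset (M × N)} (H : Sim g h (r + r) P) (hr : r ≤ R)
    (hroot : (g.root, h.root) ∈ P) (htop : (g.top, h.top) ∈ P)
    (hc : P.card * (2 * r + 1) ≤ R) (x : M) : ∃ y, Sim g h r (Insert.insert (x, y) P) := by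
  by_cases hx : ∃ a ∈ P, ∃ d : ℤ, |d| ≤ r ∧ g.E d a.1 x
  · obtain ⟨a, ha, d, hd, hE⟩ := hx
    have hd' := abs_le.1 hd
    rcases h.ex d a.2 with ⟨y, hy⟩ | ⟨j, hj1, hj2, hj⟩ | ⟨j, hj1, hj2, hj⟩
    · exact ⟨y, H.near hr ha hd hE hy⟩
    · exfalso
      rw [← H a ha _ hroot j (by rw [abs_le]; push_cast; constructor <;> omega)] at hj
      have := g.rootmin _ _ (g.trans _ _ _ _ _ (g.symm _ _ _ hj) hE)
      omega
    · exfalso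
      rw [← H a ha _ htop j (by rw [abs_le]; push_cast; constructor <;> omega)] at hj
      have := g.topmax _ _ (g.trans _ _ _ _ _ (g.symm _ _ _ hj) hE)
      omega
  · obtain ⟨y, hy⟩ := ext_far h r P hc
    refine ⟨y, (H.mono (Nat.le_add_right _ _)).insert hr x y fun a ha d hd => ?_⟩
    rw [g.symm_iff, h.symm_iff]
    push Not at hx
    exact iff_of_false (hx a ha (-d) (by rwa [abs_neg])) (hy a ha (-d) (by rwa [abs_neg]))

theorem Sim.flip {r : ℕ} {P : Finset (M × N)} (H : Sim g h r P) :
    Sim h g r (P.map (Equiv.prodComm M N).toEmbedding) := by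
  intro a ha b hb d hd
  simp only [Finset.mem_map, Equiv.coe_toEmbedding] at ha hb
  obtain ⟨a, ha, rfl⟩ := ha
  obtain ⟨b, hb, rfl⟩ := hb
  exact (H a ha b hb d hd).symm

open Classical in
theorem Sim.step {r : ℕ} {P : Finset (M × N)} (H : Sim g h (r + 1) P) (hr : r ≤ R)
    (hroot : (g.root, h.root) ∈ P) {p : M} {q : N} (hp : (p, q) ∈ P) :
    Sim g h r (Insert.insert (fInterp M p, fInterp N q) P) := by
  have h0 := H _ hp _ hroot 0 (by simp; positivity)
  simp only [g.zero, h.zero] at h0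
  by_cases hpr : p = g.root
  · have hq := h0.1 hpr
    subst hpr
    subst hq
    rw [g.froot, h.froot, Finset.insert_eq_of_mem hroot]
    exact H.mono (Nat.le_succ _)
  · exact H.near (k := 1) hr hp (d := -1) (by simp) (g.fE _ hpr) (h.fE _ fun hq => hpr (h0.2 hq))

end

theorem term_lemma {α : Type} (t : Lf.Term α) : ∃ D : ℕ, ∀ (R r : ℕ) (M N : Type) [Lf.Structure M]
    [Lf.Structure N] (g : Good R M) (h : Good R N) (P : Finset (M × N)) (xs : α → M) (ys : α → N),
    r + D ≤ R → Sim g h (r + D) P → (g.root, h.root) ∈ P → (∀ i, (xs i, ys i) ∈ P) →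
    ∃ P', P ⊆ P' ∧ Sim g h r P' ∧ (t.realize xs, t.realize ys) ∈ P' := by
  classical
  induction t with
  | var i => exact ⟨0, fun R r M N _ _ g h P xs ys hR H _ hx => ⟨P, subset_rfl, H, hx i⟩⟩
  | @func n F ts ih =>
    match n, F, ts, ih with
    | 0, F, _, _ => exact F.elim
    | (n + 2), F, _, _ => exact F.elim
    | 1, F, ts, ih =>
      obtain ⟨D, hD⟩ := ih 0
      refine ⟨D + 1, fun R r M N _ _ g h P xs ys hR H hroot hx => ?_⟩
      obtain ⟨P', hP, hS, hm⟩ := hD R (r + 1) M N g h P xs ys (by omega)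
        (H.mono (by omega)) hroot hx
      refine ⟨_, hP.trans (Finset.subset_insert _ _), hS.step (by omega) (hP hroot) hm, ?_⟩
      have e1 : ∀ (K : Type) [Lf.Structure K] (zs : α → K),
          (Term.func F ts).realize zs = fInterp K ((ts 0).realize zs) := by
        intro K _ zs
        simp only [Term.realize, fInterp]
        congr 1
        funext i
        rw [Subsingleton.elim i 0]
        rfl
      rw [e1, e1]
      exact Finset.mem_insert_self _ _

theorem formula_lemma {n : ℕ} (φ : Lf.BoundedFormula Empty n) : ∃ R0 : ℕ, ∀ R ≥ R0,
    ∀ (M N : Type) [Lf.Structure M] [Lf.Structure N] (g : Good R M) (h : Good R N)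
    (P : Finset (M × N)) (v : Empty → M) (w : Empty → N) (xs : Fin n → M) (ys : Fin n → N),
    Sim g h R0 P → (g.root, h.root) ∈ P → (g.top, h.top) ∈ P → P.card ≤ n + 2 →
    (∀ i, (xs i, ys i) ∈ P) → (φ.Realize v xs ↔ φ.Realize w ys) := by
  classical
  induction φ with
  | falsum => exact ⟨0, fun R hR M N _ _ g h P v w xs ys _ _ _ _ _ => Iff.rfl⟩
  | @equal n t1 t2 =>
    obtain ⟨D1, h1⟩ := term_lemma t1
    obtain ⟨D2, h2⟩ := term_lemma t2
    refine ⟨D1 + D2, fun R hR M N _ _ g h P v w xs ys H hroot _ _ hx => ?_⟩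
    have hx' : ∀ i, (Sum.elim v xs i, Sum.elim w ys i) ∈ P := by
      rintro (i | i)
      · exact i.elim
      · exact hx i
    obtain ⟨P1, hP1, S1, m1⟩ := h1 R D2 M N g h P _ _ (by omega) (H.mono (by omega)) hroot hx'
    obtain ⟨P2, hP2, S2, m2⟩ := h2 R 0 M N g h P1 (Sum.elim v xs) (Sum.elim w ys) (by omega)
      (S1.mono (by omega)) (hP1 hroot) (fun i => hP1 (hx' i))
    have := S2 _ (hP2 m1) _ m2 0 (by simp)
    rw [g.zero, h.zero] at this
    exact this
  | rel r _ => exact r.elim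
  | imp _ _ ih1 ih2 =>
    obtain ⟨R1, h1⟩ := ih1
    obtain ⟨R2, h2⟩ := ih2
    refine ⟨R1 + R2, fun R hR M N _ _ g h P v w xs ys H hroot htop hc hx => ?_⟩
    rw [BoundedFormula.realize_imp, BoundedFormula.realize_imp,
      h1 R (by omega) M N g h P v w xs ys (H.mono (by omega)) hroot htop hc hx,
      h2 R (by omega) M N g h P v w xs ys (H.mono (by omega)) hroot htop hc hx]
  | @all n φ ih =>
    obtain ⟨r, hr⟩ := ih
    refine ⟨(n + 2) * (2 * r + 1), fun R hR M N _ _ g h P v w xs ys H hroot htop hc hx => ?_⟩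
    have hb : r + r ≤ (n + 2) * (2 * r + 1) := by nlinarith
    have hcR : P.card * (2 * r + 1) ≤ R := (Nat.mul_le_mul_right _ hc).trans hR
    have key : ∀ x y, Sim g h r (insert (x, y) P) →
        (φ.Realize v (Fin.snoc xs x) ↔ φ.Realize w (Fin.snoc ys y)) := by
      intro x y hS
      refine hr R (by omega) M N g h _ v w _ _ hS (Finset.mem_insert_of_mem hroot)
        (Finset.mem_insert_of_mem htop) ((Finset.card_insert_le _ _).trans (by omega)) ?_
      intro i
      refine Fin.lastCases ?_ (fun i => ?_) i
      · simp
      · simp only [Fin.snoc_castSucc]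
        exact Finset.mem_insert_of_mem (hx i)
    rw [BoundedFormula.realize_all, BoundedFormula.realize_all]
    constructor
    · intro hM y
      obtain ⟨x, hS⟩ := (H.mono hb).flip.ext (by omega)
        (by simpa using hroot) (by simpa using htop) (by rwa [Finset.card_map]) y
      refine (key x y ?_).1 (hM x)
      have := hS.flip
      intro a ha b hb'
      refine this a ?_ b ?_
      · simpa [Prod.ext_iff] using ha
      · simpa [Prod.ext_iff] using hb'
    · intro hN x
      obtain ⟨y, hS⟩ := (H.mono hb).ext (by omega) hroot htop hcR x
      exact (key x y hS).2 (hN y)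

/-- A path of length `N` into a fixed point, plus `Y`-many cycles of length `N + 1`. -/
abbrev Mod (N : ℕ) (Y : Type) : Type := Fin (N + 1) ⊕ (ZMod (N + 1) × Y)

def Mod.f {N : ℕ} {Y : Type} : Mod N Y → Mod N Y
  | Sum.inl i => Sum.inl ⟨i.1 - 1, by omega⟩
  | Sum.inr u => Sum.inr (u.1 - 1, u.2)

instance (N : ℕ) (Y : Type) : Lf.Structure (Mod N Y) where
  funMap {n} F := match n, F with
    | 0, F => F.elim
    | 1, _ => fun v => Mod.f (v 0)
    | (_ + 2), F => F.elim
  RelMap {_} r := r.elim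

theorem fInterp_mod (N : ℕ) (Y : Type) (x : Mod N Y) : fInterp (Mod N Y) x = Mod.f x := rfl

def Mod.E {N : ℕ} {Y : Type} (d : ℤ) : Mod N Y → Mod N Y → Prop
  | Sum.inl i, Sum.inl j => (j.1 : ℤ) = i.1 + d
  | Sum.inr u, Sum.inr v => v.1 = u.1 + (d : ZMod (N + 1)) ∧ u.2 = v.2
  | _, _ => False

noncomputable def modGood (N : ℕ) (Y : Type) [Fintype Y] : Good N (Mod N Y) where
  E := Mod.E
  root := Sum.inl ⟨0, by omega⟩
  top := Sum.inl ⟨N, by omega⟩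
  fin := inferInstanceAs (Fintype (Fin (N + 1) ⊕ (ZMod (N + 1) × Y)))
  zero := by
    rintro (⟨i, hi⟩ | ⟨u, y⟩) (⟨j, hj⟩ | ⟨v, z⟩)
    · simp only [Mod.E]
      constructor
      · intro h
        have : i = j := by omega
        subst this; rfl
      · intro h
        have h := Sum.inl.inj h
        simp only [Fin.mk.injEq] at h
        omega
    · simp only [Mod.E, false_iff]; exact Sum.inl_ne_inr
    · simp only [Mod.E, false_iff]; exact Sum.inr_ne_inl
    · simp only [Mod.E]
      constructor
      · rintro ⟨h1, rfl⟩
        simp at h1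
        subst h1; rfl
      · intro h
        have h := Sum.inr.inj h
        simp only [Prod.mk.injEq] at h
        simp [h.1, h.2]
  symm := by
    rintro d (⟨i, hi⟩ | ⟨u, y⟩) (⟨j, hj⟩ | ⟨v, z⟩) <;> simp only [Mod.E]
    · intro h; omega
    · exact id
    · exact id
    · rintro ⟨rfl, rfl⟩
      simp
  trans := by
    rintro d e (⟨i, hi⟩ | ⟨u, y⟩) (⟨j, hj⟩ | ⟨v, z⟩) (⟨k, hk⟩ | ⟨w, x⟩) <;> simp only [Mod.E] <;>
      try tauto
    · intro h h'; omega
    · rintro ⟨rfl, rfl⟩ ⟨rfl, rfl⟩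
      simp [add_assoc]
  acyc := by
    rintro d (⟨i, hi⟩ | ⟨u, y⟩) hd <;> simp only [Mod.E]
    · intro h; omega
    · rintro ⟨h, -⟩
      have h : ((d : ℤ) : ZMod (N + 1)) = 0 := by simpa using h
      rw [ZMod.intCast_zmod_eq_zero_iff_dvd] at h
      apply Int.eq_zero_of_abs_lt_dvd h
      push_cast
      omega
  large := by
    have : Fintype.card (Fin (N + 1) ⊕ (ZMod (N + 1) × Y)) =
      N + 1 + Fintype.card (ZMod (N + 1) × Y) := by simp
    exact lt_of_lt_of_eq (by omega) this.symm
  ex := by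
    rintro d (⟨i, hi⟩ | ⟨u, y⟩)
    · by_cases h1 : (i : ℤ) + d < 0
      · exact Or.inr (Or.inl ⟨-i, by omega, by omega, by simp [Mod.E]⟩)
      · by_cases h2 : (N : ℤ) < i + d
        · exact Or.inr (Or.inr ⟨N - i, by omega, by omega, by simp [Mod.E]⟩)
        · exact Or.inl ⟨Sum.inl ⟨(i + d).toNat, by omega⟩, by simp only [Mod.E]; omega⟩
    · exact Or.inl ⟨Sum.inr (u + d, y), by simp [Mod.E]⟩
  rootmin := by
    rintro d (⟨i, hi⟩ | ⟨u, y⟩) <;> simp only [Mod.E]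
    · intro h; push_cast at h; omega
    · exact False.elim
  topmax := by
    rintro d (⟨i, hi⟩ | ⟨u, y⟩) <;> simp only [Mod.E]
    · intro h; omega
    · exact False.elim
  froot := rfl
  fE := by
    rintro (⟨i, hi⟩ | ⟨u, y⟩) h
    · have : i ≠ 0 := by rintro rfl; exact h rfl
      rw [fInterp_mod]
      simp only [Mod.E, Mod.f]
      omega
    · rw [fInterp_mod]
      simp [Mod.E, Mod.f, sub_eq_add_neg]

theorem mod_iter (N : ℕ) (Y : Type) (n : ℕ) (i : Fin (N + 1)) :
    (fInterp (Mod N Y))^[n] (Sum.inl i) = Sum.inl ⟨i.1 - n, by omega⟩ := by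
  induction n with
  | zero => rfl
  | succ n ih =>
    rw [Function.iterate_succ_apply', ih]
    rfl

theorem mod_iter' (N : ℕ) (Y : Type) (n : ℕ) (u : ZMod (N + 1) × Y) :
    ∃ v, (fInterp (Mod N Y))^[n] (Sum.inr u) = Sum.inr v := by
  induction n with
  | zero => exact ⟨u, rfl⟩
  | succ n ih =>
    obtain ⟨v, hv⟩ := ih
    rw [Function.iterate_succ_apply', hv]
    exact ⟨_, rfl⟩

theorem stmt13 :
    ¬ ∃ φ : Lf.Sentence, ∀ (A : Type) [Lf.Structure A], Finite A →
      (A ⊨ φ ↔ ∃ n : ℕ, ∀ x : A, (fInterp A)^[n + 1] x = (fInterp A)^[n] x) := by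
  classical
  rintro ⟨φ, hφ⟩
  obtain ⟨R0, hR⟩ := formula_lemma φ
  let N := R0 + 1
  let g := modGood N Empty
  let h := modGood N Unit
  have key := hR N (by omega) _ _ g h {(g.root, h.root), (g.top, h.top)} default default
    default default (by
      intro a ha b hb d hd
      simp only [Finset.mem_insert, Finset.mem_singleton] at ha hb
      rcases ha with rfl | rfl <;> rcases hb with rfl | rfl <;> exact Iff.rfl)
    (by simp) (by simp) (Finset.card_le_two) (fun i => i.elim0)
  have h1 := (hφ (Mod N Empty) (@Finite.of_fintype _ g.fin)).2 ⟨N, by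
    rintro (i | u)
    · rw [mod_iter, mod_iter]
      congr 2
      omega
    · exact u.2.elim⟩
  have h2 : Mod N Unit ⊨ φ := key.1 h1
  obtain ⟨n, hn⟩ := (hφ (Mod N Unit) (@Finite.of_fintype _ h.fin)).1 h2
  obtain ⟨v, hv⟩ := mod_iter' N Unit n (0, ())
  have h3 := hn (Sum.inr (0, ()))
  rw [Function.iterate_succ_apply', hv] at h3
  have h4 := congrArg Prod.fst (Sum.inr.inj h3)
  simp only [sub_eq_self] at h4
  have : Fact (1 < N + 1) := ⟨by omega⟩
  exact one_ne_zero h4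

end Stmt13
end

section
/- Let L be a finite first-order language with only function symbols that contains a binary function symbol ∧, and let L₀ be a fixed finite L-structure in which the interpretation of ∧ is a semilattice operation (idempotent, commutative, associative). Then: (i) there is an L-sentence Ξ of the form ∃y₁…∃y_q ∀z₁…∀z_r ψ, with ψ quantifier-free, such that for every finite L-structure K in which ∧ is a semilattice operation, K ⊨ Ξ if and only if there is a surjective homomorphism from K onto L₀; and (ii) there is an L-formula ρ(x, y) in two free variables, of the form ∃y₁…∃y_q ∀z₁…∀z_r ψ with ψ quantifier-free, such that for every finite L-structure K in which ∧ is a semilattice operation and every pair a ≠ b in K, K ⊨ ρ(a, b) if and only if there is a surjective homomorphism φ from K onto L₀ with φ(a) ≠ φ(b). -/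
open FirstOrder Language

universe u v w

namespace Stmt16

variable {L : FirstOrder.Language.{v, w}} {α : Type*}

/-- Universally quantifies the last `k` bound variables of a bounded formula. -/
def allsN : ∀ {n k : ℕ}, L.BoundedFormula α (n + k) → L.BoundedFormula α n
  | _, 0, φ => φ
  | _, _ + 1, φ => allsN φ.all

/-- An `∃*∀*` formula (in free variables `α`): existentially quantified universally
quantified quantifier-free formula. -/
def IsEAFormula (φ : L.Formula α) : Prop :=
  ∃ (q r : ℕ) (ψ : L.BoundedFormula α (q + r)),
    ψ.IsQF ∧ φ = (allsN ψ : L.BoundedFormula α q).exs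

/-- The interpretation of the binary function symbol `w` in `M` is a semilattice
operation: idempotent, commutative and associative. -/
def IsSemilatticeOp (w : L.Functions 2) (M : Type*) [L.Structure M] : Prop :=
  (∀ x : M, Structure.funMap w ![x, x] = x) ∧
  (∀ x y : M, Structure.funMap w ![x, y] = Structure.funMap w ![y, x]) ∧
  (∀ x y z : M, Structure.funMap w ![x, Structure.funMap w ![y, z] ] =
    Structure.funMap w ![Structure.funMap w ![x, y], z])

theorem realize_allsN {M : Type*} [L.Structure M] (v : α → M) :
    ∀ {n k : ℕ} (φ : L.BoundedFormula α (n + k)) (xs : Fin n → M),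
      (allsN φ).Realize v xs ↔ ∀ ys : Fin k → M, φ.Realize v (Fin.append xs ys)
  | n, 0, φ, xs => by
    have h : ∀ ys : Fin 0 → M, Fin.append xs ys = xs := by
      intro ys
      rw [Subsingleton.elim ys Fin.elim0, Fin.append_elim0]
      rfl
    constructor
    · intro H ys
      rw [h ys]
      exact H
    · intro H
      have := H Fin.elim0
      rw [h] at this
      exact this
  | n, k + 1, φ, xs => by
    have IH := realize_allsN v (n := n) (k := k) φ.all xs
    have e : (allsN φ : L.BoundedFormula α n) = allsN (k := k) φ.all := by
      simp only [allsN]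
    rw [e, IH]
    constructor
    · intro H ys
      have := H (Fin.init ys) (ys (Fin.last k))
      rw [← Fin.append_snoc, Fin.snoc_init_self] at this
      exact this
    · intro H ys a
      have := H (Fin.snoc ys a)
      rw [Fin.append_snoc] at this
      exact this

/-- Uniform definability by a quantifier-free formula. -/
def QFD (L : FirstOrder.Language.{v, w}) (α : Type*) (n : ℕ)
    (P : ∀ (M : Type u) [L.Structure M], (α → M) → (Fin n → M) → Prop) : Prop :=
  ∃ ψ : L.BoundedFormula α n, ψ.IsQF ∧
    ∀ (M : Type u) [L.Structure M] (v : α → M) (xs : Fin n → M), ψ.Realize v xs ↔ P M v xs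

section
variable {n : ℕ} {P Q : ∀ (M : Type u) [L.Structure M], (α → M) → (Fin n → M) → Prop}

theorem QFD.imp (hP : QFD L α n P) (hQ : QFD L α n Q) :
    QFD L α n (fun M _ v xs => P M v xs → Q M v xs) := by
  obtain ⟨φ, h1, h2⟩ := hP
  obtain ⟨ψ, h3, h4⟩ := hQ
  exact ⟨φ.imp ψ, h1.imp h3, fun M _ v xs => by
    rw [BoundedFormula.realize_imp, h2, h4]⟩

theorem QFD.false : QFD.{u} L α n (fun _ _ _ _ => False) :=
  ⟨BoundedFormula.falsum, .falsum, fun _ _ _ _ => Iff.rfl⟩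

theorem QFD.congr (hP : QFD L α n P)
    (h : ∀ (M : Type u) [L.Structure M] (v : α → M) (xs : Fin n → M), P M v xs ↔ Q M v xs) :
    QFD L α n Q := by
  obtain ⟨φ, h1, h2⟩ := hP
  exact ⟨φ, h1, fun M _ v xs => (h2 M v xs).trans (h M v xs)⟩

theorem QFD.not (hP : QFD L α n P) : QFD L α n (fun M _ v xs => ¬ P M v xs) :=
  hP.imp QFD.false

theorem QFD.and (hP : QFD L α n P) (hQ : QFD L α n Q) :
    QFD L α n (fun M _ v xs => P M v xs ∧ Q M v xs) :=
  (hP.imp hQ.not).not.congr fun M _ v xs => by tauto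

theorem QFD.iff (hP : QFD L α n P) (hQ : QFD L α n Q) :
    QFD L α n (fun M _ v xs => (P M v xs ↔ Q M v xs)) :=
  ((hP.imp hQ).and (hQ.imp hP)).congr fun M _ v xs => by tauto

theorem QFD.const (p : Prop) : QFD.{u} L α n (fun _ _ _ _ => p) := by
  by_cases h : p
  · exact (QFD.not QFD.false).congr fun M _ v xs => by simp [h]
  · exact QFD.false.congr fun M _ v xs => by simp [h]

theorem QFD.eq (s t : L.Term (α ⊕ Fin n)) :
    QFD.{u} L α n (fun _ _ v xs => s.realize (Sum.elim v xs) = t.realize (Sum.elim v xs)) :=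
  ⟨s.bdEqual t, .of_isAtomic (.equal s t), fun _ _ _ _ => Iff.rfl⟩

theorem QFD.all {ι : Type*} [Finite ι]
    {P : ι → ∀ (M : Type u) [L.Structure M], (α → M) → (Fin n → M) → Prop}
    (hP : ∀ i, QFD L α n (P i)) : QFD L α n (fun M _ v xs => ∀ i, P i M v xs) := by
  classical
  have := Fintype.ofFinite ι
  have key : ∀ s : Finset ι, QFD L α n (fun M _ v xs => ∀ i ∈ s, P i M v xs) := by
    intro s
    induction s using Finset.induction_on with
    | empty => exact (QFD.const True).congr fun M _ v xs => by simp
    | insert a s _ ih =>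
      exact ((hP a).and ih).congr fun M _ v xs => by simp
  exact (key Finset.univ).congr fun M _ v xs => by simp

theorem QFD.ex {ι : Type*} [Finite ι]
    {P : ι → ∀ (M : Type u) [L.Structure M], (α → M) → (Fin n → M) → Prop}
    (hP : ∀ i, QFD L α n (P i)) : QFD L α n (fun M _ v xs => ∃ i, P i M v xs) :=
  (QFD.all fun i => (hP i).not).not.congr fun M _ v xs => by simp

end

/-- `x` lies above exactly those `n d` with `d ≤ c`. -/
def FF (w : L.Functions 2) {L₀ : Type*} [L.Structure L₀] {K : Type*} [L.Structure K]
    (n : L₀ → K) (c : L₀) (x : K) : Prop :=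
  ∀ d, (Structure.funMap w ![d, c] = d ↔ Structure.funMap w ![n d, x] = n d)

theorem QFD.ff (w : L.Functions 2) {L₀ : Type*} [L.Structure L₀] [Finite L₀] {n : ℕ}
    (e : L₀ → Fin n) (c : L₀) (t : L.Term (α ⊕ Fin n)) :
    QFD.{u} L α n (fun _ _ v xs => FF w (fun d => xs (e d)) c (t.realize (Sum.elim v xs))) := by
  refine QFD.all fun d => (QFD.const _).iff ?_
  refine (QFD.eq (Term.func w ![Term.var (Sum.inr (e d)), t]) (Term.var (Sum.inr (e d)))).congr ?_
  intro M _ v xs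
  simp only [Term.realize_func, Term.realize_var, Sum.elim_inr]
  have : (fun i => ((![Term.var (Sum.inr (e d)), t] : Fin 2 → L.Term (α ⊕ Fin n)) i).realize
      (Sum.elim v xs)) = ![xs (e d), t.realize (Sum.elim v xs)] := by
    funext i
    fin_cases i <;> simp
  rw [this]

theorem exists_min {w : L.Functions 2} {K : Type*} [L.Structure K] [Finite K]
    (hK : IsSemilatticeOp w K) (S : Set K) (hS : S.Nonempty)
    (hc : ∀ x ∈ S, ∀ y ∈ S, Structure.funMap w ![x, y] ∈ S) :
    ∃ m ∈ S, ∀ x ∈ S, Structure.funMap w ![m, x] = m := by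
  obtain ⟨h1, h2, h3⟩ := hK
  letI : Min K := ⟨fun x y => Structure.funMap w ![x, y]⟩
  letI : SemilatticeInf K := SemilatticeInf.mk' h2 (fun a b c => (h3 a b c).symm) h1
  have hfin : S.Finite := S.toFinite
  have hne : hfin.toFinset.Nonempty := by simpa using hS
  refine ⟨hfin.toFinset.inf' hne id, ?_, ?_⟩
  · exact Finset.inf'_induction hne id (p := fun x => x ∈ S) hc (by simp)
  · intro x hx
    have : hfin.toFinset.inf' hne id ≤ id x := Finset.inf'_le id (by simpa using hx)
    exact inf_eq_left.2 this

/-- The conditions on the tuple `n` of least preimages. -/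
def Good (w : L.Functions 2) {L₀ : Type*} [L.Structure L₀] {K : Type*} [L.Structure K]
    {ι : Type*} (a b : ι → K) (n : L₀ → K) : Prop :=
  (∀ x, ∃ c, FF w n c x) ∧ (∀ c, FF w n c (n c)) ∧
  (∀ (g : Σ l, L.Functions l) (c : Fin g.1 → L₀) (x : Fin g.1 → K),
    (∀ i, FF w n (c i) (x i)) → FF w n (Structure.funMap g.2 c) (Structure.funMap g.2 x)) ∧
  (∀ i c, ¬ (FF w n c (a i) ∧ FF w n c (b i)))

theorem FF.unique {w : L.Functions 2} {L₀ : Type*} [L.Structure L₀] {K : Type*} [L.Structure K]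
    (hL₀ : IsSemilatticeOp w L₀) {n : L₀ → K} {c d : L₀} {x : K}
    (h : FF w n c x) (h' : FF w n d x) : c = d := by
  have h1 : Structure.funMap w ![c, d] = c := (h' c).2 ((h c).1 (hL₀.1 c))
  have h2 : Structure.funMap w ![d, c] = d := (h d).2 ((h' d).1 (hL₀.1 d))
  rw [← h1, hL₀.2.1, h2]

theorem good_iff [L.IsAlgebraic] {w : L.Functions 2} {L₀ : Type*} [L.Structure L₀]
    {K : Type*} [L.Structure K] [Finite K] (hL₀ : IsSemilatticeOp w L₀)
    (hK : IsSemilatticeOp w K) {ι : Type*} (a b : ι → K) :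
    (∃ n : L₀ → K, Good w a b n) ↔
      ∃ f : K →[L] L₀, Function.Surjective f ∧ ∀ i, f (a i) ≠ f (b i) := by
  constructor
  · rintro ⟨n, h1, h2, h3, h4⟩
    choose f hf using h1
    refine ⟨⟨f, ?_, fun {k} R => ((inferInstance : L.IsAlgebraic) k).elim R⟩, ?_, ?_⟩
    · intro k g x
      exact (hf _).unique hL₀ (h3 ⟨k, g⟩ (f ∘ x) x fun i => hf _)
    · intro c
      exact ⟨n c, (hf _).unique hL₀ (h2 c)⟩
    · intro i hi
      have hi' : f (a i) = f (b i) := hi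
      exact h4 i (f (a i)) ⟨hf _, hi' ▸ hf _⟩
  · rintro ⟨f, hs, hab⟩
    have fm : ∀ x y, f (Structure.funMap w ![x, y]) = Structure.funMap w ![f x, f y] := by
      intro x y
      rw [f.map_fun]
      congr 1
      funext i
      fin_cases i <;> rfl
    obtain ⟨i1, i2, i3⟩ := id hL₀
    have hmin : ∀ c : L₀, ∃ m : K, f m = c ∧
        ∀ x, (Structure.funMap w ![c, f x] = c ↔ Structure.funMap w ![m, x] = m) := by
      intro c
      obtain ⟨y, hy⟩ := hs c
      obtain ⟨m, hm, hm'⟩ := exists_min hK {x | Structure.funMap w ![c, f x] = c}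
        ⟨y, by simp only [Set.mem_setOf_eq, hy, i1]⟩ (by
          intro x hx z hz
          simp only [Set.mem_setOf_eq] at hx hz ⊢
          rw [fm, i3, hx, hz])
      have hfm : f m = c := by
        have := hm' y (by simp only [Set.mem_setOf_eq, hy, i1])
        rw [← this, fm, hy, i2]
        exact hm
      refine ⟨m, hfm, fun x => ⟨fun h => hm' x h, fun h => ?_⟩⟩
      rw [← hfm, ← fm, h]
    choose n hn hn' using hmin
    have hF : ∀ x, FF w n (f x) x := fun x d => hn' d x
    have hF' : ∀ c x, FF w n c x → f x = c := fun c x h => (hF x).unique hL₀ h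
    refine ⟨n, fun x => ⟨f x, hF x⟩, fun c => ?_, ?_, ?_⟩
    · have := hF (n c)
      rwa [hn] at this
    · intro g c x h
      have : c = f ∘ x := funext fun i => (hF' _ _ (h i)).symm
      rw [this, ← f.map_fun]
      exact hF _
    · rintro i c ⟨h, h'⟩
      exact hab i ((hF' _ _ h).trans (hF' _ _ h').symm)

theorem main (L : FirstOrder.Language.{v, w}) [L.IsAlgebraic] [Finite L.Symbols]
    (w : L.Functions 2) (L₀ : Type u) [L.Structure L₀] [Finite L₀]
    (hL₀ : IsSemilatticeOp w L₀) {α ι : Type} [Finite ι] (a b : ι → α) :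
    ∃ φ : L.Formula α, IsEAFormula φ ∧
      ∀ (K : Type u) [L.Structure K], Finite K → IsSemilatticeOp w K → ∀ v : α → K,
        (φ.Realize v ↔
          ∃ f : K →[L] L₀, Function.Surjective f ∧ ∀ i, f (v (a i)) ≠ f (v (b i))) := by
  obtain ⟨q, ⟨e⟩⟩ := Finite.exists_equiv_fin L₀
  have hfin : Finite (Σ l, L.Functions l) :=
    Finite.of_injective (Sum.inl : _ → L.Symbols) Sum.inl_injective
  obtain ⟨R, hR⟩ : ∃ R : ℕ, ∀ g : Σ l, L.Functions l, g.1 ≤ R := by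
    obtain ⟨R, hR⟩ := (Set.finite_range (fun g : Σ l, L.Functions l => g.1)).bddAbove
    exact ⟨R, fun g => hR ⟨g, rfl⟩⟩
  let en : L₀ → Fin (q + (R + 1)) := fun c => Fin.castAdd (R + 1) (e c)
  let z : Fin (R + 1) → L.Term (α ⊕ Fin (q + (R + 1))) := fun j => Term.var (Sum.inr (Fin.natAdd q j))
  let em : ∀ g : Σ l, L.Functions l, Fin g.1 → Fin (R + 1) :=
    fun g i => Fin.castLE ((hR g).trans (Nat.le_succ R)) i
  obtain ⟨ψ, hψ, hr⟩ := ((QFD.ex.{u} fun c => QFD.ff w en c (z 0)).and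
    ((QFD.all fun c => QFD.ff w en c (Term.var (Sum.inr (en c)))).and
    ((QFD.all fun g : Σ l, L.Functions l => QFD.all fun c : Fin g.1 → L₀ =>
      (QFD.all fun i => QFD.ff w en (c i) (z (em g i))).imp
        (QFD.ff w en (Structure.funMap g.2 c) (Term.func g.2 fun i => z (em g i)))).and
    (QFD.all fun i : ι => QFD.all fun c : L₀ =>
      ((QFD.ff w en c (Term.var (Sum.inl (a i)))).and
        (QFD.ff w en c (Term.var (Sum.inl (b i))))).not))))
  refine ⟨(allsN ψ).exs, ⟨q, R + 1, ψ, hψ, rfl⟩, fun K _ _ hK v => ?_⟩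
  rw [← good_iff hL₀ hK, BoundedFormula.realize_exs]
  simp only [realize_allsN, hr]
  have hsplit : ∀ (xs : Fin q → K) (ys : Fin (R + 1) → K),
      (fun d => Fin.append xs ys (en d)) = fun d => xs (e d) := by
    intro xs ys
    funext d
    simp [en]
  simp only [hsplit, z, en, Term.realize_var, Term.realize_func, Sum.elim_inr, Sum.elim_inl,
    Fin.append_left, Fin.append_right]
  constructor
  · rintro ⟨xs, H⟩
    refine ⟨fun d => xs (e d), ?_, ?_, ?_, ?_⟩
    · intro x
      exact (H fun _ => x).1
    · intro c
      exact (H fun _ => xs (e c)).2.1 c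
    · intro g c x h
      have hx := (H fun j => if hj : (j : ℕ) < g.1 then x ⟨j, hj⟩ else
        Structure.funMap g.2 x).2.2.1 g c
      simp only [em, Fin.val_castLE, Fin.is_lt, dif_pos, Fin.eta] at hx
      exact hx h
    · intro i c
      exact (H fun _ => v (a i)).2.2.2 i c
  · rintro ⟨n, h1, h2, h3, h4⟩
    refine ⟨fun j => n (e.symm j), fun ys => ?_⟩
    simp only [Equiv.symm_apply_apply]
    exact ⟨h1 _, h2, fun g c h => h3 g c _ h, h4⟩

theorem stmt16 (L : FirstOrder.Language.{v, w}) [L.IsAlgebraic] [Finite L.Symbols]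
    (w : L.Functions 2) (L₀ : Type u) [L.Structure L₀] [Finite L₀]
    (hL₀ : IsSemilatticeOp w L₀) :
    -- (i) an ∃*∀* sentence expressing the existence of a surjective homomorphism onto L₀
    (∃ Ξ : L.Sentence, IsEAFormula Ξ ∧
      ∀ (K : Type u) [L.Structure K], Finite K → IsSemilatticeOp w K →
        (K ⊨ Ξ ↔ ∃ f : K →[L] L₀, Function.Surjective f)) ∧
    -- (ii) an ∃*∀* formula in two free variables expressing the existence of a surjective
    -- homomorphism onto L₀ separating the two given points
    (∃ ρ : L.Formula (Fin 2), IsEAFormula ρ ∧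
      ∀ (K : Type u) [L.Structure K], Finite K → IsSemilatticeOp w K →
        ∀ a b : K, a ≠ b →
          (ρ.Realize ![a, b] ↔
            ∃ f : K →[L] L₀, Function.Surjective f ∧ f a ≠ f b)) := by
  constructor
  · obtain ⟨φ, h, H⟩ := main L w L₀ hL₀ (α := Empty) (ι := Empty) Empty.elim Empty.elim
    refine ⟨φ, h, fun K _ hf hK => ?_⟩
    have := H K hf hK default
    simpa [Sentence.Realize] using this
  · obtain ⟨φ, h, H⟩ := main L w L₀ hL₀ (α := Fin 2) (ι := Unit) (fun _ => 0) (fun _ => 1)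
    refine ⟨φ, h, fun K _ hf hK a b _ => ?_⟩
    have := H K hf hK ![a, b]
    simpa using this

end Stmt16
end

section
/- Let L be a finite first-order language with only function symbols that contains a binary function symbol ∧, and let A be a finite L-structure in which the interpretation of ∧ is a semilattice operation (idempotent, commutative, associative). Suppose there are finitely many finite L-structures A₁, …, A_k, each lying in HSP(A), such that every subdirectly irreducible member of HSP(A) is isomorphic to one of A₁, …, A_k. Then there is an L-sentence φ such that for every finite L-structure B: B ⊨ φ if and only if B lies in HSP_fin(A), i.e. there exist n ∈ ℕ, a substructure S of the direct power A^n, and a surjective homomorphism from S onto B. -/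
open FirstOrder Language

universe u v w

namespace Stmt17

variable {L : FirstOrder.Language.{v, w}}

/-- The pointwise structure on a direct product of `L`-structures. -/
instance piStructure {ι : Type*} {M : ι → Type*}
    [∀ i, L.Structure (M i)] : L.Structure (∀ i, M i) where
  funMap f x i := Structure.funMap f fun j => x j i
  RelMap r x := ∀ i, Structure.RelMap r fun j => x j i

/-- The interpretation of the binary function symbol `w` in `M` is a semilattice
operation: idempotent, commutative and associative. -/
def IsSemilatticeOp (w : L.Functions 2) (M : Type*) [L.Structure M] : Prop :=
  (∀ x : M, Structure.funMap w ![x, x] = x) ∧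
  (∀ x y : M, Structure.funMap w ![x, y] = Structure.funMap w ![y, x]) ∧
  (∀ x y z : M, Structure.funMap w ![x, Structure.funMap w ![y, z] ] =
    Structure.funMap w ![Structure.funMap w ![x, y], z])

/-- A congruence on an `L`-structure (for an algebraic language): an equivalence relation
compatible with all the operations. -/
def IsCongruence (L : FirstOrder.Language.{v, w}) (C : Type u) [L.Structure C]
    (θ : C → C → Prop) : Prop :=
  Equivalence θ ∧ ∀ (n : ℕ) (f : L.Functions n) (a b : Fin n → C),
    (∀ i, θ (a i) (b i)) → θ (Structure.funMap f a) (Structure.funMap f b)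

/-- An `L`-structure is subdirectly irreducible if some pair `a ≠ b` belongs to every
congruence other than the equality relation. -/
def SubdirectlyIrreducible (L : FirstOrder.Language.{v, w}) (C : Type u)
    [L.Structure C] : Prop :=
  ∃ a b : C, a ≠ b ∧ ∀ θ : C → C → Prop, IsCongruence L C θ →
    θ ≠ (fun x y => x = y) → θ a b

/-- `B` lies in `HSP(A)`: it is a surjective homomorphic image of a substructure of a
direct power of `A` over some index set. -/
def InHSP (L : FirstOrder.Language.{v, w}) (A : Type u) [L.Structure A]
    (B : Type u) [L.Structure B] : Prop :=
  ∃ (ι : Type u) (S : L.Substructure (ι → A)) (f : S →[L] B), Function.Surjective f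

/-- `B` lies in `HSP_fin(A)`: it is a surjective homomorphic image of a substructure of a
finite direct power of `A`. -/
def InHSPfin (L : FirstOrder.Language.{v, w}) (A : Type u) [L.Structure A]
    (B : Type u) [L.Structure B] : Prop :=
  ∃ (n : ℕ) (S : L.Substructure (Fin n → A)) (f : S →[L] B), Function.Surjective f


/-! ### Algebraic part -/

/-- `R` is the graph of a surjective homomorphism from a substructure of `A^ι` onto `B`. -/
structure Good {A B ι : Type*} [L.Structure A] [L.Structure B] (R : (ι → A) → B → Prop) :
    Prop where
  functional : ∀ x b b', R x b → R x b' → b = b'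
  closed : ∀ (n : ℕ) (f : L.Functions n) (x : Fin n → ι → A) (b : Fin n → B),
    (∀ j, R (x j) (b j)) → R (Structure.funMap f x) (Structure.funMap f b)
  surj : ∀ b, ∃ x, R x b

theorem good_of_surj {A B ι : Type*} [L.Structure A] [L.Structure B]
    (S : L.Substructure (ι → A)) (f : S →[L] B) (hf : Function.Surjective f) :
    Good (L := L) (fun (x : ι → A) (b : B) => ∃ h : x ∈ S, f ⟨x, h⟩ = b) where
  functional := by
    rintro x b b' ⟨h, rfl⟩ ⟨h', rfl⟩
    rfl
  closed := by
    intro n g x b h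
    choose h1 h2 using h
    refine ⟨S.fun_mem g x h1, ?_⟩
    have := f.map_fun g (fun j => (⟨x j, h1 j⟩ : S))
    have e : b = f ∘ (fun j => (⟨x j, h1 j⟩ : S)) := by
      funext j
      exact (h2 j).symm
    rw [e, ← this]
    rfl
  surj := by
    intro b
    obtain ⟨x, rfl⟩ := hf b
    exact ⟨x.1, x.2, rfl⟩

theorem surj_of_good [L.IsAlgebraic] {A B ι : Type*} [L.Structure A] [L.Structure B]
    (R : (ι → A) → B → Prop) (hR : Good (L := L) R) :
    ∃ (S : L.Substructure (ι → A)) (f : S →[L] B), Function.Surjective f := by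
  let S : L.Substructure (ι → A) :=
    { carrier := {x | ∃ b, R x b}
      fun_mem := by
        intro n f x hx
        choose b hb using hx
        exact ⟨_, hR.closed n f x b hb⟩ }
  have hS : ∀ x : S, ∃ b, R x.1 b := fun x => x.2
  choose g hg using hS
  refine ⟨S, { toFun := g, map_fun' := ?_, map_rel' := ?_ }, ?_⟩
  · intro n f x
    refine hR.functional _ _ _ (hg _) ?_
    exact hR.closed n f (fun j => (x j).1) (g ∘ x) (fun j => hg (x j))
  · intro n r
    exact isEmptyElim r
  · intro b
    obtain ⟨x, hx⟩ := hR.surj b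
    exact ⟨⟨x, b, hx⟩, hR.functional _ _ _ (hg _) hx⟩

theorem inHSP_iff [L.IsAlgebraic] {A B : Type u} [L.Structure A] [L.Structure B] :
    InHSP L A B ↔ ∃ (ι : Type u) (R : (ι → A) → B → Prop), Good (L := L) R :=
  ⟨fun ⟨ι, S, f, hf⟩ => ⟨ι, _, good_of_surj S f hf⟩,
    fun ⟨ι, R, hR⟩ => ⟨ι, surj_of_good R hR⟩⟩

theorem good_precomp {A B ι κ : Type*} [L.Structure A] [L.Structure B]
    {R : (ι → A) → B → Prop} (hR : Good (L := L) R) (p : ι → κ)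
    (hp : ∀ b, ∃ y : κ → A, R (y ∘ p) b) :
    Good (L := L) (fun (y : κ → A) b => R (y ∘ p) b) where
  functional _ _ _ := hR.functional _ _ _
  closed n f x b h := hR.closed n f (fun j => x j ∘ p) b h
  surj := hp

theorem inHSPfin_of_inHSP [L.IsAlgebraic] {A B : Type u} [L.Structure A] [L.Structure B]
    [Finite A] [Finite B] (h : InHSP L A B) : InHSPfin L A B := by
  obtain ⟨ι, R, hR⟩ := inHSP_iff.1 h
  choose r hr using hR.surj
  obtain ⟨n, ⟨e⟩⟩ := Finite.exists_equiv_fin (B → A)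
  refine ⟨n, surj_of_good _ (good_precomp hR (fun i => e (fun b => r b i)) ?_)⟩
  intro b
  refine ⟨fun j => e.symm j b, ?_⟩
  convert hr b using 1
  funext i
  simp

theorem inHSP_of_inHSPfin [L.IsAlgebraic] {A B : Type u} [L.Structure A] [L.Structure B]
    (h : InHSPfin L A B) : InHSP L A B := by
  obtain ⟨n, S, f, hf⟩ := h
  refine ⟨ULift.{u} (Fin n), surj_of_good _ (good_precomp (good_of_surj S f hf) ULift.up ?_)⟩
  intro b
  obtain ⟨x, hx⟩ := (good_of_surj S f hf).surj b
  exact ⟨fun j => x j.down, hx⟩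

theorem inHSP_of_separated [L.IsAlgebraic] {A B : Type u} [L.Structure A] [L.Structure B]
    (h : ∀ a b : B, a ≠ b → ∃ (C : Type u) (_ : L.Structure C) (g : B →[L] C),
      InHSP L A C ∧ g a ≠ g b) : InHSP L A B := by
  have h' : ∀ p : {p : B × B // p.1 ≠ p.2}, ∃ (C : Type u) (_ : L.Structure C) (g : B →[L] C)
      (ι : Type u) (R : (ι → A) → C → Prop), Good (L := L) R ∧ g p.1.1 ≠ g p.1.2 := by
    intro p
    obtain ⟨C, i, g, hC, hg⟩ := h _ _ p.2
    obtain ⟨ι, R, hR⟩ := inHSP_iff.1 hC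
    exact ⟨C, i, g, ι, R, hR, hg⟩
  choose C iC g ι R hR hg using h'
  refine inHSP_iff.2 ⟨Σ p, ι p, fun x b => ∀ p, R p (fun i => x ⟨p, i⟩) (g p b), ?_, ?_, ?_⟩
  · intro x b b' h1 h2
    by_contra hne
    exact hg ⟨(b, b'), hne⟩ ((hR _).functional _ _ _ (h1 _) (h2 _))
  · intro n f x b h p
    rw [(g p).map_fun]
    exact (hR p).closed n f (fun j i => x j ⟨p, i⟩) _ (fun j => h j p)
  · intro b
    choose x hx using fun p => (hR p).surj (g p b)
    exact ⟨fun q => x q.1 q.2, hx⟩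

theorem inHSP_image [L.IsAlgebraic] {A B C : Type u} [L.Structure A] [L.Structure B]
    [L.Structure C] (h : InHSP L A B) (q : B →[L] C) (hq : Function.Surjective q) :
    InHSP L A C := by
  obtain ⟨ι, S, f, hf⟩ := h
  exact ⟨ι, S, q.comp f, hq.comp hf⟩

theorem isSemilatticeOp_of_inHSP [L.IsAlgebraic] {A B : Type u} [L.Structure A] [L.Structure B]
    (w : L.Functions 2) (hA : IsSemilatticeOp w A) (h : InHSP L A B) : IsSemilatticeOp w B := by
  obtain ⟨ι, R, hR⟩ := inHSP_iff.1 h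
  have hc : ∀ x y a b, R x a → R y b →
      R (fun i => Structure.funMap w ![x i, y i]) (Structure.funMap w ![a, b]) := by
    intro x y a b hx hy
    have := hR.closed 2 w ![x, y] ![a, b] (by
      intro j
      fin_cases j
      · exact hx
      · exact hy)
    convert this using 1
    funext i
    change _ = Structure.funMap w _
    congr 1
    funext j
    fin_cases j <;> rfl
  obtain ⟨h1, h2, h3⟩ := hA
  refine ⟨fun a => ?_, fun a b => ?_, fun a b c => ?_⟩
  · obtain ⟨x, hx⟩ := hR.surj a
    refine hR.functional x _ _ ?_ hx
    have := hc _ _ _ _ hx hx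
    simpa only [h1] using this
  · obtain ⟨x, hx⟩ := hR.surj a
    obtain ⟨y, hy⟩ := hR.surj b
    refine hR.functional _ _ _ (hc _ _ _ _ hx hy) ?_
    have := hc _ _ _ _ hy hx
    convert this using 2
    exact h2 _ _
  · obtain ⟨x, hx⟩ := hR.surj a
    obtain ⟨y, hy⟩ := hR.surj b
    obtain ⟨z, hz⟩ := hR.surj c
    refine hR.functional _ _ _ (hc _ _ _ _ hx (hc _ _ _ _ hy hz)) ?_
    have := hc _ _ _ _ (hc _ _ _ _ hx hy) hz
    convert this using 2
    exact h3 _ _ _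

/-- Quotient of a structure by a congruence. -/
theorem exists_quotient [L.IsAlgebraic] {B : Type u} [L.Structure B] (θ : B → B → Prop)
    (hθ : IsCongruence L B θ) :
    ∃ (C : Type u) (_ : L.Structure C) (q : B →[L] C), Function.Surjective q ∧
      ∀ x y, q x = q y ↔ θ x y := by
  let s : Setoid B := ⟨θ, hθ.1⟩
  let st : L.Structure (Quotient s) :=
    { funMap := fun f x => Quotient.mk s (Structure.funMap f fun j => (x j).out)
      RelMap := fun r => isEmptyElim r }
  refine ⟨Quotient s, st, { toFun := Quotient.mk s, map_fun' := ?_, map_rel' := ?_ }, ?_, ?_⟩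
  · intro n f x
    refine Quotient.sound (hθ.2 n f _ _ fun j => ?_)
    exact hθ.1.symm (Quotient.mk_out (s := s) (x j))
  · intro n r
    exact isEmptyElim r
  · exact Quotient.mk_surjective
  · intro x y
    exact Quotient.eq (r := s)

/-- Every pair of distinct elements of a finite algebra is separated by a subdirectly
irreducible quotient. -/
theorem exists_si_quotient [L.IsAlgebraic] {B : Type u} [L.Structure B] [Finite B] (a b : B)
    (hab : a ≠ b) :
    ∃ (C : Type u) (_ : L.Structure C) (q : B →[L] C), Function.Surjective q ∧
      q a ≠ q b ∧ SubdirectlyIrreducible L C := by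
  let T : Set (B → B → Prop) := {θ | IsCongruence L B θ ∧ ¬ θ a b}
  have hT : T.Nonempty := by
    refine ⟨fun x y => x = y, ⟨⟨fun _ => rfl, fun h => h.symm, fun h h' => h.trans h'⟩, ?_⟩, hab⟩
    intro n f x y h
    rw [funext h]
  obtain ⟨θ, hθ⟩ := (Set.toFinite T).exists_maximal hT
  obtain ⟨C, iC, q, hq, hqθ⟩ := exists_quotient θ hθ.prop.1
  have hne : q a ≠ q b := fun h => hθ.prop.2 ((hqθ _ _).1 h)
  refine ⟨C, iC, q, hq, hne, q a, q b, hne, ?_⟩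
  intro η hη hη'
  by_contra hcon
  apply hη'
  have hmem : (fun x y => η (q x) (q y)) ∈ T := by
    refine ⟨⟨⟨fun _ => hη.1.refl _, fun h => hη.1.symm h, fun h h' => hη.1.trans h h'⟩, ?_⟩, hcon⟩
    intro n f x y h
    rw [q.map_fun, q.map_fun]
    exact hη.2 n f _ _ h
  have hle : θ ≤ (fun x y => η (q x) (q y)) := by
    intro x y h
    rw [(hqθ x y).2 h]
    exact hη.1.refl _
  have hge := hθ.le_of_ge hmem hle
  funext x y
  obtain ⟨x, rfl⟩ := hq x
  obtain ⟨y, rfl⟩ := hq y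
  refine propext ⟨fun h => (hqθ _ _).2 (hge x y h), fun h => ?_⟩
  rw [h]
  exact hη.1.refl _

/-! ### Defining homomorphisms by parameters -/

/-- The semilattice order. -/
def Le (w : L.Functions 2) {M : Type*} [L.Structure M] (x y : M) : Prop :=
  Structure.funMap w ![x, y] = x

section order

variable {w : L.Functions 2} {M : Type*} [L.Structure M]

theorem Le.rfl' (hM : IsSemilatticeOp w M) (x : M) : Le w x x := hM.1 x

theorem Le.antisymm' (hM : IsSemilatticeOp w M) {x y : M} (h : Le w x y) (h' : Le w y x) : x = y := by
  unfold Le at h h'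
  rw [← h, hM.2.1, h']

theorem Le.trans' (hM : IsSemilatticeOp w M) {x y z : M} (h : Le w x y) (h' : Le w y z) : Le w x z := by
  unfold Le at *
  rw [← h, ← hM.2.2, h']

theorem Le.inf_left (hM : IsSemilatticeOp w M) (x y : M) : Le w (Structure.funMap w ![x, y]) x := by
  unfold Le
  rw [hM.2.1 x y, ← hM.2.2, hM.1]

theorem Le.inf_right (hM : IsSemilatticeOp w M) (x y : M) : Le w (Structure.funMap w ![x, y]) y := by
  unfold Le
  rw [← hM.2.2, hM.1]

theorem Le.le_inf (hM : IsSemilatticeOp w M) {x y z : M} (h : Le w z x) (h' : Le w z y) :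
    Le w z (Structure.funMap w ![x, y]) := by
  unfold Le at *
  rw [hM.2.2, h, h']

theorem Le.eq_of_forall (hM : IsSemilatticeOp w M) {x y : M} (h : ∀ t, Le w t x ↔ Le w t y) : x = y :=
  Le.antisymm' hM ((h x).1 (Le.rfl' hM x)) ((h y).2 (Le.rfl' hM y))

end order

theorem hom_inf {w : L.Functions 2} {B S : Type*} [L.Structure B] [L.Structure S]
    (h : B →[L] S) (x y : B) :
    h (Structure.funMap w ![x, y]) = Structure.funMap w ![h x, h y] := by
  rw [h.map_fun]
  congr 1
  funext j
  fin_cases j <;> rfl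

theorem exists_least {w : L.Functions 2} {B S : Type*} [L.Structure B] [L.Structure S]
    [Finite B] (hB : IsSemilatticeOp w B) (hS : IsSemilatticeOp w S)
    (h : B →[L] S) (hh : Function.Surjective h) (s : S) :
    ∃ c : B, ∀ x, Le w c x ↔ Le w s (h x) := by
  classical
  cases nonempty_fintype B
  have key : ∀ F : Finset B, ∃ c, Le w s (h c) ∧ ∀ x ∈ F, Le w s (h x) → Le w c x := by
    intro F
    induction F using Finset.induction_on with
    | empty =>
      obtain ⟨c, rfl⟩ := hh s
      exact ⟨c, Le.rfl' hS _, by simp⟩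
    | insert y F hy ih =>
      obtain ⟨c, hc, hcF⟩ := ih
      by_cases hys : Le w s (h y)
      · refine ⟨Structure.funMap w ![c, y], ?_, ?_⟩
        · rw [hom_inf]
          exact Le.le_inf hS hc hys
        · intro x hx hsx
          rcases Finset.mem_insert.1 hx with rfl | hx
          · exact Le.inf_right hB _ _
          · exact Le.trans' hB (Le.inf_left hB _ _) (hcF x hx hsx)
      · refine ⟨c, hc, ?_⟩
        intro x hx hsx
        rcases Finset.mem_insert.1 hx with rfl | hx
        · exact absurd hsx hys
        · exact hcF x hx hsx
  obtain ⟨c, hc, hc'⟩ := key Finset.univ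
  refine ⟨c, fun x => ⟨fun hx => ?_, fun hx => hc' x (Finset.mem_univ _) hx⟩⟩
  refine Le.trans' hS hc ?_
  unfold Le
  rw [← hom_inf, hx]

/-- The parameters `c` define a homomorphism to `S` separating `a` and `b`. -/
def Codes (w : L.Functions 2) (S : Type*) [L.Structure S] {B : Type*} [L.Structure B]
    (a b : B) (c : S → B) : Prop :=
  ((∀ x : B, ∃ s : S, ∀ t, (Le w (c t) x ↔ Le w t s)) ∧
  (∀ (f : Σ n, L.Functions n) (s : Fin f.1 → S), ∀ x : Fin f.1 → B,
    (∀ j t, (Le w (c t) (x j) ↔ Le w t (s j))) →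
      ∀ t, (Le w (c t) (Structure.funMap f.2 x) ↔ Le w t (Structure.funMap f.2 s)))) ∧
  ¬ ∀ t, (Le w (c t) a ↔ Le w (c t) b)

theorem codes_iff [L.IsAlgebraic] {w : L.Functions 2} {S B : Type*} [L.Structure S]
    [L.Structure B] (hS : IsSemilatticeOp w S) (a b : B) (c : S → B) (h : Codes w S a b c) :
    ∃ g : B →[L] S, g a ≠ g b := by
  obtain ⟨⟨h1, h2⟩, h3⟩ := h
  choose g hg using h1
  refine ⟨{ toFun := g, map_fun' := ?_, map_rel' := ?_ }, ?_⟩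
  · intro n f x
    refine Le.eq_of_forall hS fun t => ?_
    rw [← hg]
    exact h2 ⟨n, f⟩ (g ∘ x) x (fun j t => hg (x j) t) t
  · intro n r
    exact isEmptyElim r
  · intro hab
    apply h3
    intro t
    rw [hg, hg]
    change g a = g b at hab
    rw [hab]

theorem exists_codes {w : L.Functions 2} {S B : Type*} [L.Structure S]
    [L.Structure B] [Finite B] (hS : IsSemilatticeOp w S) (hB : IsSemilatticeOp w B) (a b : B)
    (g : B →[L] S) (hg : Function.Surjective g) (hab : g a ≠ g b) :
    ∃ c : S → B, Codes w S a b c := by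
  choose c hc using exists_least hB hS g hg
  refine ⟨c, ⟨fun x => ⟨g x, fun t => hc t x⟩, ?_⟩, ?_⟩
  · intro f s x hx t
    have : s = g ∘ x := by
      funext j
      refine Le.eq_of_forall hS fun t => ?_
      rw [← hx, hc]
      rfl
    rw [hc, this, g.map_fun]
  · intro h
    exact hab (Le.eq_of_forall hS fun t => by rw [← hc, ← hc, h])

/-! ### Definability -/

/-- A property of tuples, uniformly in all structures, defined by a first-order formula. -/
def Dfn (L : FirstOrder.Language.{v, w}) {α : Type*}
    (P : ∀ (B : Type u) [L.Structure B], (α → B) → Prop) : Prop :=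
  ∃ φ : L.Formula α, ∀ (B : Type u) [L.Structure B] (x : α → B), φ.Realize x ↔ P B x

section Dfn

variable {α β : Type*} {P Q : ∀ (B : Type u) [L.Structure B], (α → B) → Prop}

theorem Dfn.not (hP : Dfn L P) : Dfn L (fun B _ x => ¬ P B x) := by
  obtain ⟨φ, hφ⟩ := hP
  exact ⟨φ.not, fun B _ x => by rw [Formula.realize_not, hφ]⟩

theorem Dfn.imp (hP : Dfn L P) (hQ : Dfn L Q) : Dfn L (fun B _ x => P B x → Q B x) := by
  obtain ⟨φ, hφ⟩ := hP
  obtain ⟨ψ, hψ⟩ := hQ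
  exact ⟨φ.imp ψ, fun B _ x => by rw [Formula.realize_imp, hφ, hψ]⟩

theorem Dfn.iff (hP : Dfn L P) (hQ : Dfn L Q) : Dfn L (fun B _ x => (P B x ↔ Q B x)) := by
  obtain ⟨φ, hφ⟩ := hP
  obtain ⟨ψ, hψ⟩ := hQ
  exact ⟨φ.iff ψ, fun B _ x => by rw [Formula.realize_iff, hφ, hψ]⟩

theorem Dfn.and (hP : Dfn L P) (hQ : Dfn L Q) : Dfn L (fun B _ x => P B x ∧ Q B x) := by
  obtain ⟨φ, hφ⟩ := hP
  obtain ⟨ψ, hψ⟩ := hQ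
  exact ⟨φ ⊓ ψ, fun B _ x => by rw [Formula.realize_inf, hφ, hψ]⟩

theorem Dfn.const (p : Prop) : Dfn L (fun (B : Type u) _ (_ : α → B) => p) := by
  by_cases hp : p
  · exact ⟨⊤, fun B _ x => by simp [hp, Formula.realize_top]⟩
  · exact ⟨⊥, fun B _ x => by simp [hp, Formula.realize_bot]⟩

theorem Dfn.all_fin [Finite β] {P : β → ∀ (B : Type u) [L.Structure B], (α → B) → Prop}
    (hP : ∀ i, Dfn L (P i)) : Dfn L (fun B _ x => ∀ i, P i B x) := by
  choose φ hφ using hP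
  exact ⟨Formula.iInf φ, fun B _ x => by
    rw [Formula.realize_iInf]
    exact forall_congr' fun i => hφ i B x⟩

theorem Dfn.ex_fin [Finite β] {P : β → ∀ (B : Type u) [L.Structure B], (α → B) → Prop}
    (hP : ∀ i, Dfn L (P i)) : Dfn L (fun B _ x => ∃ i, P i B x) := by
  choose φ hφ using hP
  exact ⟨Formula.iSup φ, fun B _ x => by
    rw [Formula.realize_iSup]
    exact exists_congr fun i => hφ i B x⟩

theorem Dfn.all [Finite β] {P : ∀ (B : Type u) [L.Structure B], (α → B) → (β → B) → Prop}
    (hP : Dfn L (α := α ⊕ β) (fun B _ x => P B (fun i => x (Sum.inl i)) (fun i => x (Sum.inr i)))) :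
    Dfn L (fun B _ x => ∀ y : β → B, P B x y) := by
  obtain ⟨φ, hφ⟩ := hP
  exact ⟨φ.iAlls β, fun B _ x => by
    rw [Formula.realize_iAlls]
    exact forall_congr' fun y => hφ B _⟩

theorem Dfn.ex [Finite β] {P : ∀ (B : Type u) [L.Structure B], (α → B) → (β → B) → Prop}
    (hP : Dfn L (α := α ⊕ β) (fun B _ x => P B (fun i => x (Sum.inl i)) (fun i => x (Sum.inr i)))) :
    Dfn L (fun B _ x => ∃ y : β → B, P B x y) := by
  obtain ⟨φ, hφ⟩ := hP
  exact ⟨φ.iExs β, fun B _ x => by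
    rw [Formula.realize_iExs]
    exact exists_congr fun y => hφ B _⟩

theorem Dfn.le (w : L.Functions 2) (s t : L.Term α) :
    Dfn L (fun (B : Type u) _ (x : α → B) => Le w (s.realize x) (t.realize x)) :=
  ⟨(Term.func w ![s, t]).equal s, fun B _ x => by
    rw [Formula.realize_equal, Term.realize_func]
    change _ ↔ Structure.funMap w ![s.realize x, t.realize x] = s.realize x
    have : (fun i => (![s, t] i).realize x) = ![s.realize x, t.realize x] := by
      funext j
      fin_cases j <;> rfl
    rw [this]⟩

theorem Dfn.eq (i j : α) : Dfn L (fun (B : Type u) _ (x : α → B) => x i = x j) :=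
  ⟨(Term.var i).equal (Term.var j), fun B _ x => by
    rw [Formula.realize_equal]
    rfl⟩

theorem Dfn.codes [Finite (Σ n, L.Functions n)] (w : L.Functions 2) (S : Type*) [Finite S]
    [L.Structure S] (a b : α) (c : S → α) :
    Dfn L (fun (B : Type u) _ (x : α → B) => Codes w S (x a) (x b) (fun s => x (c s))) := by
  refine Dfn.and (Dfn.and ?_ ?_) (Dfn.not (Dfn.all_fin fun t => Dfn.iff ?_ ?_))
  · have : Dfn L (fun (B : Type u) _ (x : α → B) => ∀ y : Unit → B, ∃ s : S, ∀ t : S,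
        (Le w (x (c t)) (y ()) ↔ Le w t s)) := by
      refine Dfn.all (Dfn.ex_fin fun s => Dfn.all_fin fun t => Dfn.iff ?_ (Dfn.const _))
      exact Dfn.le w (Term.var (Sum.inl (c t))) (Term.var (Sum.inr ()))
    obtain ⟨φ, hφ⟩ := this
    refine ⟨φ, fun B _ x => (hφ B x).trans ⟨fun h z => h fun _ => z, fun h y => h (y ())⟩⟩
  · refine Dfn.all_fin fun f => Dfn.all_fin fun s => Dfn.all (Dfn.imp
      (Dfn.all_fin fun j => Dfn.all_fin fun t => Dfn.iff ?_ (Dfn.const _))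
      (Dfn.all_fin fun t => Dfn.iff ?_ (Dfn.const _)))
    · exact Dfn.le w (Term.var (Sum.inl (c t))) (Term.var (Sum.inr j))
    · exact Dfn.le w (Term.var (Sum.inl (c t))) (Term.func f.2 fun j => Term.var (Sum.inr j))
  · exact Dfn.le w (Term.var (c t)) (Term.var a)
  · exact Dfn.le w (Term.var (c t)) (Term.var b)

end Dfn

theorem stmt17 (L : FirstOrder.Language.{v, w}) [L.IsAlgebraic] [Finite L.Symbols]
    (w : L.Functions 2) (A : Type u) [L.Structure A] [Finite A]
    (hA : IsSemilatticeOp w A)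
    (k : ℕ) (Ai : Fin k → Type u) (iAi : ∀ i, L.Structure (Ai i))
    (hAifin : ∀ i, Finite (Ai i))
    (hAiHSP : ∀ i, InHSP L A (Ai i))
    -- every subdirectly irreducible member of HSP(A) is isomorphic to one of the Ai
    (hsi : ∀ (C : Type u) [L.Structure C], InHSP L A C → SubdirectlyIrreducible L C →
      ∃ i, Nonempty (C ≃[L] Ai i)) :
    ∃ φ : L.Sentence, ∀ (B : Type u) [L.Structure B], Finite B →
      (B ⊨ φ ↔ InHSPfin L A B) := by
  have hfin : Finite (Σ n, L.Functions n) :=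
    Finite.of_injective (Sum.inl : _ → L.Symbols) Sum.inl_injective
  have hD : Dfn.{u} L (α := Empty) (fun (B : Type u) _ _ => ∀ y : Bool → B,
      ¬ y true = y false → ∃ i, ∃ c : Ai i → B, Codes w (Ai i) (y true) (y false) c) := by
    refine Dfn.all (Dfn.imp (Dfn.not (Dfn.eq _ _)) (Dfn.ex_fin fun i => Dfn.ex ?_))
    exact Dfn.codes w (Ai i) (Sum.inl (Sum.inr true)) (Sum.inl (Sum.inr false)) Sum.inr
  obtain ⟨φ, hφ⟩ := hD
  refine ⟨φ, fun B _ hBfin => ?_⟩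
  rw [Sentence.Realize, hφ]
  constructor
  · intro h
    refine inHSPfin_of_inHSP (inHSP_of_separated fun a b hab => ?_)
    obtain ⟨i, c, hc⟩ := h (fun t => if t then a else b) (by simpa using hab)
    obtain ⟨g, hg⟩ := codes_iff (isSemilatticeOp_of_inHSP w hA (hAiHSP i)) _ _ c hc
    exact ⟨Ai i, iAi i, g, hAiHSP i, by simpa using hg⟩
  · intro h y hy
    have hB := inHSP_of_inHSPfin h
    obtain ⟨C, iC, q, hq, hqab, hC⟩ := exists_si_quotient (L := L) _ _ hy
    obtain ⟨i, ⟨e⟩⟩ := hsi C (inHSP_image hB q hq) hC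
    refine ⟨i, exists_codes (isSemilatticeOp_of_inHSP w hA (hAiHSP i))
      (isSemilatticeOp_of_inHSP w hA hB) _ _ (e.toHom.comp q) ?_ ?_⟩
    · exact e.surjective.comp hq
    · intro heq
      exact hqab (e.injective heq)

end Stmt17
end
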